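/- arXiv:1706.04019 — 7 statements merged into one kernel-verified Lean document; each statement's English description precedes it below -/
import Mathlib

section
/- Let N be a Young function whose left derivative N'₋ satisfies N'₋(s) > 0 for all s > 0 and c_N := inf_{s>0} N(s)/(s N'₋(s)) > 0. If κ > 0 is a constant such that N^{-1}(μ(A)^{-1}) · J(A×Aᶜ) ≥ κ for every measurable set A ⊆ E with 0 < μ(A) < ∞, then ‖f‖_N ≤ (1/(2 c_N κ)) ∫_{E×E} |f(x) − f(y)| J(dx,dy) for all f ∈ L_N(μ). -/
open MeasureTheory ENNReal NNReal Filter Set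

noncomputable section

/-- A Young function: a convex, increasing function `N : [0,∞) → [0,∞]` with
`N 0 = 0` and `N(s) → ∞` as `s → ∞`. -/
structure YoungFunction where
  toFun : ℝ≥0 → ℝ≥0∞
  map_zero : toFun 0 = 0
  mono : Monotone toFun
  convex : ∀ (a b t : ℝ≥0), t ≤ 1 →
    toFun (t * a + (1 - t) * b) ≤ (t : ℝ≥0∞) * toFun a + ((1 - t : ℝ≥0) : ℝ≥0∞) * toFun b
  tendsto_top : Tendsto toFun atTop (nhds ⊤)

/-- The Orlicz (Luxemburg) norm `‖f‖_N = inf { r > 0 : ∫ N(|f|/r) dμ ≤ 1 }`,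
with `inf ∅ = ∞`. -/
def orliczNorm {E : Type*} [MeasurableSpace E] (μ : Measure E)
    (N : ℝ≥0 → ℝ≥0∞) (f : E → ℝ) : ℝ≥0∞ :=
  ⨅ (r : ℝ≥0) (_ : 0 < r ∧ ∫⁻ x, N (‖f x‖₊ / r) ∂μ ≤ 1), (r : ℝ≥0∞)

/-- The generalized inverse `F⁻¹(r) = inf { s > 0 : F s ≥ r }` of a nonnegative
increasing function, with `inf ∅ = ∞`. -/
def invIncr (F : ℝ≥0 → ℝ≥0∞) (r : ℝ≥0∞) : ℝ≥0∞ :=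
  ⨅ (s : ℝ≥0) (_ : 0 < s ∧ r ≤ F s), (s : ℝ≥0∞)


lemma YF_convexOn (N : YoungFunction) (hfin : ∀ s, N.toFun s ≠ ⊤) :
    ConvexOn ℝ univ (fun x : ℝ => (N.toFun x.toNNReal).toReal) := by
  refine ⟨convex_univ, ?_⟩
  intro x _ y _ a b ha hb hab
  have h1 : (a • x + b • y).toNNReal ≤ a.toNNReal * x.toNNReal + (1 - a.toNNReal) * y.toNNReal := by
    have hb' : (1 - a.toNNReal) = b.toNNReal := by
      have : b = 1 - a := by linarith
      rw [this]; ext; rw [NNReal.coe_sub (by rw [Real.toNNReal_le_one]; linarith), Real.coe_toNNReal _ ha, Real.coe_toNNReal _ (by linarith)]; simp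
    rw [hb', ← Real.toNNReal_mul ha, ← Real.toNNReal_mul hb]
    exact Real.toNNReal_add_le
  have h2 : a.toNNReal ≤ 1 := by
    rw [Real.toNNReal_le_one]; linarith
  have h3 := (N.mono h1).trans (N.convex x.toNNReal y.toNNReal a.toNNReal h2)
  have hb' : (1 - a.toNNReal) = b.toNNReal := by
    have : b = 1 - a := by linarith
    rw [this]; ext; rw [NNReal.coe_sub (by rw [Real.toNNReal_le_one]; linarith), Real.coe_toNNReal _ ha, Real.coe_toNNReal _ (by linarith)]; simp
  rw [hb'] at h3
  have h4 := ENNReal.toReal_mono (by simp [ENNReal.mul_eq_top, hfin]) h3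
  rw [ENNReal.toReal_add (by simp [ENNReal.mul_eq_top, hfin]) (by simp [ENNReal.mul_eq_top, hfin])] at h4
  simpa [ha, hb] using h4

lemma YF_subgrad (N : YoungFunction) (hfin : ∀ s, N.toFun s ≠ ⊤) (b : ℝ≥0) :
    ∃ d : ℝ≥0, ∀ a : ℝ≥0, N.toFun b + d * a ≤ N.toFun a + d * b := by
  have hc := YF_convexOn N hfin
  set g : ℝ → ℝ := fun x : ℝ => (N.toFun x.toNNReal).toReal with hg
  have hi : ∀ x : ℝ, x ∈ interior (univ : Set ℝ) := by simp
  set d : ℝ := derivWithin g (Ioi (b : ℝ)) b with hd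
  have hleft : ∀ y < (b : ℝ), slope g y b ≤ d := fun y hy =>
    (hc.slope_le_leftDeriv_of_mem_interior (mem_univ y) (hi b) hy).trans
      (hc.leftDeriv_le_rightDeriv_of_mem_interior (hi b))
  have hright : ∀ y > (b : ℝ), d ≤ slope g b y := fun y hy =>
    hc.rightDeriv_le_slope_of_mem_interior (hi b) (mem_univ y) hy
  have hgm : Monotone g := fun x y h =>
    ENNReal.toReal_mono (hfin _) (N.mono (Real.toNNReal_mono h))
  have hd0 : 0 ≤ d := by
    refine le_trans ?_ (hleft (b - 1) (by linarith))
    rw [slope_def_field]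
    apply div_nonneg
    · linarith [hgm (show (b : ℝ) - 1 ≤ b by linarith)]
    · linarith
  refine ⟨d.toNNReal, fun a => ?_⟩
  have key : g b + d * a ≤ g a + d * b := by
    rcases lt_trichotomy (a : ℝ) b with h | h | h
    · have := hleft a h
      rw [slope_def_field, div_le_iff₀ (by linarith)] at this
      linarith
    · rw [h]
    · have := hright a h
      rw [slope_def_field, le_div_iff₀ (by linarith)] at this
      linarith
  have e1 : ∀ c : ℝ≥0, N.toFun c = ENNReal.ofReal (g c) := by
    intro c; simp [hg, hfin]
  have e2 : ∀ c : ℝ≥0, ((d.toNNReal : ℝ≥0∞)) * c = ENNReal.ofReal (d * c) := by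
    intro c; rw [ENNReal.ofReal_mul hd0]; simp [ENNReal.ofReal]
  rw [e1, e1, e2, e2, ← ENNReal.ofReal_add, ← ENNReal.ofReal_add]
  · exact ENNReal.ofReal_le_ofReal key
  all_goals positivity

lemma YF_le_of_lt (N : YoungFunction) (hfin : ∀ s, N.toFun s ≠ ⊤) (s : ℝ≥0) (hs : 0 < s)
    (C : ℝ≥0∞) (h : ∀ t < s, N.toFun t ≤ C) : N.toFun s ≤ C := by
  obtain ⟨d, hd⟩ := YF_subgrad N hfin s
  have h1 : ∀ᶠ t : ℝ≥0 in nhdsWithin s (Iio s), N.toFun s + d * (t : ℝ≥0∞) ≤ C + d * s := by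
    filter_upwards [self_mem_nhdsWithin] with t ht
    exact (hd t).trans (by gcongr; exact h t ht)
  have hne : (nhdsWithin s (Iio s)).NeBot := nhdsLT_neBot_of_exists_lt ⟨0, hs⟩
  have h2 : Tendsto (fun t : ℝ≥0 => N.toFun s + d * (t : ℝ≥0∞)) (nhdsWithin s (Iio s))
      (nhds (N.toFun s + d * (s : ℝ≥0∞))) := by
    apply Tendsto.mono_left _ nhdsWithin_le_nhds
    apply Tendsto.add tendsto_const_nhds
    exact ENNReal.Tendsto.const_mul (ENNReal.tendsto_coe.2 tendsto_id) (by simp)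
  have h3 := le_of_tendsto h2 h1
  exact (ENNReal.add_le_add_iff_right (by finiteness)).1 h3

lemma YF_finite (N : YoungFunction) (D : ℝ≥0 → ℝ≥0∞)
    (hD : ∀ s : ℝ≥0, 0 < s →
      Tendsto (fun t : ℝ≥0 => (N.toFun s - N.toFun t) / ((s - t : ℝ≥0) : ℝ≥0∞))
        (nhdsWithin s (Iio s)) (nhds (D s)))
    (hDpos : ∀ s : ℝ≥0, 0 < s → 0 < D s) (s : ℝ≥0) : N.toFun s ≠ ⊤ := by
  intro hs
  have hp : (0 : ℝ≥0) < s + 1 := by positivity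
  have hne : (nhdsWithin (s + 1) (Iio (s + 1))).NeBot := nhdsLT_neBot_of_exists_lt ⟨0, hp⟩
  have h1 := hD (s + 1) hp
  have h2 : Tendsto (fun t : ℝ≥0 => (N.toFun (s+1) - N.toFun t) / (((s+1) - t : ℝ≥0) : ℝ≥0∞))
        (nhdsWithin (s+1) (Iio (s+1))) (nhds 0) := by
    apply tendsto_const_nhds.congr'
    have : Ioi s ∈ nhds (s + 1) := Ioi_mem_nhds (lt_add_one s)
    filter_upwards [mem_nhdsWithin_of_mem_nhds this] with t ht
    have : N.toFun t = ⊤ := top_le_iff.1 (hs ▸ N.mono (le_of_lt ht))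
    rw [this]; simp
  exact (hDpos _ hp).ne' (tendsto_nhds_unique h1 h2)

lemma YF_c_le_one (N : YoungFunction) (D : ℝ≥0 → ℝ≥0∞)
    (hD : ∀ s : ℝ≥0, 0 < s →
      Tendsto (fun t : ℝ≥0 => (N.toFun s - N.toFun t) / ((s - t : ℝ≥0) : ℝ≥0∞))
        (nhdsWithin s (Iio s)) (nhds (D s)))
    (hfin : ∀ s, N.toFun s ≠ ⊤) :
    (⨅ (s : ℝ≥0) (_ : 0 < s), N.toFun s / ((s : ℝ≥0∞) * D s)) ≤ 1 := by
  refine (iInf₂_le (1 : ℝ≥0) one_pos).trans ?_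
  apply ENNReal.div_le_of_le_mul
  simp only [ENNReal.coe_one, one_mul]
  have hne : (nhdsWithin (1 : ℝ≥0) (Iio 1)).NeBot := nhdsLT_neBot_of_exists_lt ⟨0, one_pos⟩
  apply ge_of_tendsto (hD 1 one_pos)
  filter_upwards [self_mem_nhdsWithin] with t ht
  have ht' : t < 1 := ht
  have h := N.convex 1 0 t ht'.le
  simp only [mul_one, mul_zero, add_zero, N.map_zero] at h
  rw [ENNReal.le_div_iff_mul_le (by left; simpa [← ENNReal.coe_sub] using (tsub_pos_of_lt ht').ne') (by left; simp)]
  apply ENNReal.le_sub_of_add_le_right (hfin t)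
  refine (add_le_add_right h _).trans ?_
  rw [mul_comm, ← add_mul, ← ENNReal.coe_add, tsub_add_cancel_of_le ht'.le]
  simp

lemma YF_pos (N : YoungFunction) (D : ℝ≥0 → ℝ≥0∞)
    (hcN : 0 < ⨅ (s : ℝ≥0) (_ : 0 < s), N.toFun s / ((s : ℝ≥0∞) * D s)) (s : ℝ≥0) (hs : 0 < s) :
    N.toFun s ≠ 0 := by
  intro h
  have := hcN.trans_le (iInf₂_le s hs)
  simp [h] at this

lemma YF_jensen (N : YoungFunction) (hfin : ∀ s, N.toFun s ≠ ⊤) {α : Type*} [MeasurableSpace α]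
    (Q : Measure α) (w : α → ℝ≥0) (hw : Measurable w) (B r : ℝ≥0) (hr : 0 < r)
    (hQ : Q univ = B) (hpos : ∀ᵐ t ∂Q, 0 < w t) (hm : ∫⁻ t, w t ∂Q ≤ r) :
    N.toFun (B / r) ≤ (r : ℝ≥0∞)⁻¹ * ∫⁻ t, N.toFun (w t)⁻¹ * w t ∂Q := by
  obtain ⟨d, hd⟩ := YF_subgrad N hfin (B / r)
  set b := B / r with hb
  have hNm : Measurable N.toFun := N.mono.measurable
  have hbr : (b : ℝ≥0∞) * r = B := by
    rw [← ENNReal.coe_mul, hb, div_mul_cancel₀ _ hr.ne']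
  set M := ∫⁻ t, (w t : ℝ≥0∞) ∂Q with hM
  set K := ∫⁻ t, N.toFun (w t)⁻¹ * w t ∂Q with hK
  have hwm : Measurable fun t => (w t : ℝ≥0∞) := hw.coe_nnreal_ennreal
  have h1 : N.toFun b * M + d * B ≤ K + d * b * M := by
    calc N.toFun b * M + d * B = ∫⁻ t, N.toFun b * w t + d ∂Q := by
          rw [lintegral_add_right _ measurable_const, lintegral_const_mul _ hwm, lintegral_const, hQ]
      _ ≤ ∫⁻ t, N.toFun (w t)⁻¹ * w t + d * b * w t ∂Q := by
          apply lintegral_mono_ae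
          filter_upwards [hpos] with t ht
          have := mul_le_mul_left (hd (w t)⁻¹) (w t : ℝ≥0∞)
          rw [add_mul, add_mul, mul_assoc (d : ℝ≥0∞) _ (w t : ℝ≥0∞), ← ENNReal.coe_mul (w t)⁻¹,
            inv_mul_cancel₀ ht.ne'] at this
          simpa using this
      _ = K + d * b * M := by
          rw [lintegral_add_right _ (hwm.const_mul _), lintegral_const_mul _ hwm]
  have h0 : N.toFun b ≤ d * b := by simpa [N.map_zero] using hd 0
  have h2 : N.toFun b * r + d * B ≤ K + d * B := by
    calc N.toFun b * r + d * B = N.toFun b * (M + (r - M)) + d * B := by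
          rw [add_tsub_cancel_of_le hm]
      _ = (N.toFun b * M + d * B) + N.toFun b * (r - M) := by ring
      _ ≤ (K + d * b * M) + d * b * (r - M) := by gcongr
      _ = K + d * b * (M + (r - M)) := by ring
      _ = K + d * B := by rw [add_tsub_cancel_of_le hm, mul_assoc, hbr]
  have h3 := (ENNReal.add_le_add_iff_right (by finiteness)).1 h2
  rw [mul_comm, ← div_eq_mul_inv, ENNReal.le_div_iff_mul_le (by left; simpa using hr.ne') (by left; simp)]
  exact h3

section coarea
variable {E : Type*} [MeasurableSpace E]

def cutG (μ : Measure E) (J : E → E → ℝ≥0) (f : E → ℝ) (t : ℝ) : ℝ≥0∞ :=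
  ∫⁻ x in {x | t < |f x|}, (∫⁻ y in {x | t < |f x|}ᶜ, (J x y : ℝ≥0∞) ∂μ) ∂μ

open Classical in
def cutH (J : E → E → ℝ≥0) (f : E → ℝ) (t : ℝ) (x y : E) : ℝ≥0∞ :=
  if t < |f x| ∧ |f y| ≤ t then (J x y : ℝ≥0∞) else 0

lemma cutG_eq (μ : Measure E) (J : E → E → ℝ≥0) (f : E → ℝ) (hf : Measurable f) (t : ℝ) :
    cutG μ J f t = ∫⁻ x, ∫⁻ y, cutH J f t x y ∂μ ∂μ := by
  classical
  have hA : MeasurableSet {x | t < |f x|} := measurableSet_lt measurable_const hf.abs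
  rw [cutG, ← lintegral_indicator hA]
  refine lintegral_congr fun x => ?_
  by_cases hx : t < |f x|
  · rw [indicator_of_mem (by exact hx), ← lintegral_indicator hA.compl]
    refine lintegral_congr fun y => ?_
    simp [cutH, hx, indicator_apply]
  · rw [indicator_of_notMem (by exact hx)]
    simp [cutH, hx]

lemma cutH_meas (J : E → E → ℝ≥0) (hJ : Measurable (Function.uncurry J)) (f : E → ℝ)
    (hf : Measurable f) : Measurable fun p : (ℝ × E) × E => cutH J f p.1.1 p.1.2 p.2 := by
  unfold cutH
  refine Measurable.ite ?_ ?_ measurable_const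
  · apply MeasurableSet.inter
    · exact measurableSet_lt (f := fun p : (ℝ × E) × E => p.1.1)
        (g := fun p : (ℝ × E) × E => |f p.1.2|) (by fun_prop) (by fun_prop)
    · exact measurableSet_le (f := fun p : (ℝ × E) × E => |f p.2|)
        (g := fun p : (ℝ × E) × E => p.1.1) (by fun_prop) (by fun_prop)
  · have : Measurable fun p : (ℝ × E) × E => Function.uncurry J (p.1.2, p.2) := by fun_prop
    exact this.coe_nnreal_ennreal

lemma cutG_meas (μ : Measure E) [SigmaFinite μ] (J : E → E → ℝ≥0)
    (hJ : Measurable (Function.uncurry J)) (f : E → ℝ)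
    (hf : Measurable f) : Measurable (cutG μ J f) := by
  have : cutG μ J f = fun t => ∫⁻ x, ∫⁻ y, cutH J f t x y ∂μ ∂μ := by
    ext t; exact cutG_eq μ J f hf t
  rw [this]
  have h1 := (cutH_meas J hJ f hf).lintegral_prod_right' (ν := μ)
  exact h1.lintegral_prod_right' (ν := μ)

lemma cutG_int (μ : Measure E) [SigmaFinite μ] (J : E → E → ℝ≥0)
    (hJ : Measurable (Function.uncurry J)) (f : E → ℝ) (hf : Measurable f) :
    ∫⁻ t, cutG μ J f t = ∫⁻ x, ∫⁻ y, ENNReal.ofReal (|f x| - |f y|) * J x y ∂μ ∂μ := by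
  simp_rw [cutG_eq μ J f hf]
  have h1 := (cutH_meas J hJ f hf).lintegral_prod_right' (ν := μ)
  rw [lintegral_lintegral_swap h1.aemeasurable]
  refine lintegral_congr fun x => ?_
  have h2 : Measurable fun p : ℝ × E => cutH J f p.1 x p.2 :=
    (cutH_meas J hJ f hf).comp (by fun_prop : Measurable fun p : ℝ × E => ((p.1, x), p.2))
  rw [lintegral_lintegral_swap h2.aemeasurable]
  refine lintegral_congr fun y => ?_
  have : (fun t => cutH J f t x y) = (Ico |f y| |f x|).indicator (fun _ => (J x y : ℝ≥0∞)) := by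
    classical
    ext t
    simp only [cutH, indicator_apply, mem_Ico]
    congr 1
    rw [and_comm]
  rw [this, lintegral_indicator measurableSet_Ico, setLIntegral_const, Real.volume_Ico, mul_comm]

lemma cutG_coarea (μ : Measure E) [SigmaFinite μ] (J : E → E → ℝ≥0)
    (hJ : Measurable (Function.uncurry J)) (hJs : ∀ x y, J x y = J y x) (f : E → ℝ)
    (hf : Measurable f) :
    2 * ∫⁻ t, cutG μ J f t ≤ ∫⁻ x, (∫⁻ y, (‖f x - f y‖₊ : ℝ≥0∞) * (J x y : ℝ≥0∞) ∂μ) ∂μ := by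
  have hJm : Measurable fun p : E × E => (J p.1 p.2 : ℝ≥0∞) := hJ.coe_nnreal_ennreal
  have hm1 : Measurable fun p : E × E => ENNReal.ofReal (|f p.1| - |f p.2|) * (J p.1 p.2 : ℝ≥0∞) :=
    Measurable.mul (by fun_prop) hJm
  have hm2 : Measurable fun p : E × E => ENNReal.ofReal (|f p.2| - |f p.1|) * (J p.1 p.2 : ℝ≥0∞) :=
    Measurable.mul (by fun_prop) hJm
  have e2 : ∫⁻ t, cutG μ J f t = ∫⁻ x, ∫⁻ y, ENNReal.ofReal (|f y| - |f x|) * J x y ∂μ ∂μ := by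
    rw [cutG_int μ J hJ f hf, lintegral_lintegral_swap hm1.aemeasurable]
    refine lintegral_congr fun x => lintegral_congr fun y => ?_
    rw [hJs]
  rw [two_mul]
  nth_rw 1 [cutG_int μ J hJ f hf]
  rw [e2, ← lintegral_add_left hm1.lintegral_prod_right']
  refine lintegral_mono fun x => ?_
  have hm1x : Measurable fun y => ENNReal.ofReal (|f x| - |f y|) * (J x y : ℝ≥0∞) :=
    hm1.comp measurable_prodMk_left
  simp only
  rw [← lintegral_add_left hm1x]
  refine lintegral_mono fun y => ?_
  simp only
  rw [← add_mul]
  gcongr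
  rw [← enorm_eq_nnnorm, ← ofReal_norm, Real.norm_eq_abs]
  rcases le_total |f x| |f y| with h | h
  · rw [ENNReal.ofReal_of_nonpos (by linarith), zero_add]
    apply ENNReal.ofReal_le_ofReal
    rw [abs_sub_comm]; exact abs_sub_abs_le_abs_sub _ _
  · rw [ENNReal.ofReal_of_nonpos (p := |f y| - |f x|) (by linarith), add_zero]
    apply ENNReal.ofReal_le_ofReal
    exact abs_sub_abs_le_abs_sub _ _

end coarea

lemma YF_main {E : Type*} [MeasurableSpace E] (μ : Measure E) [SigmaFinite μ]
    (N : YoungFunction) (hfin : ∀ s, N.toFun s ≠ ⊤) (f : E → ℝ) (hf : Measurable f)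
    (W : ℝ → ℝ≥0∞) (hW : Measurable W)
    (hμ : ∀ t : ℝ, 0 < t → μ {x | t < |f x|} < ⊤)
    (hiso : ∀ t : ℝ, 0 < t → 0 < μ {x | t < |f x|} →
      1 ≤ invIncr N.toFun (μ {x | t < |f x|})⁻¹ * W t)
    (r : ℝ≥0) (hr : 0 < r) (hWr : ∫⁻ t in Ioi (0 : ℝ), W t ≤ r) :
    ∫⁻ x, N.toFun (‖f x‖₊ / r) ∂μ ≤ 1 := by
  classical
  set ν : Measure ℝ := volume.restrict (Ioi 0) with hν
  set w : ℝ → ℝ≥0 := fun t => (W t).toNNReal with hw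
  have hwm : Measurable w := hW.ennreal_toNNReal
  have hNm : Measurable N.toFun := N.mono.measurable
  have hA : ∀ t, MeasurableSet {x | t < |f x|} := fun t => measurableSet_lt measurable_const hf.abs
  have hWpos : ∀ t : ℝ, 0 < t → μ {x | t < |f x|} ≠ 0 → W t ≠ 0 := by
    intro t ht h0 h
    have := hiso t ht (pos_iff_ne_zero.2 h0)
    simp [h] at this
  have hkey : ∀ t : ℝ, 0 < t → N.toFun (w t)⁻¹ * w t * μ {x | t < |f x|} ≤ W t := by
    intro t ht
    by_cases hw0 : w t = 0
    · simp [hw0]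
    by_cases h0 : μ {x | t < |f x|} = 0
    · simp [h0]
    have hWt : W t ≠ ⊤ := by
      intro h; apply hw0; simp [hw, h]
    have hwW : (w t : ℝ≥0∞) = W t := ENNReal.coe_toNNReal hWt
    have hN : N.toFun (w t)⁻¹ ≤ (μ {x | t < |f x|})⁻¹ := by
      apply YF_le_of_lt N hfin _ (by positivity)
      intro s hs
      by_contra! hcon
      have hs0 : 0 < s := by
        rcases eq_or_ne s 0 with h | h
        · rw [h, N.map_zero] at hcon; simp at hcon
        · exact pos_iff_ne_zero.2 h
      have h1 : invIncr N.toFun (μ {x | t < |f x|})⁻¹ ≤ s := iInf₂_le s ⟨hs0, hcon.le⟩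
      have h2 := (hiso t ht (pos_iff_ne_zero.2 h0)).trans (mul_le_mul_left h1 _)
      rw [← hwW, ← ENNReal.coe_mul] at h2
      have h3 : 1 ≤ s * w t := by exact_mod_cast h2
      have h4 : s * w t < (w t)⁻¹ * w t := mul_lt_mul_of_pos_right hs (pos_iff_ne_zero.2 hw0)
      rw [inv_mul_cancel₀ hw0] at h4
      exact absurd h3 (not_le.2 h4)
    calc N.toFun (w t)⁻¹ * w t * μ {x | t < |f x|}
        ≤ (μ {x | t < |f x|})⁻¹ * w t * μ {x | t < |f x|} := by gcongr
      _ = (μ {x | t < |f x|})⁻¹ * μ {x | t < |f x|} * w t := by ring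
      _ = W t := by rw [ENNReal.inv_mul_cancel h0 (hμ t ht).ne, one_mul, hwW]
  have hWfin : ∀ᵐ t ∂ν, W t < ⊤ := ae_lt_top hW (hWr.trans_lt ENNReal.coe_lt_top).ne
  have hlt : MeasurableSet {p : E × ℝ | p.2 < |f p.1|} :=
    measurableSet_lt (f := fun p : E × ℝ => p.2) (g := fun p : E × ℝ => |f p.1|)
      (by fun_prop) (by fun_prop)
  have hae : ∀ᵐ x ∂μ, ∀ᵐ t ∂ν, t < |f x| → W t ≠ 0 := by
    rw [Measure.ae_ae_comm]
    · filter_upwards [ae_restrict_mem measurableSet_Ioi] with t ht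
      by_cases h0 : μ {x | t < |f x|} = 0
      · have : ∀ᵐ x ∂μ, ¬ (t < |f x|) := by
          rw [ae_iff]; simpa using h0
        filter_upwards [this] with x hx h
        exact absurd h hx
      · exact Eventually.of_forall fun x _ => hWpos t ht h0
    · have : {p : E × ℝ | p.2 < |f p.1| → W p.2 ≠ 0}
          = {p : E × ℝ | p.2 < |f p.1|}ᶜ ∪ (Prod.snd ⁻¹' (W ⁻¹' {0}))ᶜ := by
        ext p; simp [imp_iff_not_or]
      rw [this]
      exact hlt.compl.union (measurable_snd (hW (measurableSet_singleton 0))).compl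
  have hpt : ∀ᵐ x ∂μ, N.toFun (‖f x‖₊ / r) ≤
      (r : ℝ≥0∞)⁻¹ * ∫⁻ t, (if t < |f x| then N.toFun (w t)⁻¹ * w t else 0) ∂ν := by
    filter_upwards [hae] with x hx
    have hI : MeasurableSet (Iio |f x|) := measurableSet_Iio
    have hj := YF_jensen N hfin (ν.restrict (Iio |f x|)) w hwm ‖f x‖₊ r hr ?_ ?_ ?_
    · refine hj.trans_eq ?_
      rw [← lintegral_indicator hI]
      congr 1
    · rw [Measure.restrict_apply_univ, hν, Measure.restrict_apply hI, Iio_inter_Ioi, Real.volume_Ioo,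
        sub_zero, ← enorm_eq_nnnorm, ← ofReal_norm, Real.norm_eq_abs]
    · rw [ae_restrict_iff' hI]
      filter_upwards [hx, hWfin] with t h1 h2 h3
      exact ENNReal.toNNReal_pos (h1 h3) h2.ne
    · refine (setLIntegral_le_lintegral _ _).trans (le_trans ?_ hWr)
      exact lintegral_mono fun t => ENNReal.coe_toNNReal_le_self
  have hKm : Measurable fun t => N.toFun (w t)⁻¹ * (w t : ℝ≥0∞) :=
    (hNm.comp hwm.inv).mul hwm.coe_nnreal_ennreal
  have hm : Measurable fun p : E × ℝ =>
      (if p.2 < |f p.1| then N.toFun (w p.2)⁻¹ * (w p.2 : ℝ≥0∞) else 0) :=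
    Measurable.ite hlt (hKm.comp measurable_snd) measurable_const
  calc ∫⁻ x, N.toFun (‖f x‖₊ / r) ∂μ
      ≤ ∫⁻ x, (r : ℝ≥0∞)⁻¹ * ∫⁻ t, (if t < |f x| then N.toFun (w t)⁻¹ * w t else 0) ∂ν ∂μ :=
        lintegral_mono_ae hpt
    _ = (r : ℝ≥0∞)⁻¹ * ∫⁻ x, ∫⁻ t, (if t < |f x| then N.toFun (w t)⁻¹ * w t else 0) ∂ν ∂μ :=
        lintegral_const_mul _ hm.lintegral_prod_right'
    _ = (r : ℝ≥0∞)⁻¹ * ∫⁻ t, ∫⁻ x, (if t < |f x| then N.toFun (w t)⁻¹ * w t else 0) ∂μ ∂ν := by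
        rw [lintegral_lintegral_swap hm.aemeasurable]
    _ ≤ (r : ℝ≥0∞)⁻¹ * ∫⁻ t, W t ∂ν := by
        gcongr 1
        apply lintegral_mono_ae
        filter_upwards [ae_restrict_mem measurableSet_Ioi] with t ht
        refine le_trans (le_of_eq ?_) (hkey t ht)
        rw [← setLIntegral_const, ← lintegral_indicator (hA t)]
        rfl
    _ ≤ (r : ℝ≥0∞)⁻¹ * r := by gcongr
    _ = 1 := ENNReal.inv_mul_cancel (by simpa using hr.ne') (by simp)

/-- if `N'₋ > 0`, `c_N = inf_{s>0} N(s)/(s N'₋(s)) > 0` and the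
isoperimetric inequality `N⁻¹(μ(A)⁻¹) · J(A×Aᶜ) ≥ κ` holds, then the `L¹`
Orlicz–Sobolev inequality holds with constant `1/(2 c_N κ)`. -/
theorem isoperimetric_implies_orliczSobolev
    {E : Type*} [MeasurableSpace E] (μ : Measure E) [SigmaFinite μ]
    (J : E → E → ℝ≥0) (hJmeas : Measurable (Function.uncurry J))
    (hJsymm : ∀ x y, J x y = J y x)
    (N : YoungFunction) (D : ℝ≥0 → ℝ≥0∞)
    -- `D` is the left derivative `N'₋` of `N`
    (hD : ∀ s : ℝ≥0, 0 < s →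
      Tendsto (fun t : ℝ≥0 => (N.toFun s - N.toFun t) / ((s - t : ℝ≥0) : ℝ≥0∞))
        (nhdsWithin s (Iio s)) (nhds (D s)))
    (hDpos : ∀ s : ℝ≥0, 0 < s → 0 < D s)
    (hcN : 0 < ⨅ (s : ℝ≥0) (_ : 0 < s), N.toFun s / ((s : ℝ≥0∞) * D s))
    (κ : ℝ) (hκ : 0 < κ)
    (hIso : ∀ A : Set E, MeasurableSet A → 0 < μ A → μ A < ∞ →
      ENNReal.ofReal κ ≤ invIncr N.toFun (μ A)⁻¹ *
        ∫⁻ x in A, (∫⁻ y in Aᶜ, (J x y : ℝ≥0∞) ∂μ) ∂μ) :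
    ∀ f : E → ℝ, Measurable f → orliczNorm μ N.toFun f < ∞ →
      orliczNorm μ N.toFun f ≤
        (2 * (⨅ (s : ℝ≥0) (_ : 0 < s), N.toFun s / ((s : ℝ≥0∞) * D s)) *
            ENNReal.ofReal κ)⁻¹ *
          ∫⁻ x, (∫⁻ y, (‖f x - f y‖₊ : ℝ≥0∞) * (J x y : ℝ≥0∞) ∂μ) ∂μ := by
  intro f hf hfN
  have hfin := YF_finite N D hD hDpos
  have hc1 := YF_c_le_one N D hD hfin
  have hpos := YF_pos N D hcN
  set c := ⨅ (s : ℝ≥0) (_ : 0 < s), N.toFun s / ((s : ℝ≥0∞) * D s) with hc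
  have hk0 : ENNReal.ofReal κ ≠ 0 := by simpa using hκ
  have hkt : ENNReal.ofReal κ ≠ ⊤ := ENNReal.ofReal_ne_top
  have hNm : Measurable N.toFun := N.mono.measurable
  have hμ : ∀ t : ℝ, 0 < t → μ {x | t < |f x|} < ⊤ := by
    intro t ht
    obtain ⟨r, hr⟩ := iInf_lt_iff.1 hfN
    obtain ⟨⟨hr0, hr1⟩, -⟩ := iInf_lt_iff.1 hr
    have hp : (0 : ℝ≥0) < t.toNNReal / r := div_pos (by simpa using ht) hr0
    have h1 := meas_ge_le_lintegral_div (μ := μ) (f := fun x => N.toFun (‖f x‖₊ / r))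
      (by fun_prop) (hpos _ hp) (hfin _)
    refine (measure_mono ?_).trans_lt (h1.trans_lt ?_)
    · intro x hx
      apply N.mono
      gcongr
      rw [Real.toNNReal_le_iff_le_coe]
      simpa using le_of_lt hx
    · exact ENNReal.div_lt_top (hr1.trans_lt ENNReal.one_lt_top).ne (hpos _ hp)
  set W : ℝ → ℝ≥0∞ := fun t => (ENNReal.ofReal κ)⁻¹ * cutG μ J f t with hW
  have hGm := cutG_meas μ J hJmeas f hf
  have hWm : Measurable W := hGm.const_mul _
  have hiso : ∀ t : ℝ, 0 < t → 0 < μ {x | t < |f x|} →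
      1 ≤ invIncr N.toFun (μ {x | t < |f x|})⁻¹ * W t := by
    intro t ht h0
    have h := hIso {x | t < |f x|} (measurableSet_lt measurable_const hf.abs) h0 (hμ t ht)
    have h' := mul_le_mul_right h (ENNReal.ofReal κ)⁻¹
    rw [ENNReal.inv_mul_cancel hk0 hkt] at h'
    refine h'.trans_eq ?_
    simp only [hW, cutG]
    ring
  have hle : orliczNorm μ N.toFun f ≤ ∫⁻ t in Ioi (0 : ℝ), W t := by
    apply le_of_forall_gt
    intro z hz
    obtain ⟨r, hr1, hr2⟩ := ENNReal.lt_iff_exists_nnreal_btwn.1 hz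
    have hr0 : 0 < r := by
      have := (zero_le).trans_lt hr1
      simpa using this
    refine lt_of_le_of_lt ?_ hr2
    exact iInf₂_le r ⟨hr0, YF_main μ N hfin f hf W hWm hμ hiso r hr0 hr1.le⟩
  refine hle.trans ?_
  have h2 := cutG_coarea μ J hJmeas hJsymm f hf
  calc ∫⁻ t in Ioi (0 : ℝ), W t ≤ ∫⁻ t, W t := setLIntegral_le_lintegral _ _
    _ = (ENNReal.ofReal κ)⁻¹ * ∫⁻ t, cutG μ J f t := lintegral_const_mul _ hGm
    _ = (2 * ENNReal.ofReal κ)⁻¹ * (2 * ∫⁻ t, cutG μ J f t) := by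
        rw [ENNReal.mul_inv (by left; simp) (by left; simp), mul_comm (2⁻¹ : ℝ≥0∞), mul_assoc,
          ← mul_assoc (2⁻¹ : ℝ≥0∞), ENNReal.inv_mul_cancel (by simp) (by simp), one_mul]
    _ ≤ _ := by
        gcongr
        exact mul_le_of_le_one_right' hc1
end
end

section
/- Let C₁, C̃₂ > 0 be constants such that μ(A) ≤ 2C₁ J(A×Aᶜ) + C̃₂ μ(A)² for every measurable set A ⊆ E with 0 < μ(A) < ∞. Then the L¹ Poincaré type inequality ‖f‖₂² ≤ C₁ ∫_{E×E} |f²(x) − f²(y)| J(dx,dy) + 2C̃₂ ‖f‖₁² holds for all f ∈ L²(μ). -/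
open MeasureTheory ENNReal NNReal Filter Set

noncomputable section

set_option maxHeartbeats 1000000 in
/-- the isoperimetric inequality
`μ(A) ≤ 2C₁ J(A×Aᶜ) + C̃₂ μ(A)²` implies the `L¹` Poincaré type inequality
with constants `C₁` and `2C̃₂`. -/
theorem isoperimetric_implies_poincare
    {E : Type*} [MeasurableSpace E] (μ : Measure E) [SigmaFinite μ]
    (J : E → E → ℝ≥0) (hJmeas : Measurable (Function.uncurry J))
    (hJsymm : ∀ x y, J x y = J y x)
    (C₁ C₂ : ℝ) (hC₁ : 0 < C₁) (hC₂ : 0 < C₂)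
    (hIso : ∀ A : Set E, MeasurableSet A → 0 < μ A → μ A < ∞ →
      μ A ≤ 2 * ENNReal.ofReal C₁ *
          (∫⁻ x in A, (∫⁻ y in Aᶜ, (J x y : ℝ≥0∞) ∂μ) ∂μ)
        + ENNReal.ofReal C₂ * (μ A) ^ 2) :
    ∀ f : E → ℝ, Measurable f → (∫⁻ x, (‖f x‖₊ : ℝ≥0∞) ^ 2 ∂μ) < ∞ →
      ∫⁻ x, (‖f x‖₊ : ℝ≥0∞) ^ 2 ∂μ ≤
        ENNReal.ofReal C₁ *
          (∫⁻ x, (∫⁻ y, (‖f x ^ 2 - f y ^ 2‖₊ : ℝ≥0∞) * (J x y : ℝ≥0∞) ∂μ) ∂μ)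
        + 2 * ENNReal.ofReal C₂ * (∫⁻ x, (‖f x‖₊ : ℝ≥0∞) ∂μ) ^ 2 := by
  intro f hf hfin
  set g : E → ℝ := fun x => f x ^ 2 with hg
  have hgm : Measurable g := hf.pow_const 2
  have hg0 : ∀ x, 0 ≤ g x := fun x => sq_nonneg _
  have hnorm : ∀ x, (‖f x‖₊ : ℝ≥0∞) ^ 2 = ENNReal.ofReal (g x) := by
    intro x
    rw [hg]
    simp only
    rw [← sq_abs, ENNReal.ofReal_pow (abs_nonneg _), ← Real.norm_eq_abs, ofReal_norm]
    rfl
  set ν : Measure ℝ := volume.restrict (Ioi 0) with hν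
  let u : ℝ → E → ℝ≥0∞ := fun t x => if t < g x then 1 else 0
  have hu : Measurable (Function.uncurry u) := by
    refine Measurable.ite ?_ measurable_const measurable_const
    exact measurableSet_lt measurable_fst (hgm.comp measurable_snd)
  let k : ℝ → E → E → ℝ≥0∞ := fun t x y => if t < g x ∧ g y ≤ t then (J x y : ℝ≥0∞) else 0
  have hk : Measurable (fun p : ℝ × E × E => k p.1 p.2.1 p.2.2) := by
    refine Measurable.ite ?_ ?_ measurable_const
    · exact (measurableSet_lt measurable_fst (hgm.comp (measurable_fst.comp measurable_snd))).inter
        (measurableSet_le (hgm.comp (measurable_snd.comp measurable_snd)) measurable_fst)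
    · exact (hJmeas.comp measurable_snd).coe_nnreal_ennreal
  have hA : ∀ t, MeasurableSet {x | t < g x} := fun t => measurableSet_lt measurable_const hgm
  have huA : ∀ t, ∫⁻ x, u t x ∂μ = μ {x | t < g x} := by
    intro t
    rw [← lintegral_indicator_one (hA t)]
    refine lintegral_congr fun x => ?_
    simp [u, indicator_apply]
  have hkA : ∀ t, ∫⁻ x, ∫⁻ y, k t x y ∂μ ∂μ =
      ∫⁻ x in {x | t < g x}, (∫⁻ y in {x | t < g x}ᶜ, (J x y : ℝ≥0∞) ∂μ) ∂μ := by
    intro t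
    rw [← lintegral_indicator (hA t)]
    refine lintegral_congr fun x => ?_
    by_cases hx : t < g x
    · rw [indicator_of_mem (by exact hx), ← lintegral_indicator (hA t).compl]
      refine lintegral_congr fun y => ?_
      simp [k, hx, indicator_apply]
    · rw [indicator_of_notMem (by exact hx)]
      simp [k, hx]
  -- the level set inequality
  have hlev : ∀ t, 0 < t → ∫⁻ x, u t x ∂μ ≤
      2 * ENNReal.ofReal C₁ * (∫⁻ x, ∫⁻ y, k t x y ∂μ ∂μ)
        + ENNReal.ofReal C₂ * (∫⁻ x, u t x ∂μ) ^ 2 := by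
    intro t ht
    rw [hkA, huA]
    rcases eq_or_ne (μ {x | t < g x}) 0 with h0 | h0
    · rw [h0]; exact zero_le
    · refine hIso _ (hA t) (pos_iff_ne_zero.2 h0) ?_
      have h1 : μ {x | ENNReal.ofReal t ≤ ENNReal.ofReal (g x)} ≤
          (∫⁻ x, ENNReal.ofReal (g x) ∂μ) / ENNReal.ofReal t :=
        meas_ge_le_lintegral_div hgm.ennreal_ofReal.aemeasurable
          (by simpa using ht) ENNReal.ofReal_ne_top
      refine lt_of_le_of_lt (measure_mono ?_) (lt_of_le_of_lt h1 ?_)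
      · intro x hx
        exact ENNReal.ofReal_le_ofReal (le_of_lt hx)
      · refine ENNReal.div_lt_top ?_ (by simpa using ht)
        simp only [hnorm] at hfin
        exact hfin.ne
  have hint : ∫⁻ t, ∫⁻ x, u t x ∂μ ∂ν ≤ 
      2 * ENNReal.ofReal C₁ * (∫⁻ t, ∫⁻ x, ∫⁻ y, k t x y ∂μ ∂μ ∂ν)
        + ENNReal.ofReal C₂ * ∫⁻ t, (∫⁻ x, u t x ∂μ) ^ 2 ∂ν := by
    have hum : Measurable fun t => (∫⁻ x, u t x ∂μ) ^ 2 := (hu.lintegral_prod_right').pow_const 2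
    rw [← lintegral_const_mul' _ _ (by finiteness), ← lintegral_const_mul _ hum,
      ← lintegral_add_right _ (hum.const_mul _)]
    refine lintegral_mono_ae ?_
    filter_upwards [ae_restrict_mem measurableSet_Ioi] with t ht
    exact hlev t ht
  -- layer cake
  have huν : ∀ c : ℝ, ∫⁻ t, (if t < c then 1 else 0 : ℝ≥0∞) ∂ν = ENNReal.ofReal c := by
    intro c
    have : ∀ t : ℝ, (if t < c then 1 else 0 : ℝ≥0∞) = (Iio c).indicator 1 t := by
      intro t; simp [indicator_apply]
    simp_rw [this]
    rw [lintegral_indicator_one measurableSet_Iio, hν, Measure.restrict_apply measurableSet_Iio,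
      inter_comm, Ioi_inter_Iio, Real.volume_Ioo, sub_zero]
  have hL : ∫⁻ t, ∫⁻ x, u t x ∂μ ∂ν = ∫⁻ x, ENNReal.ofReal (g x) ∂μ := by
    rw [lintegral_lintegral_swap hu.aemeasurable]
    exact lintegral_congr fun x => huν _
  have hS : ∫⁻ t, (∫⁻ x, u t x ∂μ) ^ 2 ∂ν ≤ (∫⁻ x, (‖f x‖₊ : ℝ≥0∞) ∂μ) ^ 2 := by
    have hfm : Measurable fun x => (‖f x‖₊ : ℝ≥0∞) := hf.nnnorm.coe_nnreal_ennreal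
    have hum : ∀ t, Measurable (u t) := fun t => hu.comp measurable_prodMk_left
    have e1 : ∀ t, (∫⁻ x, u t x ∂μ) ^ 2 = ∫⁻ x, ∫⁻ y, u t x * u t y ∂μ ∂μ := by
      intro t
      rw [sq, ← lintegral_mul_const _ (hum t)]
      exact lintegral_congr fun x => (lintegral_const_mul _ (hum t)).symm
    have hm3 : Measurable (fun p : (ℝ × E) × E => u p.1.1 p.1.2 * u p.1.1 p.2) :=
      (hu.comp measurable_fst).mul
        (hu.comp ((measurable_fst.comp measurable_fst).prodMk measurable_snd))
    simp_rw [e1]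
    rw [lintegral_lintegral_swap (hm3.lintegral_prod_right').aemeasurable, sq,
      ← lintegral_mul_const _ hfm]
    refine lintegral_mono fun x => ?_
    rw [lintegral_lintegral_swap (f := fun t y => u t x * u t y) (Measurable.aemeasurable
      (hm3.comp ((measurable_fst.prodMk (measurable_const (a := x))).prodMk measurable_snd))),
      ← lintegral_const_mul _ hfm]
    refine lintegral_mono fun y => ?_
    have e2 : ∀ t, u t x * u t y = if t < min (g x) (g y) then 1 else 0 := by
      intro t
      by_cases h1 : t < g x <;> by_cases h2 : t < g y <;> simp [u, h1, h2]
    simp only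
    simp_rw [e2]
    rw [huν]
    have e3 : min (g x) (g y) ≤ ‖f x‖ * ‖f y‖ := by
      simp only [hg, Real.norm_eq_abs]
      rw [← sq_abs (f x), ← sq_abs (f y)]
      rcases le_total |f x| |f y| with h | h
      · refine (min_le_left _ _).trans ?_
        nlinarith [abs_nonneg (f x)]
      · refine (min_le_right _ _).trans ?_
        nlinarith [abs_nonneg (f y)]
    refine (ENNReal.ofReal_le_ofReal e3).trans (le_of_eq ?_)
    rw [ENNReal.ofReal_mul (norm_nonneg _), ofReal_norm, ofReal_norm]
    rfl
  have hK : ∫⁻ t, ∫⁻ x, ∫⁻ y, k t x y ∂μ ∂μ ∂ν =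
      ∫⁻ x, ∫⁻ y, ENNReal.ofReal (g x - g y) * (J x y : ℝ≥0∞) ∂μ ∂μ := by
    have hm3 : Measurable (fun p : (ℝ × E) × E => k p.1.1 p.1.2 p.2) :=
      hk.comp ((measurable_fst.comp measurable_fst).prodMk
        ((measurable_snd.comp measurable_fst).prodMk measurable_snd))
    rw [lintegral_lintegral_swap (hm3.lintegral_prod_right').aemeasurable]
    refine lintegral_congr fun x => ?_
    rw [lintegral_lintegral_swap (f := fun t y => k t x y) (Measurable.aemeasurable
      (hm3.comp ((measurable_fst.prodMk (measurable_const (a := x))).prodMk measurable_snd)))]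
    refine lintegral_congr fun y => ?_
    have : ∀ t : ℝ, k t x y = (Ico (g y) (g x)).indicator (fun _ => (J x y : ℝ≥0∞)) t := by
      intro t; simp [k, indicator_apply, and_comm]
    have hsub : Ico (g y) (g x) ⊆ Ici 0 := fun t ht => (hg0 y).trans ht.1
    simp_rw [this]
    rw [lintegral_indicator_const measurableSet_Ico, mul_comm, hν,
      Measure.restrict_congr_set Ioi_ae_eq_Ici, Measure.restrict_apply measurableSet_Ico,
      inter_eq_left.2 hsub, Real.volume_Ico]
  have hGm : Measurable (fun p : E × E => ENNReal.ofReal (g p.1 - g p.2) * (J p.1 p.2 : ℝ≥0∞)) :=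
    ((hgm.comp measurable_fst).sub (hgm.comp measurable_snd)).ennreal_ofReal.mul
      hJmeas.coe_nnreal_ennreal
  have hsym : 2 * ∫⁻ x, ∫⁻ y, ENNReal.ofReal (g x - g y) * (J x y : ℝ≥0∞) ∂μ ∂μ =
      ∫⁻ x, (∫⁻ y, (‖f x ^ 2 - f y ^ 2‖₊ : ℝ≥0∞) * (J x y : ℝ≥0∞) ∂μ) ∂μ := by
    rw [two_mul]
    nth_rewrite 2 [lintegral_lintegral_swap hGm.aemeasurable]
    rw [← lintegral_add_left hGm.lintegral_prod_right']
    refine lintegral_congr fun x => ?_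
    have hGx : Measurable fun y => ENNReal.ofReal (g x - g y) * (J x y : ℝ≥0∞) :=
      (measurable_const.sub hgm).ennreal_ofReal.mul
        (hJmeas.comp measurable_prodMk_left).coe_nnreal_ennreal
    simp only
    rw [← lintegral_add_left hGx]
    refine lintegral_congr fun y => ?_
    rw [hJsymm y x, ← add_mul]
    congr 1
    change _ = ‖g x - g y‖ₑ
    rw [← ofReal_norm, Real.norm_eq_abs]
    rcases le_total (g x) (g y) with h | h
    · rw [ENNReal.ofReal_of_nonpos (by linarith : g x - g y ≤ 0), zero_add, abs_of_nonpos (by linarith)]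
      congr 1; ring
    · rw [ENNReal.ofReal_of_nonpos (by linarith : g y - g x ≤ 0), add_zero, abs_of_nonneg (by linarith)]
  simp_rw [hnorm]
  rw [hL, hK] at hint
  refine hint.trans ?_
  rw [← hsym]
  refine add_le_add (le_of_eq (by ring)) ?_
  refine mul_le_mul' ?_ hS
  exact le_mul_of_one_le_left zero_le one_le_two
end
end

section
/- Let β₁ : (0,∞) → (0,∞) be decreasing with lim_{r→∞} β₁(r) = 0, and assume the Poincaré type isoperimetric inequality ‖f‖₂² ≤ r ∫_{E×E} |f²(x) − f²(y)| J_γ(dx,dy) + β₁(r) ‖f‖₁² holds for all r > 0 and f ∈ L²(μ). Then for every s > 0, κ_γ(s) ≥ 1/(4 β₁^{-1}(1/(2s))), where β₁^{-1}(u) := inf{ t > 0 : β₁(t) ≤ u }. -/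
open MeasureTheory ENNReal NNReal Filter Set

noncomputable section

/-- The isoperimetric constant
`κ_γ(s) = inf { J_γ(A×Aᶜ)/μ(A) : 0 < μ(A) < s }`, with `inf ∅ = ∞`, where
`J_γ(dx,dy) = γ(x,y) J(x,y) μ(dx) μ(dy)`. -/
def kappaGamma {E : Type*} [MeasurableSpace E] (μ : Measure E)
    (J γ : E → E → ℝ≥0) (s : ℝ≥0∞) : ℝ≥0∞ :=
  ⨅ (A : Set E) (_ : MeasurableSet A ∧ 0 < μ A ∧ μ A < s),
    (∫⁻ x in A, (∫⁻ y in Aᶜ, (γ x y : ℝ≥0∞) * (J x y : ℝ≥0∞) ∂μ) ∂μ) / μ A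

lemma double_integral_indicator
    {E : Type*} [MeasurableSpace E] (μ : Measure E) [SigmaFinite μ]
    (J γ : E → E → ℝ≥0)
    (hJmeas : Measurable (Function.uncurry J)) (hJsymm : ∀ x y, J x y = J y x)
    (hγmeas : Measurable (Function.uncurry γ)) (hγsymm : ∀ x y, γ x y = γ y x)
    (A : Set E) (hA : MeasurableSet A) :
    (∫⁻ x, (∫⁻ y, (‖A.indicator (fun _ => (1:ℝ)) x ^ 2
        - A.indicator (fun _ => (1:ℝ)) y ^ 2‖₊ : ℝ≥0∞) * (γ x y : ℝ≥0∞) *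
              (J x y : ℝ≥0∞) ∂μ) ∂μ)
      = 2 * ∫⁻ x in A, (∫⁻ y in Aᶜ, (γ x y : ℝ≥0∞) * (J x y : ℝ≥0∞) ∂μ) ∂μ := by
  have hm : Measurable (Function.uncurry fun x y => (γ x y : ℝ≥0∞) * (J x y : ℝ≥0∞)) :=
    (hγmeas.coe_nnreal_ennreal).mul (hJmeas.coe_nnreal_ennreal)
  rw [← lintegral_add_compl _ hA, two_mul]
  congr 1
  · apply setLIntegral_congr_fun hA
    intro x hx
    simp only
    rw [← lintegral_indicator hA.compl]
    apply lintegral_congr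
    intro y
    by_cases hy : y ∈ A <;> simp [hx, hy]
  · have h1 : ∫⁻ x in Aᶜ, (∫⁻ y, (‖A.indicator (fun _ => (1:ℝ)) x ^ 2
        - A.indicator (fun _ => (1:ℝ)) y ^ 2‖₊ : ℝ≥0∞) * (γ x y : ℝ≥0∞) *
              (J x y : ℝ≥0∞) ∂μ) ∂μ
        = ∫⁻ x in Aᶜ, (∫⁻ y in A, (γ x y : ℝ≥0∞) * (J x y : ℝ≥0∞) ∂μ) ∂μ := by
      apply setLIntegral_congr_fun hA.compl
      intro x hx
      have hx' : x ∉ A := hx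
      simp only
      rw [← lintegral_indicator hA]
      apply lintegral_congr
      intro y
      by_cases hy : y ∈ A <;> simp [hx', hy]
    rw [h1, lintegral_lintegral_swap hm.aemeasurable]
    refine lintegral_congr fun x => lintegral_congr fun y => ?_
    rw [hγsymm, hJsymm]

/-- the Poincaré type isoperimetric inequality with decreasing
rate `β₁` vanishing at infinity implies `κ_γ(s) ≥ 1/(4 β₁⁻¹(1/(2s)))`, where
`β₁⁻¹(u) = inf{ t > 0 : β₁(t) ≤ u }`. -/
theorem isoperimetric_constant_lower_bound_of_poincare_type
    {E : Type*} [MeasurableSpace E] (μ : Measure E) [SigmaFinite μ]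
    (J γ : E → E → ℝ≥0)
    (hJmeas : Measurable (Function.uncurry J)) (hJsymm : ∀ x y, J x y = J y x)
    (hγmeas : Measurable (Function.uncurry γ)) (hγsymm : ∀ x y, γ x y = γ y x)
    (hγpos : ∀ x y, x ≠ y → 0 < γ x y)
    (β₁ : ℝ → ℝ) (hβpos : ∀ r : ℝ, 0 < r → 0 < β₁ r)
    (hβdec : AntitoneOn β₁ (Ioi 0))
    (hβ0 : Tendsto β₁ atTop (nhds 0))
    (hPoin : ∀ r : ℝ, 0 < r →
      ∀ f : E → ℝ, Measurable f → (∫⁻ x, (‖f x‖₊ : ℝ≥0∞) ^ 2 ∂μ) < ∞ →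
        ∫⁻ x, (‖f x‖₊ : ℝ≥0∞) ^ 2 ∂μ ≤
          ENNReal.ofReal r *
            (∫⁻ x, (∫⁻ y, (‖f x ^ 2 - f y ^ 2‖₊ : ℝ≥0∞) * (γ x y : ℝ≥0∞) *
              (J x y : ℝ≥0∞) ∂μ) ∂μ)
          + ENNReal.ofReal (β₁ r) * (∫⁻ x, (‖f x‖₊ : ℝ≥0∞) ∂μ) ^ 2) :
    ∀ s : ℝ≥0, 0 < s →
      (4 * ⨅ (t : ℝ) (_ : 0 < t ∧ β₁ t ≤ 1 / (2 * (s : ℝ))), ENNReal.ofReal t)⁻¹ ≤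
        kappaGamma μ J γ (s : ℝ≥0∞) := by
  intro s hs
  unfold kappaGamma
  refine le_iInf fun A => le_iInf fun ⟨hA, hpos, hlt⟩ => ?_
  set K := ∫⁻ x in A, (∫⁻ y in Aᶜ, (γ x y : ℝ≥0∞) * (J x y : ℝ≥0∞) ∂μ) ∂μ with hK
  have hfin : μ A ≠ ∞ := hlt.ne_top
  have i1 : ∫⁻ x, (‖A.indicator (fun _ => (1:ℝ)) x‖₊ : ℝ≥0∞) ∂μ = μ A := by
    rw [← lintegral_indicator_one hA]
    refine lintegral_congr fun x => ?_
    by_cases hx : x ∈ A <;> simp [hx]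
  have i2 : ∫⁻ x, (‖A.indicator (fun _ => (1:ℝ)) x‖₊ : ℝ≥0∞) ^ 2 ∂μ = μ A := by
    rw [← lintegral_indicator_one hA]
    refine lintegral_congr fun x => ?_
    by_cases hx : x ∈ A <;> simp [hx]
  have key : ∀ t : ℝ, 0 < t → β₁ t ≤ 1 / (2 * (s : ℝ)) →
      μ A ≤ 4 * ENNReal.ofReal t * K := by
    intro t ht hβ
    have h := hPoin t ht (A.indicator (fun _ => (1:ℝ))) (measurable_const.indicator hA)
      (by rw [i2]; exact hfin.lt_top)
    rw [double_integral_indicator μ J γ hJmeas hJsymm hγmeas hγsymm A hA, i1, i2, ← hK] at h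
    by_cases hKt : K = ∞
    · rw [hKt, ENNReal.mul_top]
      · exact le_top
      · simp [ht]
    have hb := hβpos t ht
    lift K to ℝ≥0 using hKt with K'
    lift μ A to ℝ≥0 using hfin with m
    have hms : (m : ℝ) < s := by exact_mod_cast hlt
    have hm0 : (0 : ℝ) < m := by exact_mod_cast hpos
    have hs0 : (0 : ℝ) < s := by exact_mod_cast hs
    lift t to ℝ≥0 using ht.le
    generalize β₁ t = b at *
    lift b to ℝ≥0 using hb.le
    simp only [ENNReal.ofReal_coe_nnreal] at *
    have h' : (m : ℝ) ≤ t * (2 * K') + b * m ^ 2 := by exact_mod_cast h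
    have hg : (m : ℝ) ≤ 4 * t * K' := by
      rw [le_div_iff₀ (by positivity)] at hβ
      have : (b : ℝ) * m ^ 2 ≤ m / 2 := by
        have : (b : ℝ) * m ≤ b * s := by gcongr
        nlinarith
      linarith
    exact_mod_cast hg
  rw [ENNReal.inv_le_iff_inv_le, ENNReal.inv_div (Or.inl hfin) (Or.inl hpos.ne')]
  rw [mul_comm, ← ENNReal.div_le_iff_le_mul (by simp) (by simp)]
  refine le_iInf fun t => le_iInf fun ⟨ht, hβ⟩ => ?_
  rw [ENNReal.div_le_iff_le_mul (by simp) (by simp)]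
  refine ENNReal.div_le_of_le_mul ?_
  rw [mul_comm (ENNReal.ofReal t)]
  exact key t ht hβ
end
end

section
/- Let β₁ : (0,∞) → (0,∞) be decreasing with lim_{r→∞} β₁(r) = 0, and assume ‖f‖₂² ≤ r ∫_{E×E} |f²(x) − f²(y)| J_γ(dx,dy) + β₁(r) ‖f‖₁² holds for all r > 0 and f ∈ L²(μ). If Φ(t) := 4 ∫₀ᵗ β₁^{-1}(r/2) dr < ∞ for all t > 0 (where β₁^{-1}(u) := inf{ t > 0 : β₁(t) ≤ u }), then N := Φ^{-1} is a Young function and ‖f‖_N ≤ (1/2) ∫_{E×E} |f(x) − f(y)| J_γ(dx,dy) for all f ∈ L_N(μ). -/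
open MeasureTheory ENNReal NNReal Filter Set

noncomputable section

/-- `β₁⁻¹(u) = inf{ t > 0 : β₁(t) ≤ u }`, with `inf ∅ = ∞`. -/
def invDecr (β₁ : ℝ → ℝ) (u : ℝ) : ℝ≥0∞ :=
  ⨅ (t : ℝ) (_ : 0 < t ∧ β₁ t ≤ u), ENNReal.ofReal t

/-- `Φ(t) = 4 ∫₀ᵗ β₁⁻¹(r/2) dr`. -/
def PhiBeta (β₁ : ℝ → ℝ) (t : ℝ) : ℝ≥0∞ :=
  4 * ∫⁻ r in Ioo (0 : ℝ) t, invDecr β₁ (r / 2)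

def Nfun (β₁ : ℝ → ℝ) (s : ℝ≥0) : ℝ≥0∞ :=
  ⨅ (u : ℝ) (_ : 0 < u ∧ (s : ℝ≥0∞) ≤ PhiBeta β₁ u), ENNReal.ofReal u

lemma invDecr_anti (β₁ : ℝ → ℝ) : Antitone (invDecr β₁) := by
  intro a b hab
  unfold invDecr
  refine le_iInf₂ fun t ht => iInf₂_le t ⟨ht.1, ht.2.trans hab⟩

lemma invDecr_lt_top (β₁ : ℝ → ℝ) (hβ0 : Tendsto β₁ atTop (nhds 0)) {u : ℝ} (hu : 0 < u) :
    ∃ t, 0 < t ∧ β₁ t ≤ u := by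
  have h1 := hβ0.eventually (gt_mem_nhds hu)
  obtain ⟨t, h, h'⟩ := (h1.and (eventually_gt_atTop 0)).exists
  exact ⟨t, h', h.le⟩

lemma PhiBeta_mono (β₁ : ℝ → ℝ) : Monotone (PhiBeta β₁) := by
  intro a b hab
  unfold PhiBeta
  gcongr

lemma phi_meas (β₁ : ℝ → ℝ) : Measurable (fun r : ℝ => invDecr β₁ (r / 2)) :=
  (show Antitone (fun r : ℝ => invDecr β₁ (r / 2)) from
    fun a b hab => invDecr_anti β₁ (by linarith)).measurable

lemma PhiBeta_add (β₁ : ℝ → ℝ) {a b : ℝ} (ha : 0 ≤ a) (hab : a ≤ b) :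
    PhiBeta β₁ b = PhiBeta β₁ a + 4 * ∫⁻ r in Ico a b, invDecr β₁ (r / 2) := by
  unfold PhiBeta
  rcases ha.eq_or_lt with rfl | ha
  · simp [Measure.restrict_congr_set (Ioo_ae_eq_Ico (μ := volume) (a := (0 : ℝ)) (b := b))]
  · rw [← Ioo_union_Ico_eq_Ioo ha hab, lintegral_union measurableSet_Ico, mul_add]
    exact Set.disjoint_left.2 fun x hx hx' => absurd hx.2 (not_lt.2 hx'.1)

lemma PhiBeta_pos (β₁ : ℝ → ℝ) (hβpos : ∀ r : ℝ, 0 < r → 0 < β₁ r)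
    (hβdec : AntitoneOn β₁ (Ioi 0)) {t : ℝ} (ht : 0 < t) : 0 < PhiBeta β₁ t := by
  have h1 := hβpos 1 one_pos
  have hm : 0 < min t (β₁ 1) := lt_min ht h1
  refine lt_of_lt_of_le ?_ (PhiBeta_mono β₁ (min_le_left t (β₁ 1)))
  unfold PhiBeta
  have : ∫⁻ r in Ioo (0 : ℝ) (min t (β₁ 1)), 1 ≤
      ∫⁻ r in Ioo (0 : ℝ) (min t (β₁ 1)), invDecr β₁ (r / 2) := by
    refine setLIntegral_mono' measurableSet_Ioo fun r hr => ?_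
    unfold invDecr
    refine le_iInf₂ fun s hs => ?_
    have : 1 ≤ s := by
      by_contra hlt
      have := hβdec (show s ∈ Ioi (0 : ℝ) from hs.1) (Set.mem_Ioi.2 one_pos) (not_le.1 hlt).le
      have h2 := hr.2.trans_le (min_le_right t (β₁ 1))
      linarith [hs.2]
    simpa using ENNReal.ofReal_le_ofReal this
  refine ENNReal.mul_pos (by norm_num) (ne_of_gt (lt_of_lt_of_le ?_ this))
  simpa using ⟨ht, h1⟩

lemma PhiBeta_ge (β₁ : ℝ → ℝ) {t : ℝ} :
    4 * (ENNReal.ofReal t * invDecr β₁ (t / 2)) ≤ PhiBeta β₁ t := by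
  unfold PhiBeta
  gcongr
  calc _ = ∫⁻ r in Ioo (0 : ℝ) t, invDecr β₁ (t / 2) := by simp [mul_comm]
    _ ≤ _ := setLIntegral_mono' measurableSet_Ioo fun r hr => invDecr_anti β₁ (by linarith [hr.2])

lemma PhiBeta_support (β₁ : ℝ → ℝ) (hβ0 : Tendsto β₁ atTop (nhds 0)) {W : ℝ} (hW : 0 < W) :
    ∃ C p : ℝ≥0∞, (∀ w, 0 ≤ w → PhiBeta β₁ w ≤ C + p * ENNReal.ofReal w) ∧
      C + p * ENNReal.ofReal W = PhiBeta β₁ W := by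
  set q := invDecr β₁ (W / 2) with hq
  have hqt : q ≠ ⊤ := by
    obtain ⟨t, ht⟩ := invDecr_lt_top β₁ hβ0 (half_pos hW)
    exact ne_top_of_le_ne_top ENNReal.ofReal_ne_top (iInf₂_le t ht)
  have hge : 4 * q * ENNReal.ofReal W ≤ PhiBeta β₁ W := by
    refine le_trans (le_of_eq ?_) (PhiBeta_ge β₁)
    rw [← hq]; ring
  have heq : PhiBeta β₁ W - 4 * q * ENNReal.ofReal W + 4 * q * ENNReal.ofReal W = PhiBeta β₁ W :=
    tsub_add_cancel_of_le hge
  refine ⟨PhiBeta β₁ W - 4 * q * ENNReal.ofReal W, 4 * q, fun w hw => ?_, heq⟩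
  have hfin : 4 * q * ENNReal.ofReal W ≠ ⊤ := by finiteness
  rcases le_total w W with h | h
  · have h1 := PhiBeta_add β₁ hw h
    have h2 : q * ENNReal.ofReal (W - w) ≤ ∫⁻ r in Ico w W, invDecr β₁ (r / 2) := by
      calc _ = ∫⁻ r in Ico w W, q := by simp
        _ ≤ _ := setLIntegral_mono' measurableSet_Ico fun r hr => invDecr_anti β₁ (by linarith [hr.2])
    have h3 : ENNReal.ofReal W = ENNReal.ofReal (W - w) + ENNReal.ofReal w := by
      rw [← ENNReal.ofReal_add (by linarith) hw]; congr 1; ring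
    have hf2 : 4 * q * ENNReal.ofReal (W - w) ≠ ⊤ := by finiteness
    rw [← ENNReal.add_le_add_iff_right hf2]
    calc _ ≤ PhiBeta β₁ W := by rw [h1, mul_assoc]; gcongr
      _ = _ := by rw [add_assoc, ← mul_add, add_comm (ENNReal.ofReal w), ← h3, heq]
  · have h1 := PhiBeta_add β₁ hW.le h
    have h2 : ∫⁻ r in Ico W w, invDecr β₁ (r / 2) ≤ q * ENNReal.ofReal (w - W) := by
      calc _ ≤ ∫⁻ r in Ico W w, q := 
            setLIntegral_mono' measurableSet_Ico fun r hr => invDecr_anti β₁ (by linarith [hr.1])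
        _ = _ := by simp
    have h3 : ENNReal.ofReal w = ENNReal.ofReal W + ENNReal.ofReal (w - W) := by
      rw [← ENNReal.ofReal_add hW.le (by linarith)]; congr 1; ring
    rw [h1, h3, mul_add, ← add_assoc, heq, mul_assoc 4 q (ENNReal.ofReal (w - W))]
    gcongr

lemma Nfun_le {β₁ : ℝ → ℝ} {s : ℝ≥0} {u : ℝ} (hu : 0 < u) (h : (s : ℝ≥0∞) ≤ PhiBeta β₁ u) :
    Nfun β₁ s ≤ ENNReal.ofReal u := iInf₂_le u ⟨hu, h⟩

lemma le_Nfun {β₁ : ℝ → ℝ} {s : ℝ≥0} {u : ℝ} (h : PhiBeta β₁ u < s) :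
    ENNReal.ofReal u ≤ Nfun β₁ s := by
  refine le_iInf₂ fun v hv => ENNReal.ofReal_le_ofReal ?_
  by_contra hlt
  exact absurd (hv.2.trans (PhiBeta_mono β₁ (not_le.1 hlt).le)) (not_le.2 h)

lemma Nfun_mono (β₁ : ℝ → ℝ) : Monotone (Nfun β₁) := by
  intro a b hab
  refine le_iInf₂ fun v hv => Nfun_le hv.1 (le_trans (by exact_mod_cast hab) hv.2)

lemma Nfun_zero (β₁ : ℝ → ℝ) : Nfun β₁ 0 = 0 := by
  refine le_antisymm (ENNReal.le_of_forall_pos_le_add fun ε hε _ => ?_) bot_le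
  simpa using Nfun_le (β₁ := β₁) (s := 0) (u := ε) (by exact_mod_cast hε) (by simp)

lemma Nfun_pos {β₁ : ℝ → ℝ} (hΦ : ∀ t : ℝ, 0 < t → PhiBeta β₁ t < ∞) {s : ℝ≥0} (hs : 0 < s) :
    0 < Nfun β₁ s := by
  have hfin : ∫⁻ r in Ioo (0 : ℝ) 1, invDecr β₁ (r / 2) ≠ ⊤ := by
    intro h
    have := hΦ 1 one_pos
    simp [PhiBeta, h] at this
  have hv : Tendsto ((volume.restrict (Ioo (0 : ℝ) 1)) ∘ (fun u : ℝ => Ioo (0 : ℝ) u))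
      (nhdsWithin 0 (Ioi 0)) (nhds 0) := by
    have : Tendsto (fun u : ℝ => ENNReal.ofReal u) (nhdsWithin 0 (Ioi 0)) (nhds 0) := by
      have := (ENNReal.continuous_ofReal.tendsto (0 : ℝ))
      rw [ENNReal.ofReal_zero] at this
      exact this.mono_left nhdsWithin_le_nhds
    refine tendsto_of_tendsto_of_tendsto_of_le_of_le tendsto_const_nhds this
      (fun _ => bot_le) (fun u => ?_)
    refine (Measure.restrict_apply_le _ _).trans ?_
    simp
  have h1 := tendsto_setLIntegral_zero hfin hv
  have hs4 : (0 : ℝ≥0∞) < s / 4 := ENNReal.div_pos (by exact_mod_cast hs.ne') (by norm_num)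
  obtain ⟨u, hu, hu0, hu1⟩ := ((h1.eventually (gt_mem_nhds hs4)).and
    ((eventually_mem_nhdsWithin : ∀ᶠ u : ℝ in nhdsWithin 0 (Ioi 0), u ∈ Ioi (0:ℝ)).and
    (mem_nhdsWithin_of_mem_nhds (gt_mem_nhds (show (0:ℝ) < 1 from one_pos))))).exists
  have hu1 : u < 1 := hu1
  refine lt_of_lt_of_le (ENNReal.ofReal_pos.2 hu0) (le_Nfun ?_)
  rw [Measure.restrict_restrict measurableSet_Ioo,
    inter_eq_left.2 (Ioo_subset_Ioo_right hu1.le)] at hu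
  unfold PhiBeta
  rw [mul_comm]
  exact (ENNReal.lt_div_iff_mul_lt (by norm_num) (by norm_num)).1 hu

lemma Nfun_convex {β₁ : ℝ → ℝ} (hβ0 : Tendsto β₁ atTop (nhds 0)) (a b t : ℝ≥0) (ht : t ≤ 1) :
    Nfun β₁ (t * a + (1 - t) * b) ≤
      (t : ℝ≥0∞) * Nfun β₁ a + ((1 - t : ℝ≥0) : ℝ≥0∞) * Nfun β₁ b := by
  rcases eq_or_ne t 0 with rfl | h0
  · simp
  rcases eq_or_ne (1 - t) 0 with h1 | h1
  · have : t = 1 := le_antisymm ht (tsub_eq_zero_iff_le.1 h1)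
    subst this; simp
  rcases eq_or_ne (Nfun β₁ a) ⊤ with ha | ha
  · simp [ha, h0]
  rcases eq_or_ne (Nfun β₁ b) ⊤ with hb | hb
  · rw [hb, ENNReal.mul_top (by exact_mod_cast h1)]; simp
  generalize hs : 1 - t = s at *
  have hts : t + s = 1 := by rw [← hs]; exact add_tsub_cancel_of_le ht
  have hts' : (t : ℝ≥0∞) + s = 1 := by exact_mod_cast hts
  refine ENNReal.le_of_forall_pos_le_add fun ε hε _ => ?_
  have hε' : (ε : ℝ≥0∞) ≠ 0 := by exact_mod_cast hε.ne'
  obtain ⟨u, hu⟩ := iInf_lt_iff.1 (ENNReal.lt_add_right ha hε')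
  obtain ⟨hu1, hu2⟩ := iInf_lt_iff.1 hu
  obtain ⟨v, hv⟩ := iInf_lt_iff.1 (ENNReal.lt_add_right hb hε')
  obtain ⟨hv1, hv2⟩ := iInf_lt_iff.1 hv
  have hW : (0 : ℝ) < t * u + s * v := by
    have : (0 : ℝ) < t := by exact_mod_cast pos_iff_ne_zero.2 h0
    have : (0 : ℝ) < s := by exact_mod_cast pos_iff_ne_zero.2 h1
    have := hu1.1; have := hv1.1; positivity
  have hofr : ENNReal.ofReal (t * u + s * v) = t * ENNReal.ofReal u + s * ENNReal.ofReal v := by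
    have := hu1.1; have := hv1.1
    rw [ENNReal.ofReal_add (by positivity) (by positivity), ENNReal.ofReal_mul (by positivity),
      ENNReal.ofReal_mul (by positivity)]
    simp
  obtain ⟨C, p, hC, hCW⟩ := PhiBeta_support β₁ hβ0 hW
  have key : ((t * a + s * b : ℝ≥0) : ℝ≥0∞) ≤ PhiBeta β₁ (t * u + s * v) := by
    rw [← hCW, hofr]
    push_cast
    calc (t : ℝ≥0∞) * a + s * b ≤ t * (C + p * ENNReal.ofReal u) + s * (C + p * ENNReal.ofReal v) := by
          gcongr
          · exact hu1.2.trans (hC u hu1.1.le)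
          · exact hv1.2.trans (hC v hv1.1.le)
      _ = (t + s) * C + p * (t * ENNReal.ofReal u + s * ENNReal.ofReal v) := by ring
      _ = _ := by rw [hts', one_mul]
  refine (Nfun_le hW key).trans ?_
  rw [hofr]
  calc _ ≤ (t : ℝ≥0∞) * (Nfun β₁ a + ε) + s * (Nfun β₁ b + ε) := by
        gcongr
        · exact hu2.le
        · exact hv2.le
    _ = t * Nfun β₁ a + s * Nfun β₁ b + (t + s) * ε := by ring
    _ = _ := by rw [hts', one_mul]

lemma Nfun_tendsto {β₁ : ℝ → ℝ} (hΦ : ∀ t : ℝ, 0 < t → PhiBeta β₁ t < ∞) :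
    Tendsto (Nfun β₁) atTop (nhds ⊤) := by
  refine ENNReal.tendsto_nhds_top fun n => ?_
  have h := hΦ (n + 1) (by positivity)
  filter_upwards [eventually_gt_atTop (PhiBeta β₁ (n + 1)).toNNReal] with s hs
  have : PhiBeta β₁ (n + 1) < s := by
    rw [← ENNReal.coe_toNNReal h.ne]; exact_mod_cast hs
  refine lt_of_lt_of_le ?_ (le_Nfun this)
  rw [ENNReal.lt_ofReal_iff_toReal_lt (by simp)]
  simp

def NYoung (β₁ : ℝ → ℝ) (hβ0 : Tendsto β₁ atTop (nhds 0))
    (hΦ : ∀ t : ℝ, 0 < t → PhiBeta β₁ t < ∞) : YoungFunction where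
  toFun := Nfun β₁
  map_zero := Nfun_zero β₁
  mono := Nfun_mono β₁
  convex := Nfun_convex hβ0
  tendsto_top := Nfun_tendsto hΦ

lemma nnnorm_sub_split (a b : ℝ) :
    (‖a - b‖₊ : ℝ≥0∞) = ENNReal.ofReal (a - b) + ENNReal.ofReal (b - a) := by
  rw [← enorm_eq_nnnorm, Real.enorm_eq_ofReal_abs]
  rcases le_total a b with h | h
  · rw [abs_of_nonpos (by linarith), ENNReal.ofReal_of_nonpos (p := a - b) (by linarith), zero_add,
      neg_sub]
  · rw [abs_of_nonneg (by linarith), ENNReal.ofReal_of_nonpos (p := b - a) (by linarith), add_zero]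

section energy

variable {E : Type*} [MeasurableSpace E] (μ : Measure E) [SigmaFinite μ]

/-- one-sided energy -/
def energy (k : E → E → ℝ≥0∞) (u : E → ℝ) : ℝ≥0∞ :=
  ∫⁻ x, ∫⁻ y, ENNReal.ofReal (u x - u y) * k x y ∂μ ∂μ

lemma energy_symm {k : E → E → ℝ≥0∞} (hk : Measurable (Function.uncurry k))
    (hs : ∀ x y, k x y = k y x) {u : E → ℝ} (hu : Measurable u) :
    ∫⁻ x, ∫⁻ y, (‖u x - u y‖₊ : ℝ≥0∞) * k x y ∂μ ∂μ = 2 * energy μ k u := by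
  have hm : Measurable (Function.uncurry fun x y => ENNReal.ofReal (u x - u y) * k x y) := by
    have : Measurable fun z : E × E => ENNReal.ofReal (u z.1 - u z.2) * Function.uncurry k z := by
      fun_prop
    exact this
  have hm2 : Measurable (Function.uncurry fun x y => ENNReal.ofReal (u y - u x) * k x y) := by
    have : Measurable fun z : E × E => ENNReal.ofReal (u z.2 - u z.1) * Function.uncurry k z := by
      fun_prop
    exact this
  have h2 : ∫⁻ x, ∫⁻ y, ENNReal.ofReal (u y - u x) * k x y ∂μ ∂μ = energy μ k u := by
    rw [lintegral_lintegral_swap hm2.aemeasurable]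
    unfold energy
    refine lintegral_congr fun x => lintegral_congr fun y => ?_
    rw [hs]
  calc _ = ∫⁻ x, (∫⁻ y, ENNReal.ofReal (u x - u y) * k x y ∂μ) +
        ∫⁻ y, ENNReal.ofReal (u y - u x) * k x y ∂μ ∂μ := by
        refine lintegral_congr fun x => ?_
        rw [← lintegral_add_left (hm.of_uncurry_left (x := x))]
        refine lintegral_congr fun y => ?_
        rw [nnnorm_sub_split, add_mul]
    _ = _ := by
        rw [lintegral_add_left (f := fun x => ∫⁻ y, ENNReal.ofReal (u x - u y) * k x y ∂μ)
          hm.lintegral_prod_right', h2, two_mul]; rfl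

lemma coarea_aux (a b : ℝ) :
    ∫⁻ t in Ioi (0 : ℝ), ENNReal.ofReal ((if t < a then 1 else 0) - (if t < b then 1 else 0)) ≤
      ENNReal.ofReal (a - b) := by
  calc _ ≤ ∫⁻ t, (Ico b a).indicator (fun _ => (1 : ℝ≥0∞)) t := by
        refine (setLIntegral_le_lintegral _ _).trans (lintegral_mono fun t => ?_)
        by_cases h1 : t < a <;> by_cases h2 : t < b <;> simp [h1, h2, Set.indicator]
        · simp [not_lt.1 h2]
    _ = _ := by simp [lintegral_indicator]

lemma coarea {k : E → E → ℝ≥0∞} (hk : Measurable (Function.uncurry k))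
    {u : E → ℝ} (hu : Measurable u) :
    ∫⁻ t in Ioi (0 : ℝ), energy μ k (fun x => if t < u x then 1 else 0) ≤ energy μ k u := by
  have hm : Measurable fun q : ℝ × (E × E) =>
      ENNReal.ofReal ((if q.1 < u q.2.1 then 1 else 0) - (if q.1 < u q.2.2 then 1 else 0)) *
        Function.uncurry k q.2 := by
    refine Measurable.mul (ENNReal.measurable_ofReal.comp (Measurable.sub ?_ ?_)) (by fun_prop)
    · exact Measurable.ite (measurableSet_lt (by fun_prop) (by fun_prop)) measurable_const
        measurable_const
    · exact Measurable.ite (measurableSet_lt (by fun_prop) (by fun_prop)) measurable_const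
        measurable_const
  have he : ∀ t, energy μ k (fun x => if t < u x then 1 else 0) = ∫⁻ z : E × E,
      ENNReal.ofReal ((if t < u z.1 then 1 else 0) - (if t < u z.2 then 1 else 0)) *
        Function.uncurry k z ∂(μ.prod μ) := by
    intro t
    have hmt : Measurable fun z : E × E =>
      ENNReal.ofReal ((if t < u z.1 then 1 else 0) - (if t < u z.2 then 1 else 0)) *
        Function.uncurry k z := hm.comp (measurable_prodMk_left (x := t))
    rw [lintegral_prod _ hmt.aemeasurable]
    rfl
  have he2 : energy μ k u = ∫⁻ z : E × E,
      ENNReal.ofReal (u z.1 - u z.2) * Function.uncurry k z ∂(μ.prod μ) := by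
    rw [lintegral_prod _ (by fun_prop)]
    rfl
  simp_rw [he, he2]
  rw [lintegral_lintegral_swap hm.aemeasurable]
  refine lintegral_mono fun z => ?_
  dsimp only
  rw [lintegral_mul_const _ ?_]
  · gcongr
    exact coarea_aux _ _
  · refine (ENNReal.measurable_ofReal.comp (Measurable.sub ?_ ?_))
    · exact Measurable.ite (measurableSet_lt (by fun_prop) (by fun_prop)) measurable_const
        measurable_const
    · exact Measurable.ite (measurableSet_lt (by fun_prop) (by fun_prop)) measurable_const
        measurable_const

lemma isoperimetric {k : E → E → ℝ≥0∞} (hk : Measurable (Function.uncurry k))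
    (hs : ∀ x y, k x y = k y x) (β₁ : ℝ → ℝ)
    (hβ0 : Tendsto β₁ atTop (nhds 0))
    (hPoin : ∀ r : ℝ, 0 < r →
      ∀ f : E → ℝ, Measurable f → (∫⁻ x, (‖f x‖₊ : ℝ≥0∞) ^ 2 ∂μ) < ∞ →
        ∫⁻ x, (‖f x‖₊ : ℝ≥0∞) ^ 2 ∂μ ≤
          ENNReal.ofReal r *
            (∫⁻ x, (∫⁻ y, (‖f x ^ 2 - f y ^ 2‖₊ : ℝ≥0∞) * k x y ∂μ) ∂μ)
          + ENNReal.ofReal (β₁ r) * (∫⁻ x, (‖f x‖₊ : ℝ≥0∞) ∂μ) ^ 2)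
    {u : E → ℝ} (hu : Measurable u) {t : ℝ} (h0 : μ {x | t < u x} ≠ 0)
    (h1 : μ {x | t < u x} ≠ ⊤) :
    (PhiBeta β₁ ((μ {x | t < u x})⁻¹).toReal)⁻¹ ≤
      energy μ k (fun x => if t < u x then 1 else 0) := by
  set m := μ {x | t < u x} with hm
  set I := energy μ k (fun x => if t < u x then 1 else 0) with hI
  have hset : MeasurableSet {x | t < u x} := measurableSet_lt measurable_const hu
  have hf : Measurable (fun x => if t < u x then (1 : ℝ) else 0) :=
    Measurable.ite hset measurable_const measurable_const
  have hL1 : ∫⁻ x, (‖(if t < u x then (1 : ℝ) else 0)‖₊ : ℝ≥0∞) ∂μ = m := by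
    rw [hm, ← lintegral_indicator_one hset]
    refine lintegral_congr fun x => ?_
    by_cases h : t < u x <;> simp [h]
  have hL2 : ∫⁻ x, (‖(if t < u x then (1 : ℝ) else 0)‖₊ : ℝ≥0∞) ^ 2 ∂μ = m := by
    rw [hm, ← lintegral_indicator_one hset]
    refine lintegral_congr fun x => ?_
    by_cases h : t < u x <;> simp [h]
  have hsq : ∀ x, (if t < u x then (1 : ℝ) else 0) ^ 2 = if t < u x then (1 : ℝ) else 0 := by
    intro x; split_ifs <;> simp
  have hineq : ∀ r : ℝ, 0 < r → m ≤ ENNReal.ofReal r * (2 * I) + ENNReal.ofReal (β₁ r) * m ^ 2 := by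
    intro r hr
    have := hPoin r hr _ hf (by rw [hL2]; exact h1.lt_top)
    rw [hL1, hL2] at this
    simp only [hsq] at this
    rwa [energy_symm μ hk hs hf] at this
  rcases eq_or_ne I ⊤ with hIt | hIt
  · rw [hIt]; exact le_top
  set M := m.toReal with hM
  have hMpos : 0 < M := ENNReal.toReal_pos h0 h1
  have hmM : m = ENNReal.ofReal M := (ENNReal.ofReal_toReal h1).symm
  have hinv : (m⁻¹).toReal = M⁻¹ := by rw [ENNReal.toReal_inv]
  have hIr : I = ENNReal.ofReal I.toReal := (ENNReal.ofReal_toReal hIt).symm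
  have hR0 : 0 ≤ I.toReal := ENNReal.toReal_nonneg
  have key : ∀ r : ℝ, 0 < r → β₁ r ≤ M⁻¹ / 2 → M ≤ 4 * r * I.toReal := by
    intro r hr hb
    have h3 := hineq r hr
    have h4 : ENNReal.ofReal M ≤ ENNReal.ofReal (r * (2 * I.toReal) + M⁻¹ / 2 * M ^ 2) := by
      rw [ENNReal.ofReal_add (by positivity) (by positivity), ENNReal.ofReal_mul hr.le,
        ENNReal.ofReal_mul (by norm_num), ← hIr, ENNReal.ofReal_mul (by positivity),
        ENNReal.ofReal_pow hMpos.le, ← hmM]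
      simp only [ENNReal.ofReal_ofNat]
      refine h3.trans ?_
      gcongr
    rw [ENNReal.ofReal_le_ofReal_iff (by positivity)] at h4
    have : M⁻¹ / 2 * M ^ 2 = M / 2 := by field_simp
    linarith
  obtain ⟨r0, hr0, hb0⟩ := invDecr_lt_top β₁ hβ0 (show 0 < M⁻¹ / 2 by positivity)
  have hIpos : 0 < I.toReal := by
    have := key r0 hr0 hb0
    by_contra hh
    have h0' : I.toReal = 0 := le_antisymm (not_lt.1 hh) hR0
    rw [h0', mul_zero] at this
    linarith
  have hinvd : ENNReal.ofReal (M / (4 * I.toReal)) ≤ invDecr β₁ (M⁻¹ / 2) := by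
    refine le_iInf₂ fun r hr => ENNReal.ofReal_le_ofReal ?_
    rw [div_le_iff₀ (by positivity)]
    linarith [key r hr.1 hr.2]
  rw [hinv]
  have h5 : ENNReal.ofReal (I.toReal⁻¹) ≤ PhiBeta β₁ M⁻¹ := by
    refine le_trans ?_ (PhiBeta_ge β₁)
    refine le_trans (le_of_eq ?_) (mul_le_mul_right (mul_le_mul_right hinvd _) _)
    rw [← ENNReal.ofReal_mul (by positivity), ← ENNReal.ofReal_ofNat 4,
      ← ENNReal.ofReal_mul (by positivity)]
    congr 1
    field_simp
  rw [ENNReal.inv_le_iff_inv_le, hIr, ← ENNReal.ofReal_inv_of_pos hIpos]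
  exact h5

end energy

lemma luxemburg_bound {E : Type*} [MeasurableSpace E] (μ : Measure E) [SigmaFinite μ]
    (β₁ : ℝ → ℝ) (hβpos : ∀ r : ℝ, 0 < r → 0 < β₁ r)
    (hβdec : AntitoneOn β₁ (Ioi 0))
    (hβ0 : Tendsto β₁ atTop (nhds 0))
    (hΦ : ∀ t : ℝ, 0 < t → PhiBeta β₁ t < ∞)
    (f : E → ℝ) (hf : Measurable f) (hfin : ∀ t : ℝ, 0 < t → μ {x | t < |f x|} ≠ ⊤)
    (g : ℝ → ℝ≥0∞)
    (hg : g = fun t => if μ {x | t < |f x|} = 0 then 0 else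
      (PhiBeta β₁ ((μ {x | t < |f x|})⁻¹).toReal)⁻¹) :
    orliczNorm μ (Nfun β₁) f ≤ ∫⁻ t in Ioi (0 : ℝ), g t := by
  set m : ℝ → ℝ≥0∞ := fun t => μ {x | t < |f x|} with hm
  have hmanti : Antitone m := fun a b hab => measure_mono fun x hx => lt_of_le_of_lt hab hx
  have hmmeas : Measurable m := hmanti.measurable
  have hgmeas : Measurable g := by
    rw [hg]
    refine Measurable.ite (hmmeas (measurableSet_singleton 0)) measurable_const ?_
    exact ((PhiBeta_mono β₁).measurable.comp (hmmeas.inv.ennreal_toReal)).inv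
  refine le_of_forall_gt_imp_ge_of_dense fun b' hb' => ?_
  rcases eq_or_ne b' ⊤ with rfl | hbt
  · exact le_top
  lift b' to ℝ≥0 using hbt with b
  have hb0 : 0 < b := by
    have : (0 : ℝ≥0∞) < b := lt_of_le_of_lt bot_le hb'
    exact_mod_cast this
  have hbne : (b : ℝ≥0∞) ≠ 0 := by exact_mod_cast hb0.ne'
  refine iInf₂_le b ⟨hb0, ?_⟩
  set h : ℝ → ℝ≥0∞ := fun t => g t / b with hh
  have hhmeas : Measurable h := hgmeas.div_const _
  have hkmeas : Measurable fun t => h t * (m t)⁻¹ := hhmeas.mul hmmeas.inv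
  have htot : ∫⁻ t in Ioi (0 : ℝ), h t ≤ 1 := by
    simp only [hh, div_eq_mul_inv]
    rw [lintegral_mul_const _ hgmeas, ← div_eq_mul_inv]
    exact ENNReal.div_le_of_le_mul (by rw [one_mul]; exact hb'.le)
  have hnull : ∀ᵐ x ∂μ, ∀ t : ℝ, t < |f x| → m t ≠ 0 := by
    have : ∀ᵐ x ∂μ, ∀ q : ℚ, m q = 0 → ¬ ((q : ℝ) < |f x|) := by
      rw [ae_all_iff]
      intro q
      by_cases hq : m q = 0
      · have : ∀ᵐ x ∂μ, ¬ ((q : ℝ) < |f x|) := by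
          rw [ae_iff]; simpa using hq
        filter_upwards [this] with x hx _ using hx
      · exact Eventually.of_forall fun x hx => absurd hx hq
    filter_upwards [this] with x hx t ht h0
    obtain ⟨q, hq1, hq2⟩ := exists_rat_btwn ht
    exact hx q (le_antisymm (h0 ▸ hmanti hq1.le) bot_le) hq2
  have hpt : ∀ᵐ x ∂μ, Nfun β₁ (‖f x‖₊ / b) ≤
      ∫⁻ t in Ioi (0 : ℝ), (if t < |f x| then h t * (m t)⁻¹ else 0) := by
    filter_upwards [hnull] with x hx
    rcases (abs_nonneg (f x)).eq_or_lt with hF | hF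
    · have : f x = 0 := abs_eq_zero.1 hF.symm
      simp [this, Nfun_zero]
    have hKeq : ∫⁻ t in Ioi (0 : ℝ), (if t < |f x| then h t * (m t)⁻¹ else 0) =
        ∫⁻ t in Ioo (0 : ℝ) |f x|, h t * (m t)⁻¹ := by
      rw [← lintegral_indicator measurableSet_Ioi, ← lintegral_indicator measurableSet_Ioo]
      refine lintegral_congr fun t => ?_
      by_cases h1 : 0 < t <;> by_cases h2 : t < |f x| <;> simp [h1, h2, Set.indicator]
    rw [hKeq]
    set K := ∫⁻ t in Ioo (0 : ℝ) |f x|, h t * (m t)⁻¹ with hK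
    rcases eq_or_ne K ⊤ with hKt | hKt
    · rw [hKt]; exact le_top
    have hw : ∀ t ∈ Ioo (0 : ℝ) |f x|, 0 < ((m t)⁻¹).toReal := fun t ht =>
      ENNReal.toReal_pos (ENNReal.inv_ne_zero.2 (hfin t ht.1)) (ENNReal.inv_ne_top.2 (hx t ht.2))
    have hgt : ∀ t ∈ Ioo (0 : ℝ) |f x|, g t = (PhiBeta β₁ ((m t)⁻¹).toReal)⁻¹ := fun t ht => by
      rw [hg]; exact if_neg (hx t ht.2)
    have hK0 : K ≠ 0 := by
      intro h0
      rw [hK, lintegral_eq_zero_iff hkmeas] at h0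
      have h1 : ∀ᵐ t ∂(volume.restrict (Ioo (0 : ℝ) |f x|)), False := by
        filter_upwards [h0, ae_restrict_mem measurableSet_Ioo] with t ht ht'
        have h2 : h t ≠ 0 := by
          simp only [hh, hgt t ht']
          exact (ENNReal.div_pos (ENNReal.inv_ne_zero.2 (hΦ _ (hw t ht')).ne) ENNReal.coe_ne_top).ne'
        exact absurd ht (mul_ne_zero h2 (ENNReal.inv_ne_zero.2 (hfin t ht'.1)))
      rw [ae_iff] at h1
      simp at h1
      simp [h1] at hF
    have hW : 0 < K.toReal := ENNReal.toReal_pos hK0 hKt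
    obtain ⟨C, p, hC, hCW⟩ := PhiBeta_support β₁ hβ0 hW
    rw [← ENNReal.ofReal_toReal hKt]
    refine Nfun_le hW ?_
    rw [← hCW, ENNReal.ofReal_toReal hKt]
    calc ((‖f x‖₊ / b : ℝ≥0) : ℝ≥0∞) = ∫⁻ t in Ioo (0 : ℝ) |f x|, (b : ℝ≥0∞)⁻¹ := by
          rw [ENNReal.coe_div hb0.ne']
          simp [div_eq_mul_inv, mul_comm, ← Real.enorm_eq_ofReal_abs, enorm_eq_nnnorm]
      _ ≤ ∫⁻ t in Ioo (0 : ℝ) |f x|, (h t * C + p * (h t * (m t)⁻¹)) := by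
          refine setLIntegral_mono' measurableSet_Ioo fun t ht => ?_
          have h1 := hC _ (hw t ht).le
          rw [ENNReal.ofReal_toReal (ENNReal.inv_ne_top.2 (hx t ht.2))] at h1
          have h2 : g t * PhiBeta β₁ ((m t)⁻¹).toReal = 1 := by
            rw [hgt t ht]
            exact ENNReal.inv_mul_cancel (PhiBeta_pos β₁ hβpos hβdec (hw t ht)).ne'
              (hΦ _ (hw t ht)).ne
          calc (b : ℝ≥0∞)⁻¹ = h t * PhiBeta β₁ ((m t)⁻¹).toReal := by
                simp only [hh, div_eq_mul_inv]
                rw [mul_right_comm, h2, one_mul]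
            _ ≤ h t * (C + p * (m t)⁻¹) := by gcongr
            _ = _ := by ring
      _ = (∫⁻ t in Ioo (0 : ℝ) |f x|, h t) * C + p * K := by
          rw [lintegral_add_left (hhmeas.mul_const _), lintegral_mul_const _ hhmeas,
            lintegral_const_mul _ hkmeas]
      _ ≤ 1 * C + p * K := by
          gcongr
          exact (lintegral_mono_set Ioo_subset_Ioi_self).trans htot
      _ = _ := by rw [one_mul]
  have hmeas2 : Measurable (Function.uncurry fun (x : E) (t : ℝ) =>
      if t < |f x| then h t * (m t)⁻¹ else 0) := by
    have : Measurable fun z : E × ℝ => if z.2 < |f z.1| then h z.2 * (m z.2)⁻¹ else 0 :=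
      Measurable.ite (measurableSet_lt measurable_snd (by fun_prop))
        ((hhmeas.comp measurable_snd).mul (hmmeas.comp measurable_snd).inv) measurable_const
    exact this
  calc _ ≤ ∫⁻ x, (∫⁻ t in Ioi (0 : ℝ), (if t < |f x| then h t * (m t)⁻¹ else 0)) ∂μ :=
        lintegral_mono_ae hpt
    _ = ∫⁻ t in Ioi (0 : ℝ), ∫⁻ x, (if t < |f x| then h t * (m t)⁻¹ else 0) ∂μ :=
        lintegral_lintegral_swap hmeas2.aemeasurable
    _ ≤ ∫⁻ t in Ioi (0 : ℝ), h t := by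
        refine lintegral_mono fun t => ?_
        have hset : MeasurableSet {x | t < |f x|} := measurableSet_lt measurable_const (by fun_prop)
        have : ∫⁻ x, (if t < |f x| then h t * (m t)⁻¹ else 0) ∂μ = h t * (m t)⁻¹ * m t := by
          rw [← lintegral_indicator_const hset]
          refine lintegral_congr fun x => ?_
          simp [Set.indicator]
        dsimp only
        rw [this, mul_assoc]
        exact mul_le_of_le_one_right bot_le (ENNReal.inv_mul_le_one _)
    _ ≤ 1 := htot

/-- the Poincaré type isoperimetric inequality with decreasing
rate `β₁` vanishing at infinity, together with `Φ(t) = 4∫₀ᵗ β₁⁻¹(r/2) dr < ∞`,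
implies that `N = Φ⁻¹` is a Young function with
`‖f‖_N ≤ (1/2) ∫∫ |f(x)-f(y)| J_γ(dx,dy)` for all `f ∈ L_N(μ)`. -/
theorem orliczSobolev_of_poincare_type
    {E : Type*} [MeasurableSpace E] (μ : Measure E) [SigmaFinite μ]
    (J γ : E → E → ℝ≥0)
    (hJmeas : Measurable (Function.uncurry J)) (hJsymm : ∀ x y, J x y = J y x)
    (hγmeas : Measurable (Function.uncurry γ)) (hγsymm : ∀ x y, γ x y = γ y x)
    (hγpos : ∀ x y, x ≠ y → 0 < γ x y)
    (β₁ : ℝ → ℝ) (hβpos : ∀ r : ℝ, 0 < r → 0 < β₁ r)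
    (hβdec : AntitoneOn β₁ (Ioi 0))
    (hβ0 : Tendsto β₁ atTop (nhds 0))
    (hPoin : ∀ r : ℝ, 0 < r →
      ∀ f : E → ℝ, Measurable f → (∫⁻ x, (‖f x‖₊ : ℝ≥0∞) ^ 2 ∂μ) < ∞ →
        ∫⁻ x, (‖f x‖₊ : ℝ≥0∞) ^ 2 ∂μ ≤
          ENNReal.ofReal r *
            (∫⁻ x, (∫⁻ y, (‖f x ^ 2 - f y ^ 2‖₊ : ℝ≥0∞) * (γ x y : ℝ≥0∞) *
              (J x y : ℝ≥0∞) ∂μ) ∂μ)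
          + ENNReal.ofReal (β₁ r) * (∫⁻ x, (‖f x‖₊ : ℝ≥0∞) ∂μ) ^ 2)
    (hΦ : ∀ t : ℝ, 0 < t → PhiBeta β₁ t < ∞) :
    ∃ NY : YoungFunction,
      NY.toFun = (fun s : ℝ≥0 =>
        ⨅ (u : ℝ) (_ : 0 < u ∧ (s : ℝ≥0∞) ≤ PhiBeta β₁ u), ENNReal.ofReal u) ∧
      ∀ f : E → ℝ, Measurable f → orliczNorm μ NY.toFun f < ∞ →
        orliczNorm μ NY.toFun f ≤
          2⁻¹ * ∫⁻ x, (∫⁻ y, (‖f x - f y‖₊ : ℝ≥0∞) * (γ x y : ℝ≥0∞) *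
            (J x y : ℝ≥0∞) ∂μ) ∂μ := by
  refine ⟨NYoung β₁ hβ0 hΦ, rfl, fun f hf hfN => ?_⟩
  change orliczNorm μ (Nfun β₁) f < ∞ at hfN
  change orliczNorm μ (Nfun β₁) f ≤ _
  set k : E → E → ℝ≥0∞ := fun x y => (γ x y : ℝ≥0∞) * (J x y : ℝ≥0∞) with hk
  have hkm : Measurable (Function.uncurry k) := by
    have : Measurable fun z : E × E => ((Function.uncurry γ z : ℝ≥0) : ℝ≥0∞) *
        ((Function.uncurry J z : ℝ≥0) : ℝ≥0∞) := by fun_prop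
    exact this
  have hks : ∀ x y, k x y = k y x := fun x y => by simp only [hk]; rw [hγsymm x y, hJsymm x y]
  simp only [mul_assoc] at hPoin ⊢
  have habs : Measurable fun x => |f x| := by fun_prop
  have hfin : ∀ t : ℝ, 0 < t → μ {x | t < |f x|} ≠ ⊤ := by
    intro t ht
    obtain ⟨r, hr⟩ := iInf_lt_iff.1 hfN
    obtain ⟨⟨hr0, hr1⟩, -⟩ := iInf_lt_iff.1 hr
    have hset : MeasurableSet {x | t < |f x|} := measurableSet_lt measurable_const habs
    have hc : 0 < Nfun β₁ (t.toNNReal / r) := Nfun_pos hΦ (by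
      have : 0 < t.toNNReal := Real.toNNReal_pos.2 ht
      positivity)
    intro htop
    have h1 : Nfun β₁ (t.toNNReal / r) * μ {x | t < |f x|} ≤ 1 := by
      rw [← setLIntegral_const]
      refine le_trans ?_ hr1
      refine (setLIntegral_mono' hset fun x hx => ?_).trans (setLIntegral_le_lintegral _ _)
      refine Nfun_mono β₁ ?_
      gcongr
      refine Real.toNNReal_le_iff_le_coe.2 ?_
      simpa using le_of_lt hx
    rw [htop, ENNReal.mul_top hc.ne'] at h1
    simp at h1
  refine (luxemburg_bound μ β₁ hβpos hβdec hβ0 hΦ f hf hfin _ rfl).trans ?_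
  calc _ ≤ ∫⁻ t in Ioi (0 : ℝ), energy μ k (fun x => if t < |f x| then 1 else 0) := by
        refine setLIntegral_mono' measurableSet_Ioi fun t ht => ?_
        split_ifs with h0
        · exact bot_le
        · exact isoperimetric μ hkm hks β₁ hβ0 hPoin habs h0 (hfin t ht)
    _ ≤ energy μ k (fun x => |f x|) := coarea μ hkm habs
    _ = 2⁻¹ * (2 * energy μ k (fun x => |f x|)) := by
        rw [← mul_assoc, ENNReal.inv_mul_cancel (by norm_num) (by norm_num), one_mul]
    _ ≤ _ := by
        rw [← energy_symm μ hkm hks habs]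
        gcongr with x y
        exact_mod_cast abs_abs_sub_abs_le_abs_sub (f x) (f y)
end
end

section
/- Let β₁ : (0,∞) → (0,∞) be decreasing with lim_{r→∞} β₁(r) = 0, and assume ‖f‖₂² ≤ r ∫_{E×E} |f²(x) − f²(y)| J_γ(dx,dy) + β₁(r) ‖f‖₁² holds for all r > 0 and f ∈ L²(μ). If c_γ := ess sup_x ∫_E γ(x,y)² J(x,y) μ(dy) < ∞, then the super Poincaré inequality ‖f‖₂² ≤ r E(f,f) + β(r) ‖f‖₁² holds for all r > 0 and f ∈ D(E), with β(r) := 2 β₁( √r / (2√(2c_γ)) ). -/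
open MeasureTheory ENNReal NNReal Filter Set

noncomputable section

lemma pointwise_aux (r c : ℝ) (hr : 0 < r) (hc : 0 < c) (a b : ℝ) (g j : ℝ≥0) :
    ENNReal.ofReal (Real.sqrt r / (2 * Real.sqrt (2 * c))) *
      ((‖a ^ 2 - b ^ 2‖₊ : ℝ≥0∞) * (g : ℝ≥0∞) * (j : ℝ≥0∞)) ≤
    ENNReal.ofReal (r / 4) * ((‖a - b‖₊ : ℝ≥0∞) ^ 2 * (j : ℝ≥0∞)) +
      ENNReal.ofReal (1 / (4 * c)) *
        ((‖a‖₊ : ℝ≥0∞) ^ 2 * ((g : ℝ≥0∞) ^ 2 * (j : ℝ≥0∞)) +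
          (‖b‖₊ : ℝ≥0∞) ^ 2 * ((g : ℝ≥0∞) ^ 2 * (j : ℝ≥0∞))) := by
  have key : Real.sqrt r / (2 * Real.sqrt (2 * c)) * (|a ^ 2 - b ^ 2| * g * j) ≤
      r / 4 * (|a - b| ^ 2 * j) + 1 / (4 * c) *
        (|a| ^ 2 * (g ^ 2 * j) + |b| ^ 2 * (g ^ 2 * j)) := by
    set s := Real.sqrt r / (2 * Real.sqrt (2 * c)) with hs
    have hs0 : 0 ≤ s := by positivity
    have hs2 : s ^ 2 = r * (1 / (8 * c)) := by
      rw [hs, div_pow, mul_pow, Real.sq_sqrt hr.le, Real.sq_sqrt (by positivity)]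
      field_simp
      norm_num
    have hab : |a ^ 2 - b ^ 2| = |a - b| * |a + b| := by
      rw [← abs_mul]; congr 1; ring
    rw [hab, sq_abs a, sq_abs b]
    have hj : (0 : ℝ) ≤ j := j.2
    have hg : (0 : ℝ) ≤ g := g.2
    have h1 : s * (|a - b| * |a + b| * g) ≤ r / 4 * |a - b| ^ 2 +
        1 / (8 * c) * (|a + b| ^ 2 * g ^ 2) := by
      apply le_of_sub_nonneg
      have : r / 4 * |a - b| ^ 2 + 1 / (8 * c) * (|a + b| ^ 2 * g ^ 2)
          - s * (|a - b| * |a + b| * g)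
          = 1 / r * (r / 2 * |a - b| - s * (|a + b| * g)) ^ 2 := by
        have h8 : 1 / (8 * c) = s ^ 2 / r := by rw [hs2]; field_simp
        rw [h8]; field_simp; ring
      rw [this]; positivity
    have h2 : |a + b| ^ 2 ≤ 2 * (a ^ 2 + b ^ 2) := by
      rw [sq_abs]; nlinarith [sq_nonneg (a - b)]
    have h3 : 1 / (8 * c) * (|a + b| ^ 2 * g ^ 2) ≤
        1 / (8 * c) * (2 * (a ^ 2 + b ^ 2) * g ^ 2) := by gcongr
    have h4 : 1 / (8 * c) * (2 * (a ^ 2 + b ^ 2) * (g : ℝ) ^ 2) =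
        1 / (4 * c) * ((a ^ 2 + b ^ 2) * g ^ 2) := by field_simp; ring
    have h5 := mul_le_mul_of_nonneg_right (h1.trans (add_le_add_right (h3.trans h4.le) _)) hj
    linarith
  have e : ∀ x : ℝ, (‖x‖₊ : ℝ≥0∞) = ENNReal.ofReal |x| := fun x => by
    rw [← Real.norm_eq_abs, ofReal_norm]; rfl
  have e' : ∀ x : ℝ≥0, (x : ℝ≥0∞) = ENNReal.ofReal (x : ℝ) := fun x => by simp
  rw [e, e, e, e, e' g, e' j]
  have hg : (0 : ℝ) ≤ g := g.2
  have hj : (0 : ℝ) ≤ j := j.2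
  simp only [← ENNReal.ofReal_pow (abs_nonneg _), ← ENNReal.ofReal_pow hg]
  rw [← ENNReal.ofReal_mul (by positivity), ← ENNReal.ofReal_mul (by positivity),
    ← ENNReal.ofReal_mul (by positivity), ← ENNReal.ofReal_mul (by positivity),
    ← ENNReal.ofReal_mul (by positivity), ← ENNReal.ofReal_mul (by positivity),
    ← ENNReal.ofReal_mul (by positivity), ← ENNReal.ofReal_mul (by positivity),
    ← ENNReal.ofReal_add (by positivity) (by positivity),
    ← ENNReal.ofReal_mul (by positivity),
    ← ENNReal.ofReal_add (by positivity) (by positivity)]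
  exact ENNReal.ofReal_le_ofReal key

/-- the Poincaré type isoperimetric inequality with decreasing
rate `β₁` vanishing at infinity, together with
`c_γ = ess sup_x ∫ γ(x,y)² J(x,y) μ(dy) < ∞`, implies the super Poincaré
inequality with `β(r) = 2 β₁(√r/(2√(2c_γ)))`. -/
theorem superPoincare_of_poincare_type
    {E : Type*} [MeasurableSpace E] (μ : Measure E) [SigmaFinite μ]
    (J γ : E → E → ℝ≥0)
    (hJmeas : Measurable (Function.uncurry J)) (hJsymm : ∀ x y, J x y = J y x)
    (hγmeas : Measurable (Function.uncurry γ)) (hγsymm : ∀ x y, γ x y = γ y x)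
    (hγpos : ∀ x y, x ≠ y → 0 < γ x y)
    (β₁ : ℝ → ℝ) (hβpos : ∀ r : ℝ, 0 < r → 0 < β₁ r)
    (hβdec : AntitoneOn β₁ (Ioi 0))
    (hβ0 : Tendsto β₁ atTop (nhds 0))
    (hPoin : ∀ r : ℝ, 0 < r →
      ∀ f : E → ℝ, Measurable f → (∫⁻ x, (‖f x‖₊ : ℝ≥0∞) ^ 2 ∂μ) < ∞ →
        ∫⁻ x, (‖f x‖₊ : ℝ≥0∞) ^ 2 ∂μ ≤
          ENNReal.ofReal r *
            (∫⁻ x, (∫⁻ y, (‖f x ^ 2 - f y ^ 2‖₊ : ℝ≥0∞) * (γ x y : ℝ≥0∞) *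
              (J x y : ℝ≥0∞) ∂μ) ∂μ)
          + ENNReal.ofReal (β₁ r) * (∫⁻ x, (‖f x‖₊ : ℝ≥0∞) ∂μ) ^ 2)
    (hcγ : essSup (fun x => ∫⁻ y, (γ x y : ℝ≥0∞) ^ 2 * (J x y : ℝ≥0∞) ∂μ) μ < ∞) :
    ∀ r : ℝ, 0 < r →
      ∀ f : E → ℝ, Measurable f → (∫⁻ x, (‖f x‖₊ : ℝ≥0∞) ^ 2 ∂μ) < ∞ →
        (2⁻¹ * ∫⁻ x, (∫⁻ y, (‖f x - f y‖₊ : ℝ≥0∞) ^ 2 * (J x y : ℝ≥0∞) ∂μ) ∂μ) < ∞ →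
        ∫⁻ x, (‖f x‖₊ : ℝ≥0∞) ^ 2 ∂μ ≤
          ENNReal.ofReal r *
            (2⁻¹ * ∫⁻ x, (∫⁻ y, (‖f x - f y‖₊ : ℝ≥0∞) ^ 2 * (J x y : ℝ≥0∞) ∂μ) ∂μ)
          + 2 * ENNReal.ofReal (β₁ (Real.sqrt r /
              (2 * Real.sqrt (2 * (essSup (fun x => ∫⁻ y, (γ x y : ℝ≥0∞) ^ 2 *
                (J x y : ℝ≥0∞) ∂μ) μ).toReal)))) *
            (∫⁻ x, (‖f x‖₊ : ℝ≥0∞) ∂μ) ^ 2 := by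
  intro r hr f hf hf2 hfE
  set G : E → ℝ≥0∞ := fun x => ∫⁻ y, (γ x y : ℝ≥0∞) ^ 2 * (J x y : ℝ≥0∞) ∂μ with hG
  set C := essSup G μ with hC
  have hGle : ∀ᵐ x ∂μ, G x ≤ C := ae_le_essSup
  have hJ2 : Measurable fun p : E × E => (J p.1 p.2 : ℝ≥0∞) := hJmeas.coe_nnreal_ennreal
  have hγ2 : Measurable fun p : E × E => (γ p.1 p.2 : ℝ≥0∞) := hγmeas.coe_nnreal_ennreal
  have hJ1 : ∀ x, Measurable fun y => (J x y : ℝ≥0∞) := fun x => hJ2.comp measurable_prodMk_left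
  have hγ1 : ∀ x, Measurable fun y => (γ x y : ℝ≥0∞) := fun x => hγ2.comp measurable_prodMk_left
  have hfn : Measurable fun x => (‖f x‖₊ : ℝ≥0∞) := hf.nnnorm.coe_nnreal_ennreal
  rcases eq_or_ne C 0 with hC0 | hC0
  · -- degenerate case: the measure vanishes
    have hz : ∀ᵐ x ∂μ, ∀ᵐ y ∂μ, (γ x y : ℝ≥0∞) * (J x y : ℝ≥0∞) = 0 := by
      filter_upwards [hGle] with x hx
      rw [hC0] at hx
      have h0 : G x = 0 := le_antisymm hx bot_le
      rw [hG] at h0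
      have := (lintegral_eq_zero_iff (((hγ1 x).pow_const 2).mul (hJ1 x))).1 h0
      filter_upwards [this] with y hy
      simpa using hy
    have hA : ∀ A : Set E, MeasurableSet A → μ A < ∞ → μ A = 0 := by
      intro A hAm hAf
      have hi : ∀ x, (‖A.indicator (fun _ => (1 : ℝ)) x‖₊ : ℝ≥0∞) = A.indicator 1 x := by
        intro x
        by_cases hx : x ∈ A <;> simp [hx]
      have hi2 : ∀ x, (‖A.indicator (fun _ => (1 : ℝ)) x‖₊ : ℝ≥0∞) ^ 2 = A.indicator 1 x := by
        intro x
        by_cases hx : x ∈ A <;> simp [hx]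
      have hb : ∀ t : ℝ, 0 < t → μ A ≤ ENNReal.ofReal (β₁ t) * μ A ^ 2 := by
        intro t ht
        have h := hPoin t ht (A.indicator fun _ => (1 : ℝ)) (measurable_const.indicator hAm)
          (by simp only [hi2]; rw [lintegral_indicator_one hAm]; exact hAf)
        have h0 : ∫⁻ x, (∫⁻ y, (‖A.indicator (fun _ => (1 : ℝ)) x ^ 2 -
            A.indicator (fun _ => (1 : ℝ)) y ^ 2‖₊ : ℝ≥0∞) * (γ x y : ℝ≥0∞) *
              (J x y : ℝ≥0∞) ∂μ) ∂μ = 0 := by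
          rw [← lintegral_zero (μ := μ)]
          apply lintegral_congr_ae
          filter_upwards [hz] with x hx
          rw [← lintegral_zero (μ := μ)]
          apply lintegral_congr_ae
          filter_upwards [hx] with y hy
          rw [mul_assoc, hy, mul_zero]
        rw [h0, mul_zero, zero_add] at h
        simp only [hi2] at h
        simp only [hi] at h
        rwa [lintegral_indicator_one hAm] at h
      have ht : Tendsto (fun t => ENNReal.ofReal (β₁ t) * μ A ^ 2) atTop (nhds 0) := by
        have h1 : Tendsto (fun t => ENNReal.ofReal (β₁ t)) atTop (nhds 0) := by
          simpa using ENNReal.tendsto_ofReal hβ0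
        have := ENNReal.Tendsto.mul_const (b := μ A ^ 2) h1
          (Or.inr (ENNReal.pow_ne_top hAf.ne))
        simpa using this
      refine le_antisymm (ge_of_tendsto ht ?_) bot_le
      filter_upwards [eventually_gt_atTop 0] with t h using hb t h
    have hμ : μ = 0 := by
      rw [← Measure.measure_univ_eq_zero, ← iUnion_spanningSets μ, measure_iUnion_null_iff]
      exact fun n => hA _ (measurableSet_spanningSets μ n) (measure_spanningSets_lt_top μ n)
    have : ∫⁻ x, (‖f x‖₊ : ℝ≥0∞) ^ 2 ∂μ = 0 := by rw [hμ]; simp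
    rw [this]
    exact bot_le
  have hc : 0 < C.toReal := ENNReal.toReal_pos hC0 hcγ.ne
  set c := C.toReal with hcdef
  have hCc : C = ENNReal.ofReal c := (ENNReal.ofReal_toReal hcγ.ne).symm
  set s := Real.sqrt r / (2 * Real.sqrt (2 * c)) with hs
  have hs0 : 0 < s := by positivity
  have h := hPoin s hs0 f hf hf2
  set A := ∫⁻ x, (‖f x‖₊ : ℝ≥0∞) ^ 2 ∂μ with hA
  set D := ∫⁻ x, (∫⁻ y, (‖f x - f y‖₊ : ℝ≥0∞) ^ 2 * (J x y : ℝ≥0∞) ∂μ) ∂μ with hD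
  set B := ENNReal.ofReal (β₁ s) with hB
  set L := ∫⁻ x, (‖f x‖₊ : ℝ≥0∞) ∂μ with hL
  have hI1 : ∫⁻ x, (∫⁻ y, (‖f x‖₊ : ℝ≥0∞) ^ 2 * ((γ x y : ℝ≥0∞) ^ 2 * (J x y : ℝ≥0∞)) ∂μ) ∂μ
      ≤ A * C := by
    rw [hA, ← lintegral_mul_const _ (hfn.pow_const 2)]
    apply lintegral_mono_ae
    filter_upwards [hGle] with x hx
    rw [lintegral_const_mul' _ _ (ENNReal.pow_ne_top ENNReal.coe_ne_top)]
    gcongr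
  have hf1 : Measurable fun p : E × E => (‖f p.1‖₊ : ℝ≥0∞) := hfn.comp measurable_fst
  have hf2' : Measurable fun p : E × E => (‖f p.2‖₊ : ℝ≥0∞) := hfn.comp measurable_snd
  have hm1 : Measurable fun p : E × E =>
      (‖f p.1‖₊ : ℝ≥0∞) ^ 2 * ((γ p.1 p.2 : ℝ≥0∞) ^ 2 * (J p.1 p.2 : ℝ≥0∞)) :=
    (hf1.pow_const 2).mul ((hγ2.pow_const 2).mul hJ2)
  have hm2 : Measurable fun p : E × E =>
      (‖f p.2‖₊ : ℝ≥0∞) ^ 2 * ((γ p.1 p.2 : ℝ≥0∞) ^ 2 * (J p.1 p.2 : ℝ≥0∞)) :=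
    (hf2'.pow_const 2).mul ((hγ2.pow_const 2).mul hJ2)
  have hdm : Measurable fun p : E × E => (‖f p.1 - f p.2‖₊ : ℝ≥0∞) ^ 2 * (J p.1 p.2 : ℝ≥0∞) :=
    ((((hf.comp measurable_fst).sub (hf.comp measurable_snd)).nnnorm.coe_nnreal_ennreal).pow_const
      2).mul hJ2
  have hI2 : ∫⁻ x, (∫⁻ y, (‖f y‖₊ : ℝ≥0∞) ^ 2 * ((γ x y : ℝ≥0∞) ^ 2 * (J x y : ℝ≥0∞)) ∂μ) ∂μ
      ≤ A * C := by
    rw [lintegral_lintegral_swap hm2.aemeasurable]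
    refine le_trans (le_of_eq ?_) hI1
    refine lintegral_congr fun x => lintegral_congr fun y => ?_
    rw [hγsymm, hJsymm]
  have hγm : Measurable fun p : E × E => (‖f p.1 ^ 2 - f p.2 ^ 2‖₊ : ℝ≥0∞) *
      (γ p.1 p.2 : ℝ≥0∞) * (J p.1 p.2 : ℝ≥0∞) :=
    (((((hf.comp measurable_fst).pow_const 2).sub
      ((hf.comp measurable_snd).pow_const 2)).nnnorm.coe_nnreal_ennreal).mul hγ2).mul hJ2
  have hmain : ENNReal.ofReal s *
      (∫⁻ x, (∫⁻ y, (‖f x ^ 2 - f y ^ 2‖₊ : ℝ≥0∞) * (γ x y : ℝ≥0∞) *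
        (J x y : ℝ≥0∞) ∂μ) ∂μ) ≤
      ENNReal.ofReal (r / 4) * D + ENNReal.ofReal (1 / (4 * c)) * (A * C + A * C) := by
    have hp : ∀ F : E × E → ℝ≥0∞, Measurable F →
        ∫⁻ x, (∫⁻ y, F (x, y) ∂μ) ∂μ = ∫⁻ p, F p ∂(μ.prod μ) := fun F hF =>
      (lintegral_prod _ hF.aemeasurable).symm
    have e1 := hp _ hm1
    have e2 := hp _ hm2
    have e3 := hp _ hdm
    have e4 := hp _ hγm
    simp only at e1 e2 e3 e4
    rw [e1] at hI1
    rw [e2] at hI2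
    rw [hD, e3, e4, ← lintegral_const_mul _ hγm]
    calc _ ≤ ∫⁻ p : E × E, (ENNReal.ofReal (r / 4) *
          ((‖f p.1 - f p.2‖₊ : ℝ≥0∞) ^ 2 * (J p.1 p.2 : ℝ≥0∞)) +
          ENNReal.ofReal (1 / (4 * c)) *
        ((‖f p.1‖₊ : ℝ≥0∞) ^ 2 * ((γ p.1 p.2 : ℝ≥0∞) ^ 2 * (J p.1 p.2 : ℝ≥0∞)) +
          (‖f p.2‖₊ : ℝ≥0∞) ^ 2 * ((γ p.1 p.2 : ℝ≥0∞) ^ 2 * (J p.1 p.2 : ℝ≥0∞)))) ∂(μ.prod μ) :=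
          lintegral_mono fun p => pointwise_aux r c hr hc _ _ _ _
      _ ≤ _ := by
        rw [lintegral_add_left (hdm.const_mul _), lintegral_const_mul _ hdm,
          lintegral_const_mul' _ _ ENNReal.ofReal_ne_top, lintegral_add_left hm1]
        gcongr
  have hk : ENNReal.ofReal (1 / (4 * c)) * (A * C + A * C) = A / 2 := by
    have : ENNReal.ofReal (1 / (4 * c)) * (2 * C) = 2⁻¹ := by
      have e2 : (2 : ℝ≥0∞) = ENNReal.ofReal 2 := by simp
      rw [hCc, e2, ← ENNReal.ofReal_mul (by norm_num), ← ENNReal.ofReal_mul (by positivity),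
        ← ENNReal.ofReal_inv_of_pos (by norm_num)]
      congr 1
      field_simp
      norm_num
    calc _ = A * (ENNReal.ofReal (1 / (4 * c)) * (2 * C)) := by ring
      _ = A / 2 := by rw [this, div_eq_mul_inv]
  rw [hk] at hmain
  have h6 : A / 2 + A / 2 ≤ (ENNReal.ofReal (r / 4) * D + B * L ^ 2) + A / 2 := by
    rw [ENNReal.add_halves]
    calc A ≤ _ := h
      _ ≤ ENNReal.ofReal (r / 4) * D + A / 2 + B * L ^ 2 := by gcongr
      _ = _ := by ring
  have h7 : A / 2 ≤ ENNReal.ofReal (r / 4) * D + B * L ^ 2 :=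
    (ENNReal.add_le_add_iff_right (ENNReal.div_lt_top hf2.ne (by norm_num)).ne).1 h6
  have h8 : 2 * ENNReal.ofReal (r / 4) = ENNReal.ofReal r * 2⁻¹ := by
    have e2 : (2 : ℝ≥0∞) = ENNReal.ofReal 2 := by simp
    rw [e2, ← ENNReal.ofReal_inv_of_pos (by norm_num), ← ENNReal.ofReal_mul (by norm_num),
      ← ENNReal.ofReal_mul hr.le]
    congr 1
    ring
  calc A = A / 2 + A / 2 := (ENNReal.add_halves A).symm
    _ ≤ (ENNReal.ofReal (r / 4) * D + B * L ^ 2) + (ENNReal.ofReal (r / 4) * D + B * L ^ 2) := by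
        gcongr
    _ = (2 * ENNReal.ofReal (r / 4)) * D + 2 * B * L ^ 2 := by ring
    _ = _ := by rw [h8, mul_assoc]
end
end

section
/- Let p₁, p₂ > 1. There exists a constant C > 0 such that the Orlicz–Sobolev type isoperimetric inequality ‖f‖_N ≤ C ∫_{E×E} |f(x) − f(y)| J_γ(dx,dy) holds for all f ∈ L_N(μ) with N(s) := s^{p₁} ∧ s^{p₂}, if and only if there exists a constant c > 0 such that the Poincaré type isoperimetric inequality ‖f‖₂² ≤ r ∫_{E×E} |f²(x) − f²(y)| J_γ(dx,dy) + β₁(r) ‖f‖₁² holds for all r > 0 and f ∈ L²(μ) with β₁(r) := c ( r^{−p₁/(p₁−1)} ∨ r^{−p₂/(p₂−1)} ). -/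
open MeasureTheory ENNReal NNReal Filter Set

noncomputable section

lemma aux_young_one (p s l u : ℝ) (hp : 1 < p) (hs : 0 < s) (hl : s ^ (-(1 / p)) ≤ l) (hu : 0 ≤ u) :
    u ≤ l + l * s * u ^ p := by
  have hsp : 0 < s ^ (-(1 / p)) := Real.rpow_pos_of_pos hs _
  have hl0 : 0 < l := lt_of_lt_of_le hsp hl
  rcases le_total u l with h | h
  · have : 0 ≤ l * s * u ^ p := by positivity
    linarith
  · have hu0 : 0 < u := lt_of_lt_of_le hl0 h
    have h1 : l ^ (p - 1) ≤ u ^ (p - 1) := Real.rpow_le_rpow hl0.le h (by linarith)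
    have h2 : s⁻¹ ≤ l ^ p := by
      have := Real.rpow_le_rpow hsp.le hl (by linarith : 0 ≤ p)
      rw [← Real.rpow_mul hs.le] at this
      have e : -(1 / p) * p = -1 := by field_simp
      rw [e, Real.rpow_neg_one] at this
      exact this
    have e1 : l ^ p = l * l ^ (p - 1) := by
      rw [Real.rpow_sub hl0, Real.rpow_one]; field_simp
    have e2 : u ^ p = u * u ^ (p - 1) := by
      rw [Real.rpow_sub hu0, Real.rpow_one]; field_simp
    have h3 : 1 ≤ s * (l * u ^ (p - 1)) := by
      calc 1 = s * s⁻¹ := by field_simp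
        _ ≤ s * (l * u ^ (p - 1)) := by
          gcongr
          rw [e1] at h2
          exact h2.trans (by gcongr)
    have : u * 1 ≤ u * (s * (l * u ^ (p - 1))) := by gcongr
    rw [e2]
    nlinarith

lemma aux_young (p₁ p₂ s l : ℝ) (hp₁ : 1 < p₁) (hp₂ : 1 < p₂) (hs : 0 < s)
    (h1 : s ^ (-(1 / p₁)) ≤ l) (h2 : s ^ (-(1 / p₂)) ≤ l) (u : ℝ≥0) :
    (u : ℝ≥0∞) ≤ ENNReal.ofReal l + ENNReal.ofReal (l * s) *
      min ((u : ℝ≥0∞) ^ p₁) ((u : ℝ≥0∞) ^ p₂) := by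
  have hl0 : 0 < l := lt_of_lt_of_le (Real.rpow_pos_of_pos hs _) h1
  have key : ∀ p : ℝ, 1 < p → s ^ (-(1 / p)) ≤ l →
      (u : ℝ≥0∞) ≤ ENNReal.ofReal l + ENNReal.ofReal (l * s) * (u : ℝ≥0∞) ^ p := by
    intro p hp h
    have := aux_young_one p s l u hp hs h u.2
    have e : (u : ℝ≥0∞) = ENNReal.ofReal (u : ℝ) := by simp
    rw [e, ENNReal.ofReal_rpow_of_nonneg u.coe_nonneg (by linarith), ← ENNReal.ofReal_mul (by positivity),
      ← ENNReal.ofReal_add hl0.le (by positivity)]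
    exact ENNReal.ofReal_le_ofReal this
  rcases min_choice ((u : ℝ≥0∞) ^ p₁) ((u : ℝ≥0∞) ^ p₂) with h | h <;> rw [h]
  · exact key _ hp₁ h1
  · exact key _ hp₂ h2

/-- Hölder type bound. -/
lemma aux_holder {E : Type*} [MeasurableSpace E] (μ : Measure E)
    (p₁ p₂ s l : ℝ) (hp₁ : 1 < p₁) (hp₂ : 1 < p₂) (hs : 0 < s)
    (h1 : s ^ (-(1 / p₁)) ≤ l) (h2 : s ^ (-(1 / p₂)) ≤ l) (h : E → ℝ)
    (A : Set E) (hA : MeasurableSet A) (hAs : μ A ≤ ENNReal.ofReal s)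
    (hsupp : ∀ x, x ∉ A → h x = 0) :
    ∫⁻ x, (‖h x‖₊ : ℝ≥0∞) ∂μ ≤ ENNReal.ofReal (2 * (l * s)) *
      orliczNorm μ (fun s : ℝ≥0 => min ((s : ℝ≥0∞) ^ p₁) ((s : ℝ≥0∞) ^ p₂)) h := by
  have hl0 : 0 < l := lt_of_lt_of_le (Real.rpow_pos_of_pos hs _) h1
  have hls : 0 < 2 * (l * s) := by positivity
  unfold orliczNorm
  rw [ENNReal.mul_iInf_of_ne (by simpa using mul_pos hl0 hs) ENNReal.ofReal_ne_top]
  refine le_iInf fun r => ?_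
  rw [ENNReal.mul_iInf_of_ne (by simpa using mul_pos hl0 hs) ENNReal.ofReal_ne_top]
  refine le_iInf fun hr => ?_
  obtain ⟨hr0, hr⟩ := hr
  have hb : ∀ x, (‖h x‖₊ : ℝ≥0∞) ≤ A.indicator (fun _ => (r : ℝ≥0∞) * ENNReal.ofReal l) x +
      (r : ℝ≥0∞) * ENNReal.ofReal (l * s) *
      min (((‖h x‖₊ / r : ℝ≥0) : ℝ≥0∞) ^ p₁) (((‖h x‖₊ / r : ℝ≥0) : ℝ≥0∞) ^ p₂) := by
    intro x
    by_cases hx : x ∈ A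
    · have := aux_young p₁ p₂ s l hp₁ hp₂ hs h1 h2 (‖h x‖₊ / r)
      have h3 : (‖h x‖₊ : ℝ≥0∞) = r * ((‖h x‖₊ / r : ℝ≥0) : ℝ≥0∞) := by
        rw [← ENNReal.coe_mul, mul_div_cancel₀ _ hr0.ne']
      rw [indicator_of_mem hx, mul_assoc, ← mul_add]
      conv_lhs => rw [h3]
      gcongr
    · simp [hsupp x hx]
  calc ∫⁻ x, (‖h x‖₊ : ℝ≥0∞) ∂μ ≤ _ := lintegral_mono hb
    _ = r * ENNReal.ofReal l * μ A + r * ENNReal.ofReal (l * s) * _ := by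
        rw [lintegral_add_left (measurable_const.indicator hA), lintegral_indicator_const hA,
          lintegral_const_mul' _ _ (ENNReal.mul_ne_top (by simp) (by simp))]
    _ ≤ r * ENNReal.ofReal l * ENNReal.ofReal s + r * ENNReal.ofReal (l * s) * 1 := by
        gcongr
    _ = ENNReal.ofReal (2 * (l * s)) * r := by
        rw [ENNReal.ofReal_mul (by norm_num : (0:ℝ) ≤ 2), ENNReal.ofReal_mul hl0.le]
        simp
        ring

lemma aux_isoper (p₁ p₂ c : ℝ) (hp₁ : 1 < p₁) (hp₂ : 1 < p₂) (hc : 0 < c) :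
    ∃ k : ℝ, 0 < k ∧ ∀ (m : ℝ≥0∞) (e : ℝ≥0∞), m < ∞ →
      (∀ r : ℝ, 0 < r → m ≤ ENNReal.ofReal r * e +
        ENNReal.ofReal (c * max (r ^ (-(p₁ / (p₁ - 1)))) (r ^ (-(p₂ / (p₂ - 1))))) * m ^ 2) →
      min (m ^ (1 / p₁)) (m ^ (1 / p₂)) ≤ ENNReal.ofReal k * e := by
  set K := max ((2 * c) ^ (1 - 1 / p₁)) ((2 * c) ^ (1 - 1 / p₂)) with hK
  have hK0 : 0 < K := lt_max_of_lt_left (Real.rpow_pos_of_pos (by positivity) _)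
  refine ⟨2 * K, by positivity, ?_⟩
  intro m e hm H
  rcases eq_or_ne e ∞ with rfl | he
  · rw [ENNReal.mul_top (by simpa using hK0)]; exact le_top
  lift m to ℝ≥0 using hm.ne
  lift e to ℝ≥0 using he
  rcases eq_or_ne m 0 with rfl | hm0
  · rw [ENNReal.coe_zero, ENNReal.zero_rpow_of_pos (by positivity)]; simp
  have hm0 : 0 < (m : ℝ) := by positivity
  set M : ℝ := (m : ℝ) with hM
  set b := 2 * c * M with hb
  have hb0 : 0 < b := by positivity
  set r := max (b ^ (1 - 1 / p₁)) (b ^ (1 - 1 / p₂)) with hr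
  have hr0 : 0 < r := lt_max_of_lt_left (Real.rpow_pos_of_pos (by positivity) _)
  have hri : ∀ p : ℝ, 1 < p → b ^ (1 - 1 / p) ≤ r → r ^ (-(p / (p - 1))) ≤ b⁻¹ := by
    intro p hp h
    have h1 : p - 1 ≠ 0 := by linarith
    have h2 : p ≠ 0 := by linarith
    have := Real.rpow_le_rpow_of_nonpos (Real.rpow_pos_of_pos hb0 _) h
      (by rw [neg_nonpos]; exact div_nonneg (by linarith) (by linarith) : -(p / (p - 1)) ≤ 0)
    rw [← Real.rpow_mul hb0.le] at this
    have e : (1 - 1 / p) * (-(p / (p - 1))) = -1 := by field_simp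
    rwa [e, Real.rpow_neg_one] at this
  have h1 := hri p₁ hp₁ (le_max_left _ _)
  have h2 := hri p₂ hp₂ (le_max_right _ _)
  have H1 := H r hr0
  have H2 : M ≤ r * e + c * max (r ^ (-(p₁ / (p₁ - 1)))) (r ^ (-(p₂ / (p₂ - 1)))) * M ^ 2 := by
    have hn : 0 ≤ max (r ^ (-(p₁ / (p₁ - 1)))) (r ^ (-(p₂ / (p₂ - 1)))) :=
      le_max_of_le_left (by positivity)
    rw [show (m : ℝ≥0∞) = ENNReal.ofReal M by simp [hM],
      show (e : ℝ≥0∞) = ENNReal.ofReal (e : ℝ) by simp, ← ENNReal.ofReal_pow hm0.le,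
      ← ENNReal.ofReal_mul hr0.le, ← ENNReal.ofReal_mul (by positivity),
      ← ENNReal.ofReal_add (by positivity) (by positivity)] at H1
    exact (ENNReal.ofReal_le_ofReal_iff (by positivity)).1 H1
  have H3 : M ≤ 2 * (r * e) := by
    have : c * max (r ^ (-(p₁ / (p₁ - 1)))) (r ^ (-(p₂ / (p₂ - 1)))) * M ^ 2 ≤ c * b⁻¹ * M ^ 2 := by
      gcongr
      exact max_le h1 h2
    have e2 : c * b⁻¹ * M ^ 2 = M / 2 := by rw [hb]; field_simp
    linarith
  have fin : ∀ p : ℝ, 1 < p → r = b ^ (1 - 1 / p) → (2 * c) ^ (1 - 1 / p) ≤ K →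
      (m : ℝ≥0∞) ^ (1 / p) ≤ ENNReal.ofReal (2 * K) * e := by
    intro p hp hrp hKp
    have h2 : 0 < p := by linarith
    have : M ^ (1 / p) ≤ 2 * K * e := by
      rw [hrp, hb, Real.mul_rpow (by positivity) hm0.le] at H3
      have e1 : M = M ^ (1 / p) * M ^ (1 - 1 / p) := by
        rw [← Real.rpow_add hm0]; simp
      have hpos : 0 < M ^ (1 - 1 / p) := Real.rpow_pos_of_pos hm0 _
      refine le_of_mul_le_mul_right ?_ hpos
      rw [← e1]
      calc M ≤ _ := H3
        _ ≤ 2 * (K * M ^ (1 - 1 / p) * e) := by gcongr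
        _ = _ := by ring
    rw [show (m : ℝ≥0∞) = ENNReal.ofReal M by simp [hM],
      show (e : ℝ≥0∞) = ENNReal.ofReal (e : ℝ) by simp,
      ENNReal.ofReal_rpow_of_nonneg hm0.le (by positivity), ← ENNReal.ofReal_mul (by positivity)]
    exact ENNReal.ofReal_le_ofReal this
  rcases max_choice (b ^ (1 - 1 / p₁)) (b ^ (1 - 1 / p₂)) with h | h
  · exact (min_le_left _ _).trans (fin p₁ hp₁ h (le_max_left _ _))
  · exact (min_le_right _ _).trans (fin p₂ hp₂ h (le_max_right _ _))

lemma aux_w_one (p : ℝ) (hp : 1 < p) (v : ℝ) (hv : 0 < v) (m : ℝ≥0∞) (hm : m < ∞)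
    (h : ENNReal.ofReal v * m ^ (1 / p) ≤ 1) :
    ENNReal.ofReal v ^ (p - 1) * m ≤ m ^ (1 / p) := by
  have hp0 : 0 < p := by linarith
  rcases eq_or_ne m 0 with rfl | hm0
  · simp
  have e1 : m = (m ^ (1 / p)) ^ (p - 1) * m ^ (1 / p) := by
    rw [← ENNReal.rpow_mul, ← ENNReal.rpow_add _ _ hm0 hm.ne]
    conv_lhs => rw [← ENNReal.rpow_one m]
    congr 1
    field_simp
    ring
  calc ENNReal.ofReal v ^ (p - 1) * m
      = (ENNReal.ofReal v * m ^ (1 / p)) ^ (p - 1) * m ^ (1 / p) := by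
        conv_lhs => rw [e1]
        rw [ENNReal.mul_rpow_of_nonneg _ _ (by linarith), mul_assoc]
    _ ≤ 1 ^ (p - 1) * m ^ (1 / p) := by
        gcongr
    _ = _ := by simp

lemma aux_w (p₁ p₂ : ℝ) (hp₁ : 1 < p₁) (hp₂ : 1 < p₂) (v : ℝ) (hv : 0 < v) (m : ℝ≥0∞) (hm : m < ∞)
    (h : ENNReal.ofReal v * min (m ^ (1 / p₁)) (m ^ (1 / p₂)) ≤ 1) :
    min (ENNReal.ofReal v ^ (p₁ - 1)) (ENNReal.ofReal v ^ (p₂ - 1)) * m ≤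
      min (m ^ (1 / p₁)) (m ^ (1 / p₂)) := by
  rcases min_choice (m ^ (1 / p₁)) (m ^ (1 / p₂)) with h' | h' <;> rw [h'] at h ⊢
  · refine le_trans ?_ (aux_w_one p₁ hp₁ v hv m hm h)
    gcongr; exact min_le_left _ _
  · refine le_trans ?_ (aux_w_one p₂ hp₂ v hv m hm h)
    gcongr; exact min_le_right _ _

/-- pointwise lower bound for the primitive of `w`. -/
lemma aux_prim (p₁ p₂ : ℝ) (hp₁ : 1 < p₁) (hp₂ : 1 < p₂) (D : ℝ) (hD : 0 < D) (a : ℝ) (ha : 0 ≤ a) :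
    min (ENNReal.ofReal (a / D) ^ p₁) (ENNReal.ofReal (a / D) ^ p₂) ≤
      ENNReal.ofReal (2 ^ p₁ + 2 ^ p₂) * (ENNReal.ofReal D⁻¹ * ∫⁻ t in Ioi (0 : ℝ),
        (min (ENNReal.ofReal (t / D) ^ (p₁ - 1)) (ENNReal.ofReal (t / D) ^ (p₂ - 1)) *
          if t < a then 1 else 0)) := by
  rcases ha.eq_or_lt with rfl | ha
  · simp [ENNReal.zero_rpow_of_pos (by linarith : 0 < p₁)]
  set v := a / 2 / D with hv
  have hv0 : 0 < v := by positivity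
  set w := min (ENNReal.ofReal v ^ (p₁ - 1)) (ENNReal.ofReal v ^ (p₂ - 1)) with hw
  have h1 : w * ENNReal.ofReal (a / 2) ≤ ∫⁻ t in Ioi (0 : ℝ),
        (min (ENNReal.ofReal (t / D) ^ (p₁ - 1)) (ENNReal.ofReal (t / D) ^ (p₂ - 1)) *
          if t < a then 1 else 0) := by
    calc w * ENNReal.ofReal (a / 2) = ∫⁻ t in Ioo (a / 2) a, w := by
          rw [setLIntegral_const, Real.volume_Ioo]; congr 2; ring
      _ ≤ ∫⁻ t in Ioo (a / 2) a, (min (ENNReal.ofReal (t / D) ^ (p₁ - 1))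
            (ENNReal.ofReal (t / D) ^ (p₂ - 1)) * if t < a then 1 else 0) := by
          refine setLIntegral_mono' measurableSet_Ioo fun t ht => ?_
          rw [if_pos ht.2, mul_one]
          have : ENNReal.ofReal v ≤ ENNReal.ofReal (t / D) := by
            apply ENNReal.ofReal_le_ofReal
            rw [hv]
            have := ht.1.le
            gcongr
          exact min_le_min (ENNReal.rpow_le_rpow this (by linarith))
            (ENNReal.rpow_le_rpow this (by linarith))
      _ ≤ _ := lintegral_mono_set fun t ht => lt_trans (by positivity) ht.1
  have h2 : ∀ p : ℝ, 1 < p → (2 : ℝ) ^ p ≤ 2 ^ p₁ + 2 ^ p₂ →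
      ENNReal.ofReal (a / D) ^ p ≤ ENNReal.ofReal (2 ^ p₁ + 2 ^ p₂) *
        (ENNReal.ofReal D⁻¹ * (ENNReal.ofReal v ^ (p - 1) * ENNReal.ofReal (a / 2))) := by
    intro p hp hK
    rw [ENNReal.ofReal_rpow_of_pos hv0, ENNReal.ofReal_rpow_of_pos (by positivity),
      ← ENNReal.ofReal_mul (by positivity), ← ENNReal.ofReal_mul (by positivity),
      ← ENNReal.ofReal_mul (by positivity)]
    apply ENNReal.ofReal_le_ofReal
    have e1 : a / D = 2 * v := by rw [hv]; field_simp
    have e2 : D⁻¹ * (v ^ (p - 1) * (a / 2)) = v ^ p := by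
      rw [Real.rpow_sub hv0, Real.rpow_one, hv]; field_simp
    rw [e2, e1, Real.mul_rpow (by norm_num) hv0.le]
    gcongr
  have q1 : 0 < (2 : ℝ) ^ p₁ := Real.rpow_pos_of_pos (by norm_num) _
  have q2 : 0 < (2 : ℝ) ^ p₂ := Real.rpow_pos_of_pos (by norm_num) _
  refine le_trans ?_ (mul_le_mul_right (mul_le_mul_right h1 _) _)
  rcases min_choice (ENNReal.ofReal v ^ (p₁ - 1)) (ENNReal.ofReal v ^ (p₂ - 1)) with h' | h' <;>
    rw [hw, h']
  · exact (min_le_left _ _).trans (h2 p₁ hp₁ (by linarith))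
  · exact (min_le_right _ _).trans (h2 p₂ hp₂ (by linarith))

/-- coarea inequality. -/
lemma aux_coarea {E : Type*} [MeasurableSpace E] (μ : Measure E) [SigmaFinite μ]
    (J γ : E → E → ℝ≥0)
    (hJmeas : Measurable (Function.uncurry J)) (hγmeas : Measurable (Function.uncurry γ))
    (g : E → ℝ) (hg : Measurable g) :
    ∫⁻ t in Ioi (0 : ℝ), (∫⁻ x, (∫⁻ y, (‖(if t < g x then (1 : ℝ) else 0) -
        (if t < g y then (1 : ℝ) else 0)‖₊ : ℝ≥0∞) * (γ x y : ℝ≥0∞) * (J x y : ℝ≥0∞) ∂μ) ∂μ) ≤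
      ∫⁻ x, (∫⁻ y, (‖g x - g y‖₊ : ℝ≥0∞) * (γ x y : ℝ≥0∞) * (J x y : ℝ≥0∞) ∂μ) ∂μ := by
  have hm : Measurable fun z : (ℝ × E) × E =>
      (‖(if z.1.1 < g z.1.2 then (1 : ℝ) else 0) -
        (if z.1.1 < g z.2 then (1 : ℝ) else 0)‖₊ : ℝ≥0∞) * (γ z.1.2 z.2 : ℝ≥0∞) *
        (J z.1.2 z.2 : ℝ≥0∞) := by
    have a1 : Measurable fun z : (ℝ × E) × E => γ z.1.2 z.2 :=
      hγmeas.comp (by fun_prop : Measurable fun z : (ℝ × E) × E => (z.1.2, z.2))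
    have a2 : Measurable fun z : (ℝ × E) × E => J z.1.2 z.2 :=
      hJmeas.comp (by fun_prop : Measurable fun z : (ℝ × E) × E => (z.1.2, z.2))
    have a3 : Measurable fun z : (ℝ × E) × E => (if z.1.1 < g z.1.2 then (1 : ℝ) else 0) :=
      Measurable.ite (measurableSet_lt (by fun_prop) (by fun_prop)) measurable_const measurable_const
    have a4 : Measurable fun z : (ℝ × E) × E => (if z.1.1 < g z.2 then (1 : ℝ) else 0) :=
      Measurable.ite (measurableSet_lt (by fun_prop) (by fun_prop)) measurable_const measurable_const
    fun_prop
  rw [lintegral_lintegral_swap (hm.lintegral_prod_right').aemeasurable]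
  refine lintegral_mono fun x => ?_
  rw [lintegral_lintegral_swap]
  swap
  · exact (hm.comp (by fun_prop : Measurable fun z : ℝ × E => ((z.1, x), z.2))).aemeasurable
  refine lintegral_mono fun y => ?_
  simp only [mul_assoc]
  rw [lintegral_mul_const' _ _ (ENNReal.mul_ne_top (by simp) (by simp))]
  gcongr
  refine (setLIntegral_le_lintegral _ _).trans ?_
  have : ∀ t : ℝ, (‖(if t < g x then (1 : ℝ) else 0) - (if t < g y then (1 : ℝ) else 0)‖₊ : ℝ≥0∞)
      ≤ (Ico (min (g x) (g y)) (max (g x) (g y))).indicator (fun _ => 1) t := by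
    intro t
    by_cases h1 : t < g x <;> by_cases h2 : t < g y
    · simp [h1, h2]
    · rw [indicator_of_mem (by simp [h1, not_lt.1 h2])]; simp [h1, h2]
    · rw [indicator_of_mem (by simp [h2, not_lt.1 h1])]; simp [h1, h2]
    · simp [h1, h2]
  refine (lintegral_mono this).trans ?_
  rw [lintegral_indicator_const measurableSet_Ico, Real.volume_Ico, one_mul, max_sub_min_eq_abs,
    abs_sub_comm, ← Real.norm_eq_abs, ofReal_norm]
  rfl

lemma aux_fin {E : Type*} [MeasurableSpace E] (μ : Measure E)
    (p₁ p₂ s n : ℝ) (hp₁ : 1 < p₁) (hs : 0 < s) (hn : 0 ≤ n) (h : E → ℝ)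
    (A : Set E) (hA : MeasurableSet A) (hAs : μ A ≤ ENNReal.ofReal s)
    (hsupp : ∀ x, x ∉ A → h x = 0) (hb : ∀ x, |h x| ≤ n) :
    orliczNorm μ (fun s : ℝ≥0 => min ((s : ℝ≥0∞) ^ p₁) ((s : ℝ≥0∞) ^ p₂)) h < ∞ := by
  unfold orliczNorm
  set ρ : ℝ≥0 := ⟨(n + 1) * (s + 1), by positivity⟩ with hρ
  have hρ0 : 0 < ρ := by
    rw [← NNReal.coe_pos]; change 0 < (n + 1) * (s + 1); positivity
  refine lt_of_le_of_lt (iInf₂_le ρ ⟨hρ0, ?_⟩) ENNReal.coe_lt_top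
  have key : ∀ x, min (((‖h x‖₊ / ρ : ℝ≥0) : ℝ≥0∞) ^ p₁) (((‖h x‖₊ / ρ : ℝ≥0) : ℝ≥0∞) ^ p₂) ≤
      A.indicator (fun _ => ENNReal.ofReal (1 / (s + 1))) x := by
    intro x
    refine (min_le_left _ _).trans ?_
    by_cases hx : x ∈ A
    · rw [indicator_of_mem hx]
      have h1 : ‖h x‖₊ / ρ ≤ (1 / (s + 1)).toNNReal := by
        rw [← NNReal.coe_le_coe, NNReal.coe_div, Real.coe_toNNReal _ (by positivity), coe_nnnorm,
          Real.norm_eq_abs]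
        change |h x| / ((n + 1) * (s + 1)) ≤ _
        rw [div_le_div_iff₀ (by positivity) (by positivity)]
        have := hb x
        nlinarith
      have h2 : ((‖h x‖₊ / ρ : ℝ≥0) : ℝ≥0∞) ≤ ENNReal.ofReal (1 / (s + 1)) := by
        exact ENNReal.coe_le_coe.2 h1
      have h3 : ENNReal.ofReal (1 / (s + 1)) ≤ 1 := by
        rw [ENNReal.ofReal_le_one, div_le_one (by positivity)]; linarith
      calc _ ≤ ((‖h x‖₊ / ρ : ℝ≥0) : ℝ≥0∞) ^ (1 : ℝ) :=
            ENNReal.rpow_le_rpow_of_exponent_ge (h2.trans h3) hp₁.le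
        _ ≤ _ := by rw [ENNReal.rpow_one]; exact h2
    · simp [hsupp x hx, hx, ENNReal.zero_rpow_of_pos (by linarith : 0 < p₁)]
  refine (lintegral_mono key).trans ?_
  rw [lintegral_indicator_const hA]
  calc _ ≤ ENNReal.ofReal (1 / (s + 1)) * ENNReal.ofReal s := by gcongr
    _ ≤ 1 := by
      rw [← ENNReal.ofReal_mul (by positivity), ENNReal.ofReal_le_one, div_mul_eq_mul_div,
        div_le_one (by positivity)]
      linarith

lemma aux_orlicz_le {E : Type*} [MeasurableSpace E] (μ : Measure E) [SigmaFinite μ]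
    (p₁ p₂ : ℝ) (hp₁ : 1 < p₁) (hp₂ : 1 < p₂) (f : E → ℝ) (hf : Measurable f) (D : ℝ) (hD : 0 < D)
    (hm : ∀ t : ℝ, 0 < t → μ {x | t < |f x|} < ∞)
    (h : ∫⁻ t in Ioi (0 : ℝ), min (μ {x | t < |f x|} ^ (1 / p₁)) (μ {x | t < |f x|} ^ (1 / p₂)) ≤
      ENNReal.ofReal D) :
    orliczNorm μ (fun s : ℝ≥0 => min ((s : ℝ≥0∞) ^ p₁) ((s : ℝ≥0∞) ^ p₂)) f ≤
      ENNReal.ofReal ((2 ^ p₁ + 2 ^ p₂) * D) := by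
  have q1 : 1 < (2 : ℝ) ^ p₁ := Real.one_lt_rpow (by norm_num) (by linarith)
  have q2 : 0 < (2 : ℝ) ^ p₂ := Real.rpow_pos_of_pos (by norm_num) _
  have hw : ∀ t : ℝ, 0 < t →
      min (ENNReal.ofReal (t / D) ^ (p₁ - 1)) (ENNReal.ofReal (t / D) ^ (p₂ - 1)) *
        μ {x | t < |f x|} ≤
      min (μ {x | t < |f x|} ^ (1 / p₁)) (μ {x | t < |f x|} ^ (1 / p₂)) := by
    intro t ht
    refine aux_w p₁ p₂ hp₁ hp₂ (t / D) (by positivity) _ (hm t ht) ?_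
    have h1 : min (μ {x | t < |f x|} ^ (1 / p₁)) (μ {x | t < |f x|} ^ (1 / p₂)) * ENNReal.ofReal t
        ≤ ENNReal.ofReal D := by
      refine le_trans ?_ h
      calc _ = ∫⁻ τ in Ioc 0 t,
            min (μ {x | t < |f x|} ^ (1 / p₁)) (μ {x | t < |f x|} ^ (1 / p₂)) := by
            rw [setLIntegral_const, Real.volume_Ioc, sub_zero]
        _ ≤ ∫⁻ τ in Ioc 0 t,
            min (μ {x | τ < |f x|} ^ (1 / p₁)) (μ {x | τ < |f x|} ^ (1 / p₂)) := by
            refine setLIntegral_mono' measurableSet_Ioc fun τ hτ => ?_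
            have : μ {x | t < |f x|} ≤ μ {x | τ < |f x|} :=
              measure_mono fun x hx => lt_of_le_of_lt hτ.2 hx
            exact min_le_min (ENNReal.rpow_le_rpow this (by positivity))
              (ENNReal.rpow_le_rpow this (by positivity))
        _ ≤ _ := lintegral_mono_set fun τ hτ => hτ.1
    rw [div_eq_mul_inv, mul_comm t, ENNReal.ofReal_mul (by positivity), mul_assoc,
      mul_comm (ENNReal.ofReal t)]
    calc _ ≤ ENNReal.ofReal D⁻¹ * ENNReal.ofReal D := by gcongr
      _ = 1 := by
        rw [← ENNReal.ofReal_mul (by positivity), inv_mul_cancel₀ hD.ne', ENNReal.ofReal_one]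
  set K : ℝ := 2 ^ p₁ + 2 ^ p₂ with hK
  have hK1 : 1 < K := by linarith
  have main : ∫⁻ x, min (ENNReal.ofReal (|f x| / D) ^ p₁) (ENNReal.ofReal (|f x| / D) ^ p₂) ∂μ ≤
      ENNReal.ofReal K := by
    have hwm : Measurable fun t : ℝ =>
        min (ENNReal.ofReal (t / D) ^ (p₁ - 1)) (ENNReal.ofReal (t / D) ^ (p₂ - 1)) := by
      fun_prop
    calc _ ≤ ∫⁻ x, ENNReal.ofReal K * (ENNReal.ofReal D⁻¹ * ∫⁻ t in Ioi (0 : ℝ),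
        (min (ENNReal.ofReal (t / D) ^ (p₁ - 1)) (ENNReal.ofReal (t / D) ^ (p₂ - 1)) *
          if t < |f x| then 1 else 0)) ∂μ :=
          lintegral_mono fun x => aux_prim p₁ p₂ hp₁ hp₂ D hD _ (abs_nonneg _)
      _ = ENNReal.ofReal K * (ENNReal.ofReal D⁻¹ * ∫⁻ t in Ioi (0 : ℝ), ∫⁻ x,
        (min (ENNReal.ofReal (t / D) ^ (p₁ - 1)) (ENNReal.ofReal (t / D) ^ (p₂ - 1)) *
          if t < |f x| then 1 else 0) ∂μ) := by
          rw [lintegral_const_mul' _ _ ENNReal.ofReal_ne_top,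
            lintegral_const_mul' _ _ ENNReal.ofReal_ne_top, lintegral_lintegral_swap]
          refine Measurable.aemeasurable ?_
          refine Measurable.mul (hwm.comp measurable_snd) ?_
          exact Measurable.ite (measurableSet_lt (by fun_prop) (by fun_prop))
            measurable_const measurable_const
      _ ≤ ENNReal.ofReal K * (ENNReal.ofReal D⁻¹ * ENNReal.ofReal D) := by
          gcongr
          refine le_trans (setLIntegral_mono' measurableSet_Ioi fun t ht => ?_) h
          refine le_trans (le_of_eq ?_) (hw t ht)
          rw [lintegral_const_mul _ (Measurable.ite (measurableSet_lt (by fun_prop) (by fun_prop))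
            measurable_const measurable_const)]
          congr 1
          rw [← lintegral_indicator_one (measurableSet_lt (by fun_prop) (by fun_prop))]
          refine lintegral_congr fun x => ?_
          simp [indicator_apply]
      _ = _ := by
        rw [← ENNReal.ofReal_mul (by positivity), inv_mul_cancel₀ hD.ne', ENNReal.ofReal_one,
          mul_one]
  unfold orliczNorm
  have hKD : 0 < K * D := by positivity
  refine iInf₂_le_of_le (K * D).toNNReal ⟨by simpa using hKD, ?_⟩ le_rfl
  have key : ∀ x, min (((‖f x‖₊ / (K * D).toNNReal : ℝ≥0) : ℝ≥0∞) ^ p₁)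
        (((‖f x‖₊ / (K * D).toNNReal : ℝ≥0) : ℝ≥0∞) ^ p₂) ≤
      ENNReal.ofReal K⁻¹ *
        min (ENNReal.ofReal (|f x| / D) ^ p₁) (ENNReal.ofReal (|f x| / D) ^ p₂) := by
    intro x
    have e : ((‖f x‖₊ / (K * D).toNNReal : ℝ≥0) : ℝ≥0∞) =
        ENNReal.ofReal K⁻¹ * ENNReal.ofReal (|f x| / D) := by
      rw [← ENNReal.ofReal_mul (by positivity), ENNReal.ofReal, ENNReal.coe_inj, ← NNReal.coe_inj,
        NNReal.coe_div, Real.coe_toNNReal _ hKD.le, Real.coe_toNNReal _ (by positivity), coe_nnnorm,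
        Real.norm_eq_abs]
      field_simp
    have hk : ∀ p : ℝ, 1 < p → ((‖f x‖₊ / (K * D).toNNReal : ℝ≥0) : ℝ≥0∞) ^ p ≤
        ENNReal.ofReal K⁻¹ * ENNReal.ofReal (|f x| / D) ^ p := by
      intro p hp
      rw [e, ENNReal.mul_rpow_of_nonneg _ _ (by linarith)]
      gcongr
      conv_rhs => rw [← ENNReal.rpow_one (ENNReal.ofReal K⁻¹)]
      refine ENNReal.rpow_le_rpow_of_exponent_ge ?_ hp.le
      rw [ENNReal.ofReal_le_one]
      exact inv_le_one_of_one_le₀ hK1.le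
    rcases min_choice (ENNReal.ofReal (|f x| / D) ^ p₁) (ENNReal.ofReal (|f x| / D) ^ p₂)
      with h' | h' <;> rw [h']
    · exact (min_le_left _ _).trans (hk _ hp₁)
    · exact (min_le_right _ _).trans (hk _ hp₂)
  refine (lintegral_mono key).trans ?_
  rw [lintegral_const_mul' _ _ ENNReal.ofReal_ne_top]
  calc _ ≤ ENNReal.ofReal K⁻¹ * ENNReal.ofReal K := by gcongr
    _ = 1 := by
      rw [← ENNReal.ofReal_mul (by positivity), inv_mul_cancel₀ (by positivity), ENNReal.ofReal_one]

lemma aux_meas_fin {E : Type*} [MeasurableSpace E] (μ : Measure E)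
    (p₁ p₂ : ℝ) (hp₁ : 1 < p₁) (hp₂ : 1 < p₂) (f : E → ℝ) (hf : Measurable f)
    (hfin : orliczNorm μ (fun s : ℝ≥0 => min ((s : ℝ≥0∞) ^ p₁) ((s : ℝ≥0∞) ^ p₂)) f < ∞)
    (t : ℝ) (ht : 0 < t) : μ {x | t < |f x|} < ∞ := by
  unfold orliczNorm at hfin
  simp only [iInf_lt_iff] at hfin
  obtain ⟨r, ⟨hr0, hr⟩, -⟩ := hfin
  set T : ℝ≥0 := t.toNNReal / r with hT
  have hT0 : 0 < T := div_pos (by simpa using ht) hr0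
  have hmeas : Measurable fun x => min (((‖f x‖₊ / r : ℝ≥0) : ℝ≥0∞) ^ p₁)
      (((‖f x‖₊ / r : ℝ≥0) : ℝ≥0∞) ^ p₂) := by fun_prop
  have hM := mul_meas_ge_le_lintegral (μ := μ) hmeas (min ((T : ℝ≥0∞) ^ p₁) ((T : ℝ≥0∞) ^ p₂))
  have hpos : min ((T : ℝ≥0∞) ^ p₁) ((T : ℝ≥0∞) ^ p₂) ≠ 0 := by
    have h0 : (0 : ℝ≥0∞) < T := by exact_mod_cast hT0
    exact (lt_min (ENNReal.rpow_pos h0 (by simp)) (ENNReal.rpow_pos h0 (by simp))).ne'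
  have hlt := lt_of_le_of_lt (hM.trans hr) ENNReal.one_lt_top
  refine lt_of_le_of_lt (measure_mono ?_) (ENNReal.lt_top_of_mul_ne_top_right hlt.ne hpos)
  intro x hx
  have h1 : T ≤ ‖f x‖₊ / r := by
    rw [hT]
    gcongr
    rw [← NNReal.coe_le_coe, Real.coe_toNNReal _ ht.le, coe_nnnorm, Real.norm_eq_abs]
    exact le_of_lt hx
  have h2 : (T : ℝ≥0∞) ≤ ((‖f x‖₊ / r : ℝ≥0) : ℝ≥0∞) := by exact ENNReal.coe_le_coe.2 h1
  exact min_le_min (ENNReal.rpow_le_rpow h2 (by linarith)) (ENNReal.rpow_le_rpow h2 (by linarith))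

/-- for `p₁, p₂ > 1`, the Orlicz–Sobolev type isoperimetric
inequality with `N(s) = s^{p₁} ∧ s^{p₂}` holds for some constant `C > 0` iff
the Poincaré type isoperimetric inequality holds with
`β₁(r) = c (r^{-p₁/(p₁-1)} ∨ r^{-p₂/(p₂-1)})` for some constant `c > 0`. -/
theorem orliczSobolev_iff_poincare_type_power
    {E : Type*} [MeasurableSpace E] (μ : Measure E) [SigmaFinite μ]
    (J γ : E → E → ℝ≥0)
    (hJmeas : Measurable (Function.uncurry J)) (hJsymm : ∀ x y, J x y = J y x)
    (hγmeas : Measurable (Function.uncurry γ)) (hγsymm : ∀ x y, γ x y = γ y x)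
    (hγpos : ∀ x y, x ≠ y → 0 < γ x y)
    (p₁ p₂ : ℝ) (hp₁ : 1 < p₁) (hp₂ : 1 < p₂) :
    (∃ C : ℝ, 0 < C ∧
      ∀ f : E → ℝ, Measurable f →
        orliczNorm μ (fun s : ℝ≥0 =>
          min ((s : ℝ≥0∞) ^ p₁) ((s : ℝ≥0∞) ^ p₂)) f < ∞ →
        orliczNorm μ (fun s : ℝ≥0 =>
          min ((s : ℝ≥0∞) ^ p₁) ((s : ℝ≥0∞) ^ p₂)) f ≤
          ENNReal.ofReal C *
            ∫⁻ x, (∫⁻ y, (‖f x - f y‖₊ : ℝ≥0∞) * (γ x y : ℝ≥0∞) *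
              (J x y : ℝ≥0∞) ∂μ) ∂μ) ↔
    (∃ c : ℝ, 0 < c ∧
      ∀ r : ℝ, 0 < r →
        ∀ f : E → ℝ, Measurable f → (∫⁻ x, (‖f x‖₊ : ℝ≥0∞) ^ 2 ∂μ) < ∞ →
          ∫⁻ x, (‖f x‖₊ : ℝ≥0∞) ^ 2 ∂μ ≤
            ENNReal.ofReal r *
              (∫⁻ x, (∫⁻ y, (‖f x ^ 2 - f y ^ 2‖₊ : ℝ≥0∞) * (γ x y : ℝ≥0∞) *
                (J x y : ℝ≥0∞) ∂μ) ∂μ)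
            + ENNReal.ofReal (c * max (r ^ (-(p₁ / (p₁ - 1)))) (r ^ (-(p₂ / (p₂ - 1))))) *
              (∫⁻ x, (‖f x‖₊ : ℝ≥0∞) ∂μ) ^ 2) := by
  constructor
  · rintro ⟨C, hC, H⟩
    refine ⟨max ((2 * C) ^ (p₁ / (p₁ - 1))) ((2 * C) ^ (p₂ / (p₂ - 1))),
      lt_max_of_lt_left (by positivity), ?_⟩
    intro r hr f hf hf2
    set En := ∫⁻ x, (∫⁻ y, (‖f x ^ 2 - f y ^ 2‖₊ : ℝ≥0∞) * (γ x y : ℝ≥0∞) *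
                (J x y : ℝ≥0∞) ∂μ) ∂μ with hEn
    set c := max ((2 * C) ^ (p₁ / (p₁ - 1))) ((2 * C) ^ (p₂ / (p₂ - 1))) with hc
    set B := c * max (r ^ (-(p₁ / (p₁ - 1)))) (r ^ (-(p₂ / (p₂ - 1)))) with hB
    have hc0 : 0 < c := lt_max_of_lt_left (by positivity)
    have hB0 : 0 < B := mul_pos hc0 (lt_max_of_lt_left (by positivity))
    rcases eq_or_ne (∫⁻ x, (‖f x‖₊ : ℝ≥0∞) ∂μ) ∞ with hI | hI
    · rw [hI, ENNReal.top_pow (by norm_num), ENNReal.mul_top (by simpa using hB0)]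
      simp
    rcases eq_or_ne (∫⁻ x, (‖f x‖₊ : ℝ≥0∞) ∂μ) 0 with hI0 | hI0
    · rw [lintegral_eq_zero_iff (by fun_prop)] at hI0
      have : ∫⁻ x, (‖f x‖₊ : ℝ≥0∞) ^ 2 ∂μ = 0 := by
        rw [lintegral_eq_zero_iff (by fun_prop)]
        filter_upwards [hI0] with x hx
        have hx : (‖f x‖₊ : ℝ≥0∞) = 0 := hx
        simp [hx]
      rw [this]
      exact zero_le
    obtain ⟨i, hi⟩ : ∃ i : ℝ≥0, (i : ℝ≥0∞) = ∫⁻ x, (‖f x‖₊ : ℝ≥0∞) ∂μ :=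
      ⟨_, ENNReal.coe_toNNReal hI⟩
    have hi0 : 0 < (i : ℝ) := by
      rw [← hi] at hI0
      have : i ≠ 0 := by exact_mod_cast hI0
      positivity
    set b := r / (2 * C) with hb
    have hb0 : 0 < b := by positivity
    set s := min (b ^ (p₁ / (p₁ - 1))) (b ^ (p₂ / (p₂ - 1))) with hs
    have hs0 : 0 < s := lt_min (by positivity) (by positivity)
    set l := max (s ^ (-(1 / p₁))) (s ^ (-(1 / p₂))) with hl
    have hl0 : 0 < l := lt_max_of_lt_left (by positivity)
    -- the two choices of constants
    have hlsb : ∀ p : ℝ, 1 < p → s ≤ b ^ (p / (p - 1)) → s ^ (-(1 / p)) * s ≤ b := by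
      intro p hp h
      have h1 : p - 1 ≠ 0 := by linarith
      have h2 : p ≠ 0 := by linarith
      have h3 : 0 ≤ 1 - 1 / p := by
        rw [sub_nonneg, div_le_one (by linarith)]; linarith
      calc s ^ (-(1 / p)) * s = s ^ (1 - 1 / p) := by
            rw [sub_eq_neg_add, Real.rpow_add hs0, Real.rpow_one]
        _ ≤ (b ^ (p / (p - 1))) ^ (1 - 1 / p) := Real.rpow_le_rpow hs0.le h h3
        _ = b := by
            rw [← Real.rpow_mul hb0.le]
            have : p / (p - 1) * (1 - 1 / p) = 1 := by field_simp
            rw [this, Real.rpow_one]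
    have hls : l * s ≤ b := by
      rcases max_choice (s ^ (-(1 / p₁))) (s ^ (-(1 / p₂))) with h | h <;> rw [hl, h]
      · exact hlsb p₁ hp₁ (min_le_left _ _)
      · exact hlsb p₂ hp₂ (min_le_right _ _)
    have hsB1 : ∀ p : ℝ, (b ^ p)⁻¹ = (2 * C) ^ p * r ^ (-p) := by
      intro p
      rw [hb, Real.div_rpow hr.le (by positivity), Real.rpow_neg hr.le]
      field_simp
    have hsB : s⁻¹ ≤ B := by
      rcases min_choice (b ^ (p₁ / (p₁ - 1))) (b ^ (p₂ / (p₂ - 1))) with h | h <;>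
        rw [hs, h, hsB1, hB]
      · exact mul_le_mul (le_max_left _ _) (le_max_left _ _) (by positivity) hc0.le
      · exact mul_le_mul (le_max_right _ _) (le_max_right _ _) (by positivity) hc0.le
    set τ : ℝ := i / s with hτ
    have hτ0 : 0 < τ := by positivity
    set A : Set E := {x | τ ≤ |f x|} with hA
    have hAm : MeasurableSet A := measurableSet_le (by fun_prop) (by fun_prop)
    have hAs : μ A ≤ ENNReal.ofReal s := by
      have hM := mul_meas_ge_le_lintegral (μ := μ)
        (by fun_prop : Measurable fun x => (‖f x‖₊ : ℝ≥0∞)) (ENNReal.ofReal τ)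
      have hsub : A ⊆ {x | ENNReal.ofReal τ ≤ (‖f x‖₊ : ℝ≥0∞)} := by
        intro x hx
        change ENNReal.ofReal τ ≤ (‖f x‖₊ : ℝ≥0∞)
        rw [← enorm_eq_nnnorm, ← ofReal_norm, Real.norm_eq_abs]
        exact ENNReal.ofReal_le_ofReal hx
      have h1 : ENNReal.ofReal τ * μ A ≤ ENNReal.ofReal τ * ENNReal.ofReal s := by
        calc _ ≤ _ := mul_le_mul_right (measure_mono hsub) _
          _ ≤ _ := hM
          _ = _ := by
            rw [← hi, ← ENNReal.ofReal_mul hτ0.le, hτ, div_mul_cancel₀ _ hs0.ne']; simp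
      exact (ENNReal.mul_le_mul_iff_right (by simpa using hτ0) ENNReal.ofReal_ne_top).1 h1
    have hn : ∀ n : ℕ, ∫⁻ x, ENNReal.ofReal (min (f x ^ 2) n) ∂μ ≤ ENNReal.ofReal r * En +
        ENNReal.ofReal B * (∫⁻ x, (‖f x‖₊ : ℝ≥0∞) ∂μ) ^ 2 := by
      intro n
      set h : E → ℝ := fun x => max (min (f x ^ 2) n - τ ^ 2) 0 with hh
      have hhm : Measurable h := by fun_prop
      have hsupp : ∀ x, x ∉ A → h x = 0 := by
        intro x hx
        have hx : |f x| < τ := not_le.1 hx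
        have : f x ^ 2 ≤ τ ^ 2 := by
          rw [← sq_abs]; gcongr
        exact max_eq_right (by linarith [min_le_left (f x ^ 2) (n : ℝ)])
      have hbd : ∀ x, |h x| ≤ n := by
        intro x
        rw [abs_of_nonneg (le_max_right _ _)]
        exact max_le (by nlinarith [min_le_right (f x ^ 2) (n : ℝ)]) (by positivity)
      have hfin := aux_fin μ p₁ p₂ s n hp₁ hs0 (by positivity) h A hAm hAs hsupp hbd
      have hS := H h hhm hfin
      have hH := aux_holder μ p₁ p₂ s l hp₁ hp₂ hs0 (le_max_left _ _) (le_max_right _ _) h A hAm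
        hAs hsupp
      have hE : ∫⁻ x, (∫⁻ y, (‖h x - h y‖₊ : ℝ≥0∞) * (γ x y : ℝ≥0∞) *
                (J x y : ℝ≥0∞) ∂μ) ∂μ ≤ En := by
        refine lintegral_mono fun x => lintegral_mono fun y => ?_
        gcongr
        rw [← NNReal.coe_le_coe, coe_nnnorm, coe_nnnorm, Real.norm_eq_abs, Real.norm_eq_abs]
        calc |h x - h y| ≤ |(min (f x ^ 2) n - τ ^ 2) - (min (f y ^ 2) n - τ ^ 2)| :=
              abs_max_sub_max_le_abs _ _ _
          _ = |min (f x ^ 2) n - min (f y ^ 2) n| := by congr 1; ring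
          _ ≤ max |f x ^ 2 - f y ^ 2| |(n : ℝ) - n| := abs_min_sub_min_le_max _ _ _ _
          _ = _ := by simp
      have hpt : ∀ x, ENNReal.ofReal (min (f x ^ 2) n) ≤
          (‖h x‖₊ : ℝ≥0∞) + ENNReal.ofReal τ * (‖f x‖₊ : ℝ≥0∞) := by
        intro x
        rw [← enorm_eq_nnnorm, ← enorm_eq_nnnorm, ← ofReal_norm, ← ofReal_norm, Real.norm_eq_abs,
          Real.norm_eq_abs, ← ENNReal.ofReal_mul hτ0.le,
          ← ENNReal.ofReal_add (by positivity) (by positivity)]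
        apply ENNReal.ofReal_le_ofReal
        have a1 : h x ≤ |h x| := le_abs_self _
        have a2 : min (f x ^ 2) n - τ ^ 2 ≤ h x := le_max_left _ _
        rcases le_total τ |f x| with hx | hx
        · nlinarith
        · have a3 := min_le_left (f x ^ 2) (n : ℝ)
          have a4 : f x ^ 2 = |f x| * |f x| := by rw [← sq_abs]; ring
          nlinarith [abs_nonneg (f x), abs_nonneg (h x)]
      calc _ ≤ _ := lintegral_mono hpt
        _ = ∫⁻ x, (‖h x‖₊ : ℝ≥0∞) ∂μ + ENNReal.ofReal τ * ∫⁻ x, (‖f x‖₊ : ℝ≥0∞) ∂μ := by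
          rw [lintegral_add_left (by fun_prop), lintegral_const_mul' _ _ ENNReal.ofReal_ne_top]
        _ ≤ _ := by
          gcongr ?_ + ?_
          · calc _ ≤ _ := hH
              _ ≤ ENNReal.ofReal (2 * (l * s)) * (ENNReal.ofReal C * En) := by
                gcongr
                exact hS.trans (by gcongr)
              _ ≤ _ := by
                rw [← mul_assoc, ← ENNReal.ofReal_mul (by positivity)]
                gcongr
                calc 2 * (l * s) * C ≤ 2 * b * C := by gcongr
                  _ = r := by rw [hb]; field_simp
          · rw [← hi, show (i : ℝ≥0∞) = ENNReal.ofReal (i : ℝ) by simp,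
              ← ENNReal.ofReal_pow hi0.le, ← ENNReal.ofReal_mul hτ0.le,
              ← ENNReal.ofReal_mul hB0.le]
            apply ENNReal.ofReal_le_ofReal
            calc τ * i = s⁻¹ * (i : ℝ) ^ 2 := by rw [hτ]; field_simp
              _ ≤ _ := by gcongr
    calc ∫⁻ x, (‖f x‖₊ : ℝ≥0∞) ^ 2 ∂μ
        ≤ ∫⁻ x, ⨆ n : ℕ, ENNReal.ofReal (min (f x ^ 2) n) ∂μ := by
          refine lintegral_mono fun x => ?_
          obtain ⟨n, hn⟩ := exists_nat_ge (f x ^ 2)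
          refine le_trans (le_of_eq ?_) (le_iSup _ n)
          rw [min_eq_left hn, ← enorm_eq_nnnorm, ← ofReal_norm, Real.norm_eq_abs,
            ← ENNReal.ofReal_pow (abs_nonneg _), sq_abs]
      _ = ⨆ n : ℕ, ∫⁻ x, ENNReal.ofReal (min (f x ^ 2) n) ∂μ := by
          refine lintegral_iSup (fun n => by fun_prop) ?_
          intro n m hnm x
          refine ENNReal.ofReal_le_ofReal (min_le_min le_rfl ?_)
          exact_mod_cast hnm
      _ ≤ _ := iSup_le hn
  · rintro ⟨c, hc, H⟩
    obtain ⟨k, hk, hiso⟩ := aux_isoper p₁ p₂ c hp₁ hp₂ hc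
    have q1 : 0 < (2 : ℝ) ^ p₁ := Real.rpow_pos_of_pos (by norm_num) _
    have q2 : 0 < (2 : ℝ) ^ p₂ := Real.rpow_pos_of_pos (by norm_num) _
    set K : ℝ := 2 ^ p₁ + 2 ^ p₂ with hK
    have hK0 : 0 < K := by positivity
    refine ⟨K * k, by positivity, ?_⟩
    intro f hf hfin
    set En := ∫⁻ x, (∫⁻ y, (‖f x - f y‖₊ : ℝ≥0∞) * (γ x y : ℝ≥0∞) *
              (J x y : ℝ≥0∞) ∂μ) ∂μ with hEn
    rcases eq_or_ne En ∞ with hE | hE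
    · rw [hE, ENNReal.mul_top (by simpa using mul_pos hK0 hk)]; exact le_top
    have hm := aux_meas_fin μ p₁ p₂ hp₁ hp₂ f hf hfin
    have hset : ∀ t : ℝ, MeasurableSet {x | t < |f x|} := fun t =>
      measurableSet_lt (by fun_prop) (by fun_prop)
    have hpsi : ∫⁻ t in Ioi (0 : ℝ),
        min (μ {x | t < |f x|} ^ (1 / p₁)) (μ {x | t < |f x|} ^ (1 / p₂)) ≤
        ENNReal.ofReal k * En := by
      calc _ ≤ ∫⁻ t in Ioi (0 : ℝ), ENNReal.ofReal k *
            (∫⁻ x, (∫⁻ y, (‖(if t < |f x| then (1 : ℝ) else 0) -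
            (if t < |f y| then (1 : ℝ) else 0)‖₊ : ℝ≥0∞) * (γ x y : ℝ≥0∞) *
              (J x y : ℝ≥0∞) ∂μ) ∂μ) := by
            refine setLIntegral_mono' measurableSet_Ioi fun t ht => ?_
            refine hiso _ _ (hm t ht) fun r hr => ?_
            have hme : Measurable fun x => if t < |f x| then (1 : ℝ) else 0 :=
              Measurable.ite (hset t) measurable_const measurable_const
            have e1 : ∫⁻ x, (‖(if t < |f x| then (1 : ℝ) else 0)‖₊ : ℝ≥0∞) ∂μ =
                μ {x | t < |f x|} := by
              rw [← lintegral_indicator_one (hset t)]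
              refine lintegral_congr fun x => ?_
              by_cases hx : t < |f x| <;> simp [indicator_apply, hx]
            have e2 : ∫⁻ x, (‖(if t < |f x| then (1 : ℝ) else 0)‖₊ : ℝ≥0∞) ^ 2 ∂μ =
                μ {x | t < |f x|} := by
              rw [← e1]
              refine lintegral_congr fun x => ?_
              by_cases hx : t < |f x| <;> simp [hx]
            have e3 : ∀ x, (if t < |f x| then (1 : ℝ) else 0) ^ 2 =
                if t < |f x| then (1 : ℝ) else 0 := by
              intro x
              by_cases hx : t < |f x| <;> simp [hx]
            have := H r hr _ hme (by rw [e2]; exact hm t ht)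
            rw [e1, e2] at this
            simp only [e3] at this
            exact this
        _ = _ := lintegral_const_mul' _ _ ENNReal.ofReal_ne_top
        _ ≤ ENNReal.ofReal k * En := by
            gcongr
            refine (aux_coarea μ J γ hJmeas hγmeas (fun x => |f x|) (by fun_prop)).trans ?_
            refine lintegral_mono fun x => lintegral_mono fun y => ?_
            gcongr
            rw [← NNReal.coe_le_coe, coe_nnnorm, coe_nnnorm, Real.norm_eq_abs, Real.norm_eq_abs]
            exact abs_abs_sub_abs_le_abs_sub _ _
    refine ENNReal.le_of_forall_pos_le_add fun ε hε _ => ?_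
    have hε : 0 < (ε : ℝ) := hε
    have hEe : En = ENNReal.ofReal En.toReal := (ENNReal.ofReal_toReal hE).symm
    have hE0 : 0 ≤ En.toReal := ENNReal.toReal_nonneg
    have hD : 0 < k * En.toReal + ε / K := by positivity
    have := aux_orlicz_le μ p₁ p₂ hp₁ hp₂ f hf (k * En.toReal + ε / K) hD hm (by
      refine hpsi.trans ?_
      rw [hEe, ← ENNReal.ofReal_mul hk.le, ENNReal.toReal_ofReal hE0]
      apply ENNReal.ofReal_le_ofReal
      have : 0 < (ε : ℝ) / K := by positivity
      linarith)
    refine this.trans (le_of_eq ?_)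
    rw [hEe, show (ε : ℝ≥0∞) = ENNReal.ofReal (ε : ℝ) by simp, ← ENNReal.ofReal_mul (by positivity),
      ENNReal.toReal_ofReal hE0, ← ENNReal.ofReal_add (by positivity) hε.le]
    congr 1
    rw [← hK]
    field_simp
end
end

section
/- For any α ∈ (0,2) and any h ∈ 𝓗_α, there exists a constant C > 0 such that ‖f‖_{N_h} ≤ C ∫_{ℝⁿ×ℝⁿ} |f(x) − f(y)| · h(|x−y|) / |x−y|^{n+α} dx dy for all f ∈ L_{N_h}(ℝⁿ). -/
open MeasureTheory ENNReal NNReal Filter Set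

noncomputable section

/-- `Φ_h(s) = ∫₀ˢ dt ∫₀^{t^{-1/n}} r^{α-1}/h(r) dr`. -/
def PhiH (n : ℕ) (α : ℝ) (h : ℝ → ℝ) (s : ℝ) : ℝ≥0∞ :=
  ∫⁻ t in Ioo (0 : ℝ) s, ∫⁻ r in Ioo (0 : ℝ) (t ^ (-(1 / (n : ℝ)))),
    ENNReal.ofReal (r ^ (α - 1) / h r)

/-- `N_h = Φ_h⁻¹`. -/
def Nh (n : ℕ) (α : ℝ) (h : ℝ → ℝ) (s : ℝ≥0) : ℝ≥0∞ :=
  ⨅ (u : ℝ) (_ : 0 < u ∧ (s : ℝ≥0∞) ≤ PhiH n α h u), ENNReal.ofReal u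

/-- inner integral -/
def gH (n : ℕ) (α : ℝ) (h : ℝ → ℝ) (t : ℝ) : ℝ≥0∞ :=
  ∫⁻ r in Ioo (0 : ℝ) (t ^ (-(1 / (n : ℝ)))), ENNReal.ofReal (r ^ (α - 1) / h r)

lemma PhiH_eq (n : ℕ) (α : ℝ) (h : ℝ → ℝ) (s : ℝ) :
    PhiH n α h s = ∫⁻ t in Ioo (0 : ℝ) s, gH n α h t := rfl

lemma gH_anti (n : ℕ) (α : ℝ) (h : ℝ → ℝ) {s t : ℝ} (hs : 0 < s) (hst : s ≤ t) :
    gH n α h t ≤ gH n α h s := by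
  apply lintegral_mono_set
  apply Ioo_subset_Ioo_right
  apply Real.rpow_le_rpow_of_nonpos hs hst
  have : (0:ℝ) ≤ 1 / n := by positivity
  linarith

lemma PhiH_mono (n : ℕ) (α : ℝ) (h : ℝ → ℝ) {s t : ℝ} (hst : s ≤ t) :
    PhiH n α h s ≤ PhiH n α h t :=
  lintegral_mono_set (Ioo_subset_Ioo_right hst)

lemma mul_gH_le (n : ℕ) (α : ℝ) (h : ℝ → ℝ) (v : ℝ) :
    ENNReal.ofReal v * gH n α h v ≤ PhiH n α h v := by
  rw [PhiH_eq]
  calc ENNReal.ofReal v * gH n α h v = ∫⁻ t in Ioo (0 : ℝ) v, gH n α h v := by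
        rw [setLIntegral_const, Real.volume_Ioo, sub_zero, mul_comm]
    _ ≤ _ := setLIntegral_mono' measurableSet_Ioo
        (fun t ht => gH_anti n α h ht.1 ht.2.le)

lemma PhiH_le (n : ℕ) (α : ℝ) (h : ℝ → ℝ) {u v : ℝ} (hv : 0 < v) :
    PhiH n α h u ≤ PhiH n α h v + ENNReal.ofReal u * gH n α h v := by
  rw [PhiH_eq, PhiH_eq]
  have hsub : Ioo (0:ℝ) u ⊆ Ioo 0 v ∪ Ico v u := by
    intro t ht
    rcases lt_or_ge t v with h1 | h1
    · exact Or.inl ⟨ht.1, h1⟩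
    · exact Or.inr ⟨h1, ht.2⟩
  refine (lintegral_mono_set hsub).trans ((lintegral_union_le _ _ _).trans ?_)
  gcongr
  calc ∫⁻ t in Ico v u, gH n α h t ≤ ∫⁻ t in Ico v u, gH n α h v :=
        setLIntegral_mono' measurableSet_Ico (fun t ht => gH_anti n α h hv ht.1)
    _ = ENNReal.ofReal (u - v) * gH n α h v := by
        rw [setLIntegral_const, Real.volume_Ico, mul_comm]
    _ ≤ _ := by gcongr; linarith

lemma gH_lower (n : ℕ) (hn : 1 ≤ n) (α : ℝ) (hα : 0 < α)
    (h : ℝ → ℝ) (hpos : ∀ s : ℝ, 0 < s → 0 < h s)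
    (hmono : MonotoneOn h (Ioi (0 : ℝ))) {R : ℝ} (hR : 0 < R) :
    ENNReal.ofReal ((R / 2) ^ α / (2 * h R)) ≤ gH n α h ((R ^ n)⁻¹) := by
  have hn0 : (n : ℝ) ≠ 0 := by positivity
  have e : ((R ^ n)⁻¹ : ℝ) ^ (-(1 / (n : ℝ))) = R := by
    rw [Real.rpow_neg (by positivity), Real.inv_rpow (by positivity), inv_inv, one_div,
      Real.pow_rpow_inv_natCast hR.le (by omega)]
  unfold gH
  rw [e]
  have hhR := hpos R hR
  calc ENNReal.ofReal ((R / 2) ^ α / (2 * h R))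
      = ∫⁻ r in Ioo (R/2) R, ENNReal.ofReal ((R / 2) ^ α / (R * h R)) := by
        rw [setLIntegral_const, Real.volume_Ioo, ← ENNReal.ofReal_mul (by positivity)]
        congr 1
        field_simp
        ring
    _ ≤ ∫⁻ r in Ioo (R/2) R, ENNReal.ofReal (r ^ (α - 1) / h r) := by
        refine setLIntegral_mono' measurableSet_Ioo (fun r hr => ?_)
        apply ENNReal.ofReal_le_ofReal
        have hr0 : 0 < r := by linarith [hr.1]
        have h1 : h r ≤ h R := hmono hr0 hR hr.2.le
        have h2 := hpos r hr0
        rw [Real.rpow_sub_one hr0.ne', div_div]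
        have h3 : (R/2)^α ≤ r ^ α := Real.rpow_le_rpow (by positivity) hr.1.le hα.le
        have h4 : r ≤ R := hr.2.le
        gcongr
    _ ≤ _ := lintegral_mono_set (Ioo_subset_Ioo_left (by positivity))

/-- the kernel -/
def kerK (n : ℕ) (α : ℝ) (h : ℝ → ℝ) (r : ℝ) : ℝ≥0∞ :=
  ENNReal.ofReal (h r / r ^ ((n : ℝ) + α))

lemma kerK_anti (n : ℕ) (hn : 1 ≤ n) (α : ℝ) (hα : 0 < α)
    (h : ℝ → ℝ) (hpos : ∀ s : ℝ, 0 < s → 0 < h s)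
    (hmono' : MonotoneOn (fun s => s / h s) (Ioi (0 : ℝ))) {r s : ℝ} (hr : 0 < r) (hrs : r ≤ s) :
    kerK n α h s ≤ kerK n α h r := by
  have hs : 0 < s := hr.trans_le hrs
  have h1 : r / h r ≤ s / h s := hmono' hr hs hrs
  have hr' := hpos r hr
  have hs' := hpos s hs
  apply ENNReal.ofReal_le_ofReal
  have h2 : h s / s ≤ h r / r := by
    have := inv_anti₀ (by positivity) h1
    simpa using this
  have hn1 : (1:ℝ) ≤ n := by exact_mod_cast hn
  have h3 : r ^ ((n:ℝ) + α - 1) ≤ s ^ ((n:ℝ) + α - 1) :=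
    Real.rpow_le_rpow hr.le hrs (by linarith)
  have key : ∀ x : ℝ, 0 < x → h x / x ^ ((n:ℝ)+α) = (h x / x) / x ^ ((n:ℝ)+α-1) := by
    intro x hx
    rw [Real.rpow_sub_one hx.ne']
    field_simp
  rw [key s hs, key r hr]
  have : 0 < r ^ ((n:ℝ) + α - 1) := by positivity
  gcongr

lemma kerK_meas (n : ℕ) (α : ℝ) (hα : 0 < α)
    (h : ℝ → ℝ) (hpos : ∀ s : ℝ, 0 < s → 0 < h s)
    (hmono : MonotoneOn h (Ioi (0 : ℝ))) :
    Measurable (fun p : EuclideanSpace ℝ (Fin n) × EuclideanSpace ℝ (Fin n) =>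
      kerK n α h (dist p.1 p.2)) := by
  let H : ℝ → ℝ := fun s => if 0 < s then h s else 0
  have hH : Monotone H := by
    intro a b hab
    simp only [H]
    split_ifs with h1 h2 h2
    · exact hmono h1 h2 hab
    · linarith
    · exact (hpos b h2).le
    · exact le_rfl
  have e : (fun p : EuclideanSpace ℝ (Fin n) × EuclideanSpace ℝ (Fin n) =>
      kerK n α h (dist p.1 p.2)) = fun p => ENNReal.ofReal (H (dist p.1 p.2) /
        dist p.1 p.2 ^ ((n : ℝ) + α)) := by
    funext p
    unfold kerK
    rcases (dist_nonneg (x := p.1) (y := p.2)).eq_or_lt with h0 | h0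
    · rw [← h0, Real.zero_rpow (by positivity)]; simp
    · simp [H, h0]
  rw [e]
  have := hH.measurable
  fun_prop

lemma iso (n : ℕ) (hn : 1 ≤ n) (α : ℝ) (hα : 0 < α)
    (h : ℝ → ℝ) (hpos : ∀ s : ℝ, 0 < s → 0 < h s)
    (hmono : MonotoneOn h (Ioi (0 : ℝ)))
    (hmono' : MonotoneOn (fun s => s / h s) (Ioi (0 : ℝ))) :
    ∃ C : ℝ, 0 < C ∧ ∀ A : Set (EuclideanSpace ℝ (Fin n)), MeasurableSet A →
      volume A ≠ 0 → volume A ≠ ∞ →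
      1 ≤ ENNReal.ofReal C * (∫⁻ x in A, ∫⁻ y in Aᶜ, kerK n α h (dist x y)) *
        PhiH n α h ((volume A).toReal)⁻¹ := by
  have hn0 : (n : ℝ) ≠ 0 := by positivity
  obtain ⟨ρ, hρ1, hρ⟩ : ∃ ρ : ℝ, 1 ≤ ρ ∧
      2 ≤ ENNReal.ofReal ρ * volume (Metric.ball (0 : EuclideanSpace ℝ (Fin n)) 1) := by
    have hb : 0 < volume (Metric.ball (0 : EuclideanSpace ℝ (Fin n)) 1) :=
      Metric.measure_ball_pos _ _ one_pos
    have hb' : volume (Metric.ball (0 : EuclideanSpace ℝ (Fin n)) 1) < ∞ :=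
      measure_ball_lt_top
    set b := (volume (Metric.ball (0 : EuclideanSpace ℝ (Fin n)) 1)).toReal with hbdef
    have hbp : 0 < b := ENNReal.toReal_pos hb.ne' hb'.ne
    refine ⟨max 1 (2 / b), le_max_left _ _, ?_⟩
    rw [← ENNReal.ofReal_toReal hb'.ne, ← hbdef, ← ENNReal.ofReal_mul (by positivity)]
    have : (2 : ℝ≥0∞) = ENNReal.ofReal 2 := by simp
    rw [this]
    apply ENNReal.ofReal_le_ofReal
    calc (2:ℝ) = 2 / b * b := by field_simp
      _ ≤ _ := by gcongr; exact le_max_right _ _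
  have hρ0 : 0 < ρ := by linarith
  refine ⟨2 ^ (α + 1) * ρ ^ ((n : ℝ) + α), by positivity, ?_⟩
  intro A hA hA0 hAt
  set m := (volume A).toReal with hm
  have hm0 : 0 < m := ENNReal.toReal_pos hA0 hAt
  have hmA : volume A = ENNReal.ofReal m := (ENNReal.ofReal_toReal hAt).symm
  set R := m ^ ((n:ℝ)⁻¹) with hRdef
  have hR : 0 < R := by positivity
  have hRn : R ^ n = m := Real.rpow_inv_natCast_pow hm0.le (by omega)
  have hΦ : ENNReal.ofReal (m⁻¹ * ((R / 2) ^ α / (2 * h R))) ≤ PhiH n α h m⁻¹ := by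
    rw [ENNReal.ofReal_mul (by positivity)]
    refine le_trans ?_ (mul_gH_le n α h m⁻¹)
    gcongr
    rw [← hRn]
    exact gH_lower n hn α hα h hpos hmono hR
  have hper : ENNReal.ofReal (m * (m * (h (ρ * R) / (ρ * R) ^ ((n : ℝ) + α)))) ≤
      ∫⁻ x in A, ∫⁻ y in Aᶜ, kerK n α h (dist x y) := by
    have hρR : 0 < ρ * R := by positivity
    calc ENNReal.ofReal (m * (m * (h (ρ * R) / (ρ * R) ^ ((n : ℝ) + α))))
        = ∫⁻ x in A, ENNReal.ofReal (m * (h (ρ * R) / (ρ * R) ^ ((n : ℝ) + α))) := by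
          rw [setLIntegral_const, hmA, ENNReal.ofReal_mul hm0.le, mul_comm]
      _ ≤ _ := by
          refine setLIntegral_mono' hA (fun x hx => ?_)
          have hball : ENNReal.ofReal m ≤ volume (Metric.ball x (ρ * R) \ A) := by
            refine le_trans ?_ le_measure_sdiff
            rw [hmA]
            apply ENNReal.le_sub_of_add_le_right ENNReal.ofReal_ne_top
            rw [Measure.addHaar_ball_of_pos _ _ hρR, finrank_euclideanSpace_fin, mul_pow, hRn,
              ENNReal.ofReal_mul (by positivity)]
            calc ENNReal.ofReal m + ENNReal.ofReal m = 2 * ENNReal.ofReal m := by ring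
              _ ≤ (ENNReal.ofReal ρ * volume (Metric.ball (0 : EuclideanSpace ℝ (Fin n)) 1))
                  * ENNReal.ofReal m := by gcongr
              _ ≤ (ENNReal.ofReal (ρ ^ n) *
                    volume (Metric.ball (0 : EuclideanSpace ℝ (Fin n)) 1))
                  * ENNReal.ofReal m := by
                  gcongr
                  exact le_self_pow₀ hρ1 (by omega)
              _ = _ := by ring
          calc ENNReal.ofReal (m * (h (ρ * R) / (ρ * R) ^ ((n : ℝ) + α)))
              = kerK n α h (ρ * R) * ENNReal.ofReal m := by
                rw [ENNReal.ofReal_mul hm0.le, mul_comm]; rfl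
            _ ≤ kerK n α h (ρ * R) * volume (Metric.ball x (ρ * R) \ A) := by gcongr
            _ = ∫⁻ y in Metric.ball x (ρ * R) \ A, kerK n α h (ρ * R) := by
                rw [setLIntegral_const]
            _ ≤ ∫⁻ y in Metric.ball x (ρ * R) \ A, kerK n α h (dist x y) := by
                refine setLIntegral_mono' (measurableSet_ball.diff hA) (fun y hy => ?_)
                have hne : x ≠ y := fun e => hy.2 (e ▸ hx)
                refine kerK_anti n hn α hα h hpos hmono' (dist_pos.2 hne) ?_
                rw [dist_comm]; exact (Metric.mem_ball.1 hy.1).le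
            _ ≤ _ := lintegral_mono_set (fun y hy => hy.2)
  have hhR := hpos R hR
  have hle : h R ≤ h (ρ * R) := hmono hR (show 0 < ρ * R by positivity) (by nlinarith)
  calc (1 : ℝ≥0∞) ≤ ENNReal.ofReal ((2 ^ (α + 1) * ρ ^ ((n : ℝ) + α)) *
        (m * (m * (h (ρ * R) / (ρ * R) ^ ((n : ℝ) + α)))) *
          (m⁻¹ * ((R / 2) ^ α / (2 * h R)))) := by
        rw [← ENNReal.ofReal_one]
        apply ENNReal.ofReal_le_ofReal
        have e : (2 ^ (α + 1) * ρ ^ ((n : ℝ) + α)) *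
          (m * (m * (h (ρ * R) / (ρ * R) ^ ((n : ℝ) + α)))) *
          (m⁻¹ * ((R / 2) ^ α / (2 * h R))) = h (ρ * R) / h R := by
          rw [Real.mul_rpow hρ0.le hR.le, Real.rpow_add hR, Real.rpow_natCast, hRn,
            Real.div_rpow hR.le (by norm_num), Real.rpow_add_one (by norm_num)]
          field_simp
        rw [e, one_le_div hhR]
        exact hle
    _ = ENNReal.ofReal (2 ^ (α + 1) * ρ ^ ((n : ℝ) + α)) *
        ENNReal.ofReal (m * (m * (h (ρ * R) / (ρ * R) ^ ((n : ℝ) + α)))) *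
          ENNReal.ofReal (m⁻¹ * ((R / 2) ^ α / (2 * h R))) := by
        have := hpos (ρ * R) (by positivity)
        rw [ENNReal.ofReal_mul (by positivity), ENNReal.ofReal_mul (by positivity)]
    _ ≤ _ := by gcongr

lemma Nh_mono (n : ℕ) (α : ℝ) (h : ℝ → ℝ) : Monotone (Nh n α h) := by
  intro a b hab
  unfold Nh
  refine le_iInf₂ (fun u hu => iInf₂_le u ⟨hu.1, le_trans ?_ hu.2⟩)
  exact_mod_cast hab

lemma Nh_pos (n : ℕ) (α : ℝ) (h : ℝ → ℝ) (hΦ : PhiH n α h 1 < ∞) {s : ℝ≥0} (hs : 0 < s) :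
    0 < Nh n α h s := by
  obtain ⟨δ, hδ, H⟩ := exists_pos_setLIntegral_lt_of_measure_lt
    (μ := volume.restrict (Ioo (0:ℝ) 1)) (f := gH n α h) hΦ.ne
    (ε := s) (by exact_mod_cast hs.ne')
  obtain ⟨u, hu0, hu⟩ : ∃ u : ℝ, 0 < u ∧ u ≤ 1 ∧ ENNReal.ofReal u < δ := by
    obtain ⟨q, hq0, hq⟩ := ENNReal.lt_iff_exists_nnreal_btwn.1 hδ
    have hq0' : 0 < (q : ℝ) := by exact_mod_cast hq0
    refine ⟨min 1 q, by positivity, min_le_left _ _, lt_of_le_of_lt ?_ hq⟩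
    rw [← ENNReal.ofReal_coe_nnreal]
    exact ENNReal.ofReal_le_ofReal (min_le_right _ _)
  have h1 : PhiH n α h u < s := by
    have h2 := H (Ioo 0 u) (by
      refine lt_of_le_of_lt (Measure.restrict_apply_le _ _) ?_
      simpa using hu.2)
    rw [Measure.restrict_restrict measurableSet_Ioo,
      inter_eq_left.2 (Ioo_subset_Ioo_right hu.1)] at h2
    exact h2
  refine lt_of_lt_of_le (ENNReal.ofReal_pos.2 hu0) ?_
  unfold Nh
  refine le_iInf₂ (fun w hw => ENNReal.ofReal_le_ofReal ?_)
  by_contra hcon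
  push Not at hcon
  exact absurd (hw.2.trans (PhiH_mono n α h hcon.le)) (not_le.2 h1)

lemma Nh_le (n : ℕ) (α : ℝ) (h : ℝ → ℝ) {s : ℝ≥0} {v : ℝ} (hv : 0 < v)
    (hs : (s : ℝ≥0∞) ≤ PhiH n α h v) : Nh n α h s ≤ ENNReal.ofReal v :=
  iInf₂_le v ⟨hv, hs⟩

lemma Nh_zero (n : ℕ) (α : ℝ) (h : ℝ → ℝ) : Nh n α h 0 = 0 := by
  refine le_antisymm (ENNReal.le_of_forall_pos_le_add fun ε hε _ => ?_) bot_le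
  rw [zero_add]
  have := Nh_le n α h (s := 0) (v := ε) (by exact_mod_cast hε) (by simp)
  simpa using this

lemma level_finite (n : ℕ) (α : ℝ) (h : ℝ → ℝ) (hΦ : PhiH n α h 1 < ∞)
    (f : EuclideanSpace ℝ (Fin n) → ℝ) (hf : Measurable f)
    (hN : orliczNorm volume (Nh n α h) f < ∞) {t : ℝ} (ht : 0 < t) :
    volume {x | t < |f x|} ≠ ∞ := by
  unfold orliczNorm at hN
  obtain ⟨r, hr⟩ := iInf_lt_iff.1 hN
  obtain ⟨⟨hr0, hr1⟩, -⟩ := iInf_lt_iff.1 hr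
  have hA : MeasurableSet {x | t < |f x|} := measurableSet_lt measurable_const hf.abs
  let T : ℝ≥0 := ⟨t, ht.le⟩
  have hT : 0 < T / r := div_pos (show (0:ℝ) < T from ht) hr0
  have hp := Nh_pos n α h hΦ hT
  have : Nh n α h (T / r) * volume {x | t < |f x|} ≤ 1 := by
    rw [← setLIntegral_const]
    refine le_trans (le_trans (setLIntegral_mono' hA (fun x hx => ?_))
      (setLIntegral_le_lintegral _ _)) hr1
    apply Nh_mono
    gcongr
    have : t ≤ ‖f x‖ := le_of_lt hx
    exact this
  intro htop
  rw [htop, ENNReal.mul_top hp.ne'] at this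
  simp at this

/-- coarea-type perimeter of the level `t` -/
def Pt (n : ℕ) (α : ℝ) (h : ℝ → ℝ) (f : EuclideanSpace ℝ (Fin n) → ℝ) (t : ℝ) : ℝ≥0∞ :=
  ∫⁻ x in {x | t < |f x|}, ∫⁻ y in {x | t < |f x|}ᶜ, kerK n α h (dist x y)

/-- integrand -/
def Ft (n : ℕ) (α : ℝ) (h : ℝ → ℝ) (f : EuclideanSpace ℝ (Fin n) → ℝ) (t : ℝ)
    (p : EuclideanSpace ℝ (Fin n) × EuclideanSpace ℝ (Fin n)) : ℝ≥0∞ :=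
  {q : ℝ × (EuclideanSpace ℝ (Fin n) × EuclideanSpace ℝ (Fin n)) |
    q.1 < |f q.2.1| ∧ |f q.2.2| ≤ q.1}.indicator (fun q => kerK n α h (dist q.2.1 q.2.2)) (t, p)

lemma Ft_meas (n : ℕ) (α : ℝ) (hα : 0 < α)
    (h : ℝ → ℝ) (hpos : ∀ s : ℝ, 0 < s → 0 < h s)
    (hmono : MonotoneOn h (Ioi (0 : ℝ)))
    (f : EuclideanSpace ℝ (Fin n) → ℝ) (hf : Measurable f) :
    Measurable (Function.uncurry (Ft n α h f)) := by
  have hS : MeasurableSet {q : ℝ × (EuclideanSpace ℝ (Fin n) × EuclideanSpace ℝ (Fin n)) |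
    q.1 < |f q.2.1| ∧ |f q.2.2| ≤ q.1} := by
    have h1 : Measurable fun q : ℝ × (EuclideanSpace ℝ (Fin n) × EuclideanSpace ℝ (Fin n)) =>
        |f q.2.1| := (hf.comp (measurable_fst.comp measurable_snd)).abs
    have h2 : Measurable fun q : ℝ × (EuclideanSpace ℝ (Fin n) × EuclideanSpace ℝ (Fin n)) =>
        |f q.2.2| := (hf.comp (measurable_snd.comp measurable_snd)).abs
    exact (measurableSet_lt measurable_fst h1).inter (measurableSet_le h2 measurable_fst)
  exact ((kerK_meas n α hα h hpos hmono).comp measurable_snd).indicator hS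

lemma Pt_eq (n : ℕ) (α : ℝ) (hα : 0 < α)
    (h : ℝ → ℝ) (hpos : ∀ s : ℝ, 0 < s → 0 < h s)
    (hmono : MonotoneOn h (Ioi (0 : ℝ)))
    (f : EuclideanSpace ℝ (Fin n) → ℝ) (hf : Measurable f) (t : ℝ) :
    Pt n α h f t = ∫⁻ p, Ft n α h f t p := by
  have hA : MeasurableSet {x | t < |f x|} := measurableSet_lt measurable_const hf.abs
  have hm : Measurable (Ft n α h f t) :=
    (Ft_meas n α hα h hpos hmono f hf).comp measurable_prodMk_left
  rw [Measure.volume_eq_prod, lintegral_prod _ hm.aemeasurable]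
  unfold Pt
  rw [← lintegral_indicator hA]
  refine lintegral_congr fun x => ?_
  by_cases hx : t < |f x|
  · rw [indicator_of_mem (show x ∈ {x | t < |f x|} from hx), ← lintegral_indicator hA.compl]
    refine lintegral_congr fun y => ?_
    simp [Ft, indicator, hx]
  · rw [indicator_of_notMem (show x ∉ {x | t < |f x|} from hx)]
    simp [Ft, indicator, hx]

lemma Pt_meas (n : ℕ) (α : ℝ) (hα : 0 < α)
    (h : ℝ → ℝ) (hpos : ∀ s : ℝ, 0 < s → 0 < h s)
    (hmono : MonotoneOn h (Ioi (0 : ℝ)))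
    (f : EuclideanSpace ℝ (Fin n) → ℝ) (hf : Measurable f) :
    Measurable (Pt n α h f) := by
  rw [funext (Pt_eq n α hα h hpos hmono f hf)]
  exact (Ft_meas n α hα h hpos hmono f hf).lintegral_prod_right'

lemma coarea_s14 (n : ℕ) (α : ℝ) (hα : 0 < α)
    (h : ℝ → ℝ) (hpos : ∀ s : ℝ, 0 < s → 0 < h s)
    (hmono : MonotoneOn h (Ioi (0 : ℝ)))
    (f : EuclideanSpace ℝ (Fin n) → ℝ) (hf : Measurable f) :
    ∫⁻ t, Pt n α h f t ≤ ∫⁻ x, (∫⁻ y, (‖f x - f y‖₊ : ℝ≥0∞) * kerK n α h (dist x y)) := by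
  have hF := Ft_meas n α hα h hpos hmono f hf
  rw [funext (Pt_eq n α hα h hpos hmono f hf), lintegral_lintegral_swap hF.aemeasurable,
    Measure.volume_eq_prod, lintegral_prod (fun p => ∫⁻ t, Ft n α h f t p)
      (Measurable.lintegral_prod_left' hF).aemeasurable]
  refine lintegral_mono fun x => lintegral_mono fun y => ?_
  have e : ∀ t, Ft n α h f t (x, y) =
      (Ico |f y| |f x|).indicator (fun _ => kerK n α h (dist x y)) t := by
    intro t
    simp [Ft, indicator, and_comm]
  dsimp only
  rw [lintegral_congr e, lintegral_indicator measurableSet_Ico, setLIntegral_const,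
    Real.volume_Ico, mul_comm]
  gcongr
  rw [← enorm_eq_nnnorm, ← ofReal_norm]
  exact ENNReal.ofReal_le_ofReal (abs_sub_abs_le_abs_sub _ _)

lemma pointwise (n : ℕ) (α : ℝ) (h : ℝ → ℝ) {C E : ℝ} (hC : 0 < C) (hE : 0 < E)
    (m : ℝ → ℝ≥0∞) (P : ℝ → ℝ≥0∞) (hmm : Measurable m) (hPm : Measurable P) {s : ℝ≥0}
    (hm0 : ∀ t ∈ Ioo (0:ℝ) s, m t ≠ 0) (hmt : ∀ t ∈ Ioo (0:ℝ) s, m t ≠ ∞)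
    (hiso : ∀ t ∈ Ioo (0:ℝ) s, 1 ≤ ENNReal.ofReal C * P t * PhiH n α h ((m t).toReal)⁻¹)
    (hPE : ∫⁻ t in Ioo (0:ℝ) s, P t ≤ ENNReal.ofReal E) :
    Nh n α h (s / (2 * C * E).toNNReal) ≤
      (ENNReal.ofReal E)⁻¹ * ∫⁻ t in Ioo (0:ℝ) s, (m t)⁻¹ * P t := by
  have hE0 : ENNReal.ofReal E ≠ 0 := by simpa using hE
  set I := ∫⁻ t in Ioo (0:ℝ) s, (m t)⁻¹ * P t with hI
  have hmeas : Measurable fun t => (m t)⁻¹ * P t := hmm.inv.mul hPm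
  have hsI : (s : ℝ≥0∞) = ∫⁻ t in Ioo (0:ℝ) s, 1 := by
    rw [setLIntegral_const, Real.volume_Ioo]; simp
  by_cases hI0 : I = 0
  · have h1 : ∀ᵐ t ∂(volume.restrict (Ioo (0:ℝ) s)), P t = 0 := by
      have h2 := (lintegral_eq_zero_iff hmeas).1 hI0
      filter_upwards [h2, ae_restrict_mem measurableSet_Ioo] with t h3 h4
      have h5 : (m t)⁻¹ * P t = 0 := h3
      rcases mul_eq_zero.1 h5 with h6 | h6
      · exact absurd (ENNReal.inv_eq_zero.1 h6) (hmt t h4)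
      · exact h6
    have hs0 : (s : ℝ≥0∞) = 0 := by
      refine le_antisymm ?_ bot_le
      rw [hsI]
      refine (lintegral_mono_ae (g := fun _ => 0) ?_).trans (by simp)
      filter_upwards [h1, ae_restrict_mem measurableSet_Ioo] with t h3 h4
      have := hiso t h4
      simp [h3] at this
    have hs0' : s = 0 := by exact_mod_cast hs0
    rw [hs0', zero_div, Nh_zero]
    exact bot_le
  set v := (ENNReal.ofReal E)⁻¹ * I with hv
  by_cases hvt : v = ∞
  · rw [hvt]; exact le_top
  have hv0 : v ≠ 0 := mul_ne_zero (ENNReal.inv_ne_zero.2 ENNReal.ofReal_ne_top) hI0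
  have hvr : 0 < v.toReal := ENNReal.toReal_pos hv0 hvt
  rw [← ENNReal.ofReal_toReal hvt]
  apply Nh_le n α h hvr
  have hIv : I = ENNReal.ofReal E * ENNReal.ofReal v.toReal := by
    rw [ENNReal.ofReal_toReal hvt, hv, ← mul_assoc,
      ENNReal.mul_inv_cancel hE0 ENNReal.ofReal_ne_top, one_mul]
  have main : (s : ℝ≥0∞) ≤ ENNReal.ofReal (2 * C * E) * PhiH n α h v.toReal := by
    calc (s : ℝ≥0∞) = ∫⁻ t in Ioo (0:ℝ) s, 1 := hsI
      _ ≤ ∫⁻ t in Ioo (0:ℝ) s, ((ENNReal.ofReal C * PhiH n α h v.toReal) * P t +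
          (ENNReal.ofReal C * gH n α h v.toReal) * ((m t)⁻¹ * P t)) := by
          refine setLIntegral_mono' measurableSet_Ioo fun t ht => ?_
          refine (hiso t ht).trans ?_
          calc _ ≤ ENNReal.ofReal C * P t * (PhiH n α h v.toReal +
                ENNReal.ofReal ((m t).toReal)⁻¹ * gH n α h v.toReal) := by
                gcongr; exact PhiH_le n α h hvr
            _ = _ := by
                rw [ENNReal.ofReal_inv_of_pos (ENNReal.toReal_pos (hm0 t ht) (hmt t ht)),
                  ENNReal.ofReal_toReal (hmt t ht)]
                ring
      _ = (ENNReal.ofReal C * PhiH n α h v.toReal) * (∫⁻ t in Ioo (0:ℝ) s, P t) +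
          (ENNReal.ofReal C * gH n α h v.toReal) * I := by
          rw [lintegral_add_left (hPm.const_mul _), lintegral_const_mul _ hPm,
            lintegral_const_mul _ hmeas]
      _ ≤ (ENNReal.ofReal C * PhiH n α h v.toReal) * ENNReal.ofReal E +
          (ENNReal.ofReal C * ENNReal.ofReal E) *
            (ENNReal.ofReal v.toReal * gH n α h v.toReal) := by
          rw [hIv]
          refine add_le_add (by gcongr) (le_of_eq (by ring))
      _ ≤ (ENNReal.ofReal C * PhiH n α h v.toReal) * ENNReal.ofReal E +
          (ENNReal.ofReal C * ENNReal.ofReal E) * PhiH n α h v.toReal := by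
          gcongr; exact mul_gH_le n α h _
      _ = _ := by
          rw [ENNReal.ofReal_mul (by positivity), ENNReal.ofReal_mul (by positivity)]
          simp only [ENNReal.ofReal_ofNat]
          ring
  have hpos : 0 < (2 * C * E).toNNReal := by simp; positivity
  rw [ENNReal.coe_div hpos.ne']
  exact ENNReal.div_le_of_le_mul' main

/-- for `α ∈ (0,2)` and `h ∈ 𝓗_α`, there is `C > 0` with
`‖f‖_{N_h} ≤ C ∫∫ |f(x)-f(y)| h(|x-y|)/|x-y|^{n+α} dx dy` for `f ∈ L_{N_h}(ℝⁿ)`. -/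
theorem orliczSobolev_stable_like
    (n : ℕ) (hn : 1 ≤ n) (α : ℝ) (hα : α ∈ Ioo (0 : ℝ) 2)
    (h : ℝ → ℝ) (hpos : ∀ s : ℝ, 0 < s → 0 < h s)
    (hmono : MonotoneOn h (Ioi (0 : ℝ)))
    (hmono' : MonotoneOn (fun s => s / h s) (Ioi (0 : ℝ)))
    (hΦ : ∀ s : ℝ, 0 < s → PhiH n α h s < ∞) :
    ∃ C : ℝ, 0 < C ∧
      ∀ f : EuclideanSpace ℝ (Fin n) → ℝ, Measurable f →
        orliczNorm volume (Nh n α h) f < ∞ →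
        orliczNorm volume (Nh n α h) f ≤ ENNReal.ofReal C *
          ∫⁻ x, (∫⁻ y, (‖f x - f y‖₊ : ℝ≥0∞) *
            ENNReal.ofReal (h (dist x y) / dist x y ^ ((n : ℝ) + α))) := by
  have hα0 : 0 < α := hα.1
  obtain ⟨C, hC, hiso⟩ := iso n hn α hα0 h hpos hmono hmono'
  refine ⟨2 * C, by positivity, fun f hf hN => ?_⟩
  change _ ≤ ENNReal.ofReal (2 * C) *
    ∫⁻ x, (∫⁻ y, (‖f x - f y‖₊ : ℝ≥0∞) * kerK n α h (dist x y))
  set En := ∫⁻ x, (∫⁻ y, (‖f x - f y‖₊ : ℝ≥0∞) * kerK n α h (dist x y)) with hEn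
  have hco : ∫⁻ t, Pt n α h f t ≤ En := coarea_s14 n α hα0 h hpos hmono f hf
  have hC0 : ENNReal.ofReal (2 * C) ≠ 0 := by simpa using hC
  by_cases hEt : En = ∞
  · rw [hEt, ENNReal.mul_top hC0]; exact le_top
  have key : ∀ E : ℝ, 0 < E → En ≤ ENNReal.ofReal E →
      orliczNorm volume (Nh n α h) f ≤ ENNReal.ofReal (2 * C) * ENNReal.ofReal E := by
    intro E hE hEE
    let m : ℝ → ℝ≥0∞ := fun t => volume {x | t < |f x|}
    have hmanti : Antitone m := fun a b hab => measure_mono fun x hx => lt_of_le_of_lt hab hx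
    have hmm : Measurable m := hmanti.measurable
    have hPm := Pt_meas n α hα0 h hpos hmono f hf
    have hae : ∀ᵐ x, ∀ t : ℝ, t < |f x| → m t ≠ 0 := by
      have h1 : ∀ᵐ x, ∀ q : ℚ, (q : ℝ) < |f x| → m q ≠ 0 := by
        rw [ae_all_iff]
        intro q
        by_cases hq : m q = 0
        · have : ∀ᵐ x, ¬ ((q : ℝ) < |f x|) := by
            rw [ae_iff]; simpa using hq
          filter_upwards [this] with x hx h2
          exact absurd h2 hx
        · exact Eventually.of_forall fun x _ => hq
      filter_upwards [h1] with x hx t ht h0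
      obtain ⟨q, hq1, hq2⟩ := exists_rat_btwn ht
      exact hx q hq2 (le_antisymm ((hmanti hq1.le).trans h0.le) bot_le)
    have hfin : ∀ t : ℝ, 0 < t → m t ≠ ∞ := fun t ht =>
      level_finite n α h (hΦ 1 one_pos) f hf hN ht
    have hr : 0 < (2 * C * E).toNNReal := by simp; positivity
    have hE0 : ENNReal.ofReal E ≠ 0 := by simpa using hE
    rw [← ENNReal.ofReal_mul (by positivity)]
    refine iInf₂_le (2 * C * E).toNNReal ⟨hr, ?_⟩
    have hPE : ∫⁻ t in Ioi (0:ℝ), Pt n α h f t ≤ ENNReal.ofReal E :=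
      (setLIntegral_le_lintegral _ _).trans (hco.trans hEE)
    have hg : Measurable fun t => (m t)⁻¹ * Pt n α h f t := hmm.inv.mul hPm
    calc ∫⁻ x, Nh n α h (‖f x‖₊ / (2 * C * E).toNNReal)
        ≤ ∫⁻ x, (ENNReal.ofReal E)⁻¹ *
            ∫⁻ t in Ioo (0:ℝ) ‖f x‖₊, (m t)⁻¹ * Pt n α h f t := by
          apply lintegral_mono_ae
          filter_upwards [hae] with x hx
          refine pointwise n α h hC hE m _ hmm hPm (fun t ht => hx t ht.2)
            (fun t ht => hfin t ht.1) (fun t ht => ?_)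
            ((lintegral_mono_set Ioo_subset_Ioi_self).trans hPE)
          exact hiso _ (measurableSet_lt measurable_const hf.abs) (hx t ht.2) (hfin t ht.1)
      _ = (ENNReal.ofReal E)⁻¹ * ∫⁻ x, ∫⁻ t in Ioi (0:ℝ),
            {p : EuclideanSpace ℝ (Fin n) × ℝ | p.2 < |f p.1|}.indicator
              (fun p => (m p.2)⁻¹ * Pt n α h f p.2) (x, t) := by
          rw [lintegral_const_mul' _ _ (ENNReal.inv_ne_top.2 hE0)]
          congr 1
          refine lintegral_congr fun x => ?_
          rw [← Ioi_inter_Iio, inter_comm, ← Measure.restrict_restrict measurableSet_Iio,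
            ← lintegral_indicator measurableSet_Iio]
          rfl
      _ = (ENNReal.ofReal E)⁻¹ * ∫⁻ t in Ioi (0:ℝ), ∫⁻ x,
            {p : EuclideanSpace ℝ (Fin n) × ℝ | p.2 < |f p.1|}.indicator
              (fun p => (m p.2)⁻¹ * Pt n α h f p.2) (x, t) := by
          rw [lintegral_lintegral_swap]
          refine Measurable.aemeasurable ?_
          exact (hg.comp measurable_snd).indicator
            (measurableSet_lt measurable_snd (hf.comp measurable_fst).abs)
      _ ≤ (ENNReal.ofReal E)⁻¹ * ∫⁻ t in Ioi (0:ℝ), Pt n α h f t := by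
          gcongr with t
          have : ∀ x, {p : EuclideanSpace ℝ (Fin n) × ℝ | p.2 < |f p.1|}.indicator
              (fun p => (m p.2)⁻¹ * Pt n α h f p.2) (x, t) =
              {x | t < |f x|}.indicator (fun _ => (m t)⁻¹ * Pt n α h f t) x := fun x => rfl
          rw [lintegral_congr this,
            lintegral_indicator (measurableSet_lt measurable_const hf.abs), setLIntegral_const]
          calc (m t)⁻¹ * Pt n α h f t * m t = (m t * (m t)⁻¹) * Pt n α h f t := by ring
            _ ≤ 1 * Pt n α h f t := by gcongr; exact ENNReal.mul_inv_le_one _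
            _ = _ := one_mul _
      _ ≤ (ENNReal.ofReal E)⁻¹ * ENNReal.ofReal E := by gcongr
      _ ≤ 1 := ENNReal.inv_mul_le_one _
  refine ENNReal.le_of_forall_pos_le_add fun ε hε _ => ?_
  have hε' : (0:ℝ) < ε := by exact_mod_cast hε
  have h1 := key (En.toReal + ε / (2 * C)) (by positivity) (by
    rw [ENNReal.ofReal_add ENNReal.toReal_nonneg (by positivity), ENNReal.ofReal_toReal hEt]
    exact le_self_add)
  refine h1.trans (le_of_eq ?_)
  rw [ENNReal.ofReal_add ENNReal.toReal_nonneg (by positivity), ENNReal.ofReal_toReal hEt,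
    mul_add, ← ENNReal.ofReal_mul (by positivity), mul_div_cancel₀ _ (by positivity),
    ENNReal.ofReal_coe_nnreal]
end
end
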